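/- arXiv:2004.10526 — 2 statements merged into one kernel-verified Lean document; each statement's English description precedes it below -/
import Mathlib

section
/- Let n > 1 be an odd integer. Then, modulo [n]·Φ_n(q)^3, the following q-congruence of rational functions holds: Σ_{k=0}^{n-1} [3k-1] · ((q;q^2)_k · (q^{-1};q^2)_k^2 / ((q;q)_k^2 · (q^2;q^2)_k)) · q^{(3k-k^2)/2} ≡ [n]·q^{-(n+1)/2} - (1+q)·[n]^3 + ((n^2-1)(1-q)^2/24)·[n]^3·q^{-(n+1)/2}. -/
open Finset Polynomial

/-- The variable `q`, viewed as a rational function over `ℚ`. -/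
noncomputable def q : RatFunc ℚ := RatFunc.X

/-- The q-shifted factorial `(a; b)_n = (1-a)(1-ab)⋯(1-ab^{n-1})`. -/
noncomputable def qpoch (a b : RatFunc ℚ) (n : ℕ) : RatFunc ℚ :=
  ∏ i ∈ Finset.range n, (1 - a * b ^ i)

/-- The q-integer `[m] = (1-q^m)/(1-q)` (for an arbitrary integer `m`). -/
noncomputable def qint (m : ℤ) : RatFunc ℚ := (1 - q ^ m) / (1 - q)

/-- The q-integer `[n] = 1 + q + ⋯ + q^{n-1}` as a polynomial. -/
noncomputable def qintPoly (n : ℕ) : Polynomial ℚ := ∑ i ∈ Finset.range n, Polynomial.X ^ i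

/-- The central q-binomial coefficient `[2k choose k] = (q;q)_{2k}/(q;q)_k^2`. -/
noncomputable def qcb (k : ℕ) : RatFunc ℚ := qpoch q q (2 * k) / (qpoch q q k) ^ 2

/-- Two rational functions are congruent modulo a polynomial `P` iff `P` divides the
numerator of the reduced form of their difference. -/
def ratCongr (A B : RatFunc ℚ) (P : Polynomial ℚ) : Prop := P ∣ (A - B).num

section Telescoping

variable {F : Type*} [Field F]

/-- The ratio of consecutive summands, as a function of `x = t ^ k`. -/
def summandRatio (t u x : F) : F :=
  (1 - t ^ 2 * x ^ 3) * (1 - t * x ^ 2) * (t - u * x ^ 2) * (u * t - x ^ 2) /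
    ((t - x ^ 3) * (1 - t ^ 2 * x ^ 2) * (u - t * x) * (1 - t * u * x) * x)

/-- The summand deformed by `u`; the original summand is the case `u = 1`. -/
def deformedSummand (t u : F) : ℕ → F
  | 0 => -1 / t
  | k + 1 => deformedSummand t u k * summandRatio t u (t ^ k)

/-- The quotient of the summands at `u * t ^ 2` and at `u`. -/
def shiftRatio (t u x : F) : F :=
  (t - u * x ^ 2) * (u * t ^ 3 - 1) * (u - x) * (u * t - x) * (1 - t * u) * (1 - t ^ 2 * u) /
    ((t - u) * (u * t ^ 3 - x ^ 2) * (u - 1) * (u * t - 1) * (1 - u * x * t) * (1 - u * x * t ^ 2))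

/-- The rational certificate of the telescoping relation. -/
def certificate (t u x : F) : F :=
  (u ^ 2 * t ^ 2 - 1) * (u * t ^ 2 - 1) * t * x * (1 - x ^ 2) * (u - x) * (t ^ 2 - x) /
    ((u - t) * (t - x ^ 3) * (u * t ^ 3 - x ^ 2) * (1 - u * t * x))

theorem summandRatio_shift (t u x : F) (h0 : t ≠ 0) (hx : x ≠ 0)
   (h1 : t - u ≠ 0) (h2 : u * t ^ 3 - x ^ 2 ≠ 0) (h3 : u - 1 ≠ 0) (h4 : u * t - 1 ≠ 0)
   (h5 : 1 - u * x * t ≠ 0) (h6 : 1 - u * x * t ^ 2 ≠ 0) (h7 : t - x ^ 3 ≠ 0)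
   (h8 : 1 - t ^ 2 * x ^ 2 ≠ 0) (h9 : u - t * x ≠ 0) (h10 : u * t - x ^ 2 ≠ 0)
   (h11 : 1 - u * x * t ^ 3 ≠ 0) (h13 : u * t - x ≠ 0) :
   summandRatio t (u * t ^ 2) x * shiftRatio t u x =
     shiftRatio t u (t * x) * summandRatio t u x := by
  have e1 : u * t ^ 2 - t * x = t * (u * t - x) := by ring
  have e2 : 1 - t * (u * t ^ 2) * x = 1 - u * x * t ^ 3 := by ring
  have e3 : u * t ^ 3 - (t * x) ^ 2 = t ^ 2 * (u * t - x ^ 2) := by ring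
  have e4 : 1 - u * (t * x) * t = 1 - u * x * t ^ 2 := by ring
  have e5 : 1 - u * (t * x) * t ^ 2 = 1 - u * x * t ^ 3 := by ring
  have e6 : 1 - t * u * x = 1 - u * x * t := by ring
  have e7 : t - u * t ^ 2 * x ^ 2 = t * (1 - u * t * x ^ 2) := by ring
  have e8 : t - u * (t * x) ^ 2 = t * (1 - u * t * x ^ 2) := by ring
  have e9 : u - x * t = u - t * x := by ring
  have e10 : u * t ^ 2 * t - x ^ 2 = u * t ^ 3 - x ^ 2 := by ring
  have e11 : u * t - t * x = t * (u - x) := by ring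
  simp only [summandRatio, shiftRatio, e1, e2, e3, e4, e5, e6, e7, e8, e10, e11]
  generalize t - u = a1 at *
  generalize u * t ^ 3 - x ^ 2 = a2 at *
  generalize u - 1 = a3 at *
  generalize u * t - 1 = a4 at *
  generalize 1 - u * x * t = a5 at *
  generalize 1 - u * x * t ^ 2 = a6 at *
  generalize t - x ^ 3 = a7 at *
  generalize 1 - t ^ 2 * x ^ 2 = a8 at *
  generalize u - t * x = a9 at *
  generalize u * t - x ^ 2 = a10 at *
  generalize 1 - u * x * t ^ 3 = a11 at *
  generalize u - x = a12 at *
  generalize u * t - x = a13 at *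
  generalize 1 - t ^ 2 * x ^ 3 = a14 at *
  generalize 1 - t * x ^ 2 = a15 at *
  generalize 1 - u * t * x ^ 2 = a16 at *
  generalize t - u * x ^ 2 = a17 at *
  generalize u * t ^ 3 - 1 = a18 at *
  generalize 1 - t * u = a19 at *
  generalize 1 - t ^ 2 * u = a20 at *
  clear e1 e2 e3 e4 e5 e6 e7 e8 e9 e10 e11
  rw [div_mul_div_comm, div_mul_div_comm, div_eq_div_iff (by simp [*]) (by simp [*])]
  ring

theorem certificate_step (t u x : F) (h0 : t ≠ 0) (hx : x ≠ 0)
   (h1 : u - t ≠ 0) (h2 : u * t ^ 3 - x ^ 2 ≠ 0) (h3 : u - 1 ≠ 0) (h4 : u * t - 1 ≠ 0)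
   (h5 : 1 - u * x * t ≠ 0) (h6 : 1 - u * x * t ^ 2 ≠ 0) (h7 : t - x ^ 3 ≠ 0)
   (h8 : 1 - t ^ 2 * x ^ 2 ≠ 0) (h9 : u - t * x ≠ 0) (h10 : u * t - x ^ 2 ≠ 0)
   (h14 : 1 - t ^ 2 * x ^ 3 ≠ 0) :
   t * (1 - u) * shiftRatio t u x - (1 - u * t ^ 2) =
     certificate t u (t * x) * summandRatio t u x - certificate t u x := by
  have e3 : u * t ^ 3 - (t * x) ^ 2 = t ^ 2 * (u * t - x ^ 2) := by ring
  have e4 : 1 - u * t * (t * x) = 1 - u * x * t ^ 2 := by ring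
  have e5 : t - (t * x) ^ 3 = t * (1 - t ^ 2 * x ^ 3) := by ring
  have e6 : 1 - t * u * x = 1 - u * x * t := by ring
  have e7 : 1 - u * t * x = 1 - u * x * t := by ring
  have e8 : t - u = - (u - t) := by ring
  have e9 : t ^ 2 - t * x = t * (t - x) := by ring
  have hA : certificate t u (t * x) * summandRatio t u x =
      (u ^ 2 * t ^ 2 - 1) * (u * t ^ 2 - 1) * (t - x) * (1 - t * x ^ 2) * (t - u * x ^ 2) *
        (u * t ^ 3 - x ^ 2) /
      ((u - t) * (1 - u * x * t ^ 2) * (t - x ^ 3) * (1 - u * x * t) * (u * t ^ 3 - x ^ 2)) := by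
    have e10 : 1 - (t * x) ^ 2 = 1 - t ^ 2 * x ^ 2 := by ring
    simp only [summandRatio, certificate, e3, e4, e5, e6, e9, e10]
    generalize u * t ^ 3 - x ^ 2 = a2 at *
    generalize 1 - u * x * t = a5 at *
    generalize 1 - u * x * t ^ 2 = a6 at *
    generalize t - x ^ 3 = a7 at *
    generalize 1 - t ^ 2 * x ^ 2 = a8 at *
    generalize u - t * x = a9 at *
    generalize u * t - x ^ 2 = a10 at *
    generalize 1 - t ^ 2 * x ^ 3 = a14 at *
    generalize 1 - t * x ^ 2 = a15 at *
    generalize t - u * x ^ 2 = a17 at *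
    generalize t - x = a18 at *
    generalize u ^ 2 * t ^ 2 - 1 = a19 at *
    generalize u * t ^ 2 - 1 = a20 at *
    generalize u - t = a21 at *
    clear e3 e4 e5 e6 e7 e8 e9 e10
    rw [div_mul_div_comm, div_eq_div_iff (by simp [*]) (by simp [*])]
    ring
  have hB : t * (1 - u) * shiftRatio t u x =
      t * (t - u * x ^ 2) * (u * t ^ 3 - 1) * (u - x) * (u * t - x) * (t ^ 2 * u - 1) *
        (t - x ^ 3) /
      ((u - t) * (1 - u * x * t ^ 2) * (t - x ^ 3) * (1 - u * x * t) * (u * t ^ 3 - x ^ 2)) := by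
    have e10 : 1 - u = - (u - 1) := by ring
    have e11 : 1 - t * u = - (u * t - 1) := by ring
    have e12 : 1 - t ^ 2 * u = - (t ^ 2 * u - 1) := by ring
    simp only [shiftRatio, e8, e10, e11, e12]
    generalize u * t ^ 3 - x ^ 2 = a2 at *
    generalize 1 - u * x * t = a5 at *
    generalize 1 - u * x * t ^ 2 = a6 at *
    generalize t - x ^ 3 = a7 at *
    generalize u - t = a21 at *
    generalize u - 1 = a22 at *
    generalize u * t - 1 = a23 at *
    generalize t ^ 2 * u - 1 = a24 at *
    generalize u * t - x = a25 at *
    generalize u - x = a26 at *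
    generalize t - u * x ^ 2 = a27 at *
    clear e3 e4 e5 e6 e7 e8 e9 e10 e11 e12
    rw [mul_div_assoc', div_eq_div_iff (by simp [*]) (by simp [*])]
    ring
  have hC : certificate t u x =
      (u ^ 2 * t ^ 2 - 1) * (u * t ^ 2 - 1) * t * x * (1 - x ^ 2) * (u - x) * (t ^ 2 - x) *
        (1 - u * x * t ^ 2) /
      ((u - t) * (1 - u * x * t ^ 2) * (t - x ^ 3) * (1 - u * x * t) * (u * t ^ 3 - x ^ 2)) := by
    rw [certificate, e7, div_eq_div_iff (by simp [*]) (by simp [*])]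
    ring
  rw [hA, hB, hC, ← sub_div, div_sub' (by simp [*])]
  congr 1
  ring

/-- The telescoping relation at the last index, where `u * t = x ^ 2`. -/
theorem certificate_last (t y : F) (h0 : t ≠ 0) (hy : y ≠ 0)
    (h2 : 1 - t ^ 2 ≠ 0) (h3 : 1 - y ≠ 0) (h4 : 1 + y ≠ 0) (h5 : 1 - t * y ^ 2 ≠ 0)
    (h6 : 1 - t ^ 2 * y ^ 2 ≠ 0) (h7 : 1 - t ^ 3 * y ^ 3 ≠ 0) (h8 : 1 - t ^ 4 * y ^ 3 ≠ 0)
    (h9 : 1 - t ^ 2 * y ^ 3 ≠ 0) (h10 : 1 - t ^ 4 * y ^ 2 ≠ 0) (h11 : 1 - t * y ≠ 0)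
    (h12 : 1 - t ^ 5 * y ^ 3 ≠ 0) :
    certificate t (t * y ^ 2) (t * y) + t * (1 - t * y ^ 2) * shiftRatio t (t * y ^ 2) (t * y) *
      (1 + summandRatio t (t * y ^ 2 * t ^ 2) (t * y)) = 1 - t * y ^ 2 * t ^ 2 := by
  have hA : certificate t (t * y ^ 2) (t * y) =
      -((1 - t ^ 4 * y ^ 4) * (1 - t ^ 3 * y ^ 2) * (1 - t ^ 2 * y ^ 2) * (t - y)) /
        ((1 + y) * (1 - t ^ 2 * y ^ 3) * (1 - t ^ 2) * (1 - t ^ 3 * y ^ 3)) := by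
    have e1 : t * y ^ 2 - t * y = -(t * y) * (1 - y) := by ring
    have e2 : t ^ 2 - t * y = t * (t - y) := by ring
    have e3 : t * y ^ 2 - t = - t * ((1 - y) * (1 + y)) := by ring
    have e4 : t - (t * y) ^ 3 = t * (1 - t ^ 2 * y ^ 3) := by ring
    have e5 : t * y ^ 2 * t ^ 3 - (t * y) ^ 2 = - (t ^ 2 * y ^ 2) * (1 - t ^ 2) := by ring
    have e6 : 1 - t * y ^ 2 * t * (t * y) = 1 - t ^ 3 * y ^ 3 := by ring
    have e7 : (t * y ^ 2) ^ 2 * t ^ 2 - 1 = -(1 - t ^ 4 * y ^ 4) := by ring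
    have e8 : t * y ^ 2 * t ^ 2 - 1 = -(1 - t ^ 3 * y ^ 2) := by ring
    have e9 : 1 - (t * y) ^ 2 = 1 - t ^ 2 * y ^ 2 := by ring
    rw [certificate, e1, e2, e3, e4, e5, e6, e7, e8, e9]
    generalize 1 - t ^ 2 * y ^ 3 = a1 at *
    generalize 1 - t ^ 3 * y ^ 3 = a2 at *
    generalize 1 - t ^ 2 * y ^ 2 = a3 at *
    generalize 1 - t ^ 2 = a4 at *
    generalize 1 - y = a5 at *
    generalize 1 + y = a6 at *
    clear e1 e2 e3 e4 e5 e6 e7 e8 e9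
    rw [div_eq_div_iff (by simp [*]) (by simp [*])]
    ring
  have hB : shiftRatio t (t * y ^ 2) (t * y) =
      (1 + t * y ^ 2) * (1 - t ^ 4 * y ^ 2) * (1 - t * y) * (1 - t ^ 3 * y ^ 2) /
        ((1 + y) * (1 - t ^ 2) * (1 - t ^ 3 * y ^ 3) * (1 - t ^ 4 * y ^ 3)) := by
    have e1 : t * y ^ 2 - t * y = -(t * y) * (1 - y) := by ring
    have e2 : t - t * y ^ 2 * (t * y) ^ 2 = t * ((1 - t * y ^ 2) * (1 + t * y ^ 2)) := by ring
    have e3 : t - t * y ^ 2 = t * ((1 - y) * (1 + y)) := by ring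
    have e4 : t * y ^ 2 * t - t * y = -(t * y) * (1 - t * y) := by ring
    have e5 : t * y ^ 2 * t ^ 3 - (t * y) ^ 2 = - (t ^ 2 * y ^ 2) * (1 - t ^ 2) := by ring
    have e6 : 1 - t * y ^ 2 * (t * y) * t = 1 - t ^ 3 * y ^ 3 := by ring
    have e7 : 1 - t * y ^ 2 * (t * y) * t ^ 2 = 1 - t ^ 4 * y ^ 3 := by ring
    have e8 : t * y ^ 2 * t ^ 3 - 1 = -(1 - t ^ 4 * y ^ 2) := by ring
    have e9 : 1 - t * (t * y ^ 2) = 1 - t ^ 2 * y ^ 2 := by ring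
    have e10 : 1 - t ^ 2 * (t * y ^ 2) = 1 - t ^ 3 * y ^ 2 := by ring
    have e11 : t * y ^ 2 * t - 1 = -(1 - t ^ 2 * y ^ 2) := by ring
    have e12 : t * y ^ 2 - 1 = -(1 - t * y ^ 2) := by ring
    rw [shiftRatio, e1, e2, e3, e4, e5, e6, e7, e8, e9, e10, e11, e12]
    generalize 1 - t * y ^ 2 = a1 at *
    generalize 1 - t ^ 3 * y ^ 3 = a2 at *
    generalize 1 - t ^ 2 * y ^ 2 = a3 at *
    generalize 1 - t ^ 2 = a4 at *
    generalize 1 - y = a5 at *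
    generalize 1 + y = a6 at *
    generalize 1 - t ^ 4 * y ^ 3 = a7 at *
    clear e1 e2 e3 e4 e5 e6 e7 e8 e9 e10 e11 e12
    rw [div_eq_div_iff (by simp [*]) (by simp [*])]
    ring
  have hC : summandRatio t (t * y ^ 2 * t ^ 2) (t * y) =
      (1 - t ^ 3 * y ^ 2) * (1 - t ^ 4 * y ^ 4) * (1 - t ^ 2) /
        ((1 - t ^ 2 * y ^ 3) * (1 - t ^ 4 * y ^ 2) * (1 - t * y) * t) := by
    have e1 : 1 - t ^ 2 * (t * y) ^ 3 = 1 - t ^ 5 * y ^ 3 := by ring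
    have e2 : 1 - t * (t * y) ^ 2 = 1 - t ^ 3 * y ^ 2 := by ring
    have e3 : t - t * y ^ 2 * t ^ 2 * (t * y) ^ 2 = t * (1 - t ^ 4 * y ^ 4) := by ring
    have e4 : t * y ^ 2 * t ^ 2 * t - (t * y) ^ 2 = -(t ^ 2 * y ^ 2) * (1 - t ^ 2) := by ring
    have e5 : t - (t * y) ^ 3 = t * (1 - t ^ 2 * y ^ 3) := by ring
    have e6 : 1 - t ^ 2 * (t * y) ^ 2 = 1 - t ^ 4 * y ^ 2 := by ring
    have e7 : t * y ^ 2 * t ^ 2 - t * (t * y) = -(t ^ 2 * y) * (1 - t * y) := by ring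
    have e8 : 1 - t * (t * y ^ 2 * t ^ 2) * (t * y) = 1 - t ^ 5 * y ^ 3 := by ring
    rw [summandRatio, e1, e2, e3, e4, e5, e6, e7, e8]
    generalize 1 - t ^ 2 * y ^ 3 = a1 at *
    generalize 1 - t ^ 5 * y ^ 3 = a2 at *
    generalize 1 - t ^ 4 * y ^ 2 = a3 at *
    generalize 1 - t ^ 2 = a4 at *
    generalize 1 - t * y = a5 at *
    clear e1 e2 e3 e4 e5 e6 e7 e8
    rw [div_eq_div_iff (by simp [*]) (by simp [*])]
    ring
  have hD : shiftRatio t (t * y ^ 2) (t * y) * summandRatio t (t * y ^ 2 * t ^ 2) (t * y) =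
      (1 + t * y ^ 2) * (1 - t ^ 3 * y ^ 2) ^ 2 * (1 - t ^ 4 * y ^ 4) /
        ((1 + y) * (1 - t ^ 3 * y ^ 3) * (1 - t ^ 4 * y ^ 3) * (1 - t ^ 2 * y ^ 3) * t) := by
    rw [hB, hC, div_mul_div_comm, div_eq_div_iff (by simp [*]) (by simp [*])]
    generalize 1 - t ^ 2 = a1 at *
    generalize 1 - t ^ 4 * y ^ 2 = a3 at *
    generalize 1 - t * y = a5 at *
    generalize 1 - t ^ 2 * y ^ 3 = a6 at *
    generalize 1 - t ^ 3 * y ^ 3 = a7 at *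
    generalize 1 - t ^ 4 * y ^ 3 = a8 at *
    ring
  rw [mul_add, mul_one, mul_assoc (t * _), hD, hA, hB, mul_div_assoc', mul_div_assoc',
    div_add_div _ _ (by simp [*]) (by simp [*]), div_add_div _ _ (by simp [*]) (by simp [*]),
    div_eq_iff (by simp [*])]
  ring

theorem pow_sub_pow_ne_zero {t : F} (h0 : t ≠ 0) (ht : ∀ k : ℕ, 0 < k → t ^ k ≠ 1) {a b : ℕ}
    (hab : a ≠ b) : t ^ a - t ^ b ≠ 0 := by
  wlog h : a < b generalizing a b
  · rw [← neg_sub]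
    exact neg_ne_zero.mpr (this hab.symm (by omega))
  intro h'
  refine ht (b - a) (by omega) ?_
  have := sub_eq_zero.mp h'
  rw [show b = a + (b - a) by omega, pow_add] at this
  exact (mul_left_cancel₀ (pow_ne_zero a h0) (by rw [← this, mul_one]))

theorem deformedSummand_shift {t : F} (h0 : t ≠ 0) (ht : ∀ k : ℕ, 0 < k → t ^ k ≠ 1) (N : ℕ) :
    ∀ k ≤ N + 2, deformedSummand t (t ^ (2 * N + 3) * t ^ 2) k =
      deformedSummand t (t ^ (2 * N + 3)) k * shiftRatio t (t ^ (2 * N + 3)) (t ^ k) := by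
  have hne : ∀ {a b : ℕ}, a ≠ b → t ^ a - t ^ b ≠ 0 := fun h => pow_sub_pow_ne_zero h0 ht h
  intro k
  induction k with
  | zero =>
    intro _
    obtain ⟨u, hu⟩ : ∃ u, u = t ^ (2 * N + 3) := ⟨_, rfl⟩
    rw [← hu]
    have h1 : t - u ≠ 0 := by
      have := @hne 1 (2 * N + 3) (by omega)
      rwa [pow_one, ← hu] at this
    have h2 : u * t ^ 3 - 1 ≠ 0 := by
      convert @hne (2 * N + 6) 0 (by omega) using 1; rw [hu]; ring
    have h3 : u - 1 ≠ 0 := by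
      convert @hne (2 * N + 3) 0 (by omega) using 1; rw [hu]; ring
    have h4 : u * t - 1 ≠ 0 := by
      convert @hne (2 * N + 4) 0 (by omega) using 1; rw [hu]; ring
    have h5 : 1 - t * u ≠ 0 := by rw [← neg_sub, mul_comm]; exact neg_ne_zero.mpr h4
    have h6 : 1 - t ^ 2 * u ≠ 0 := by
      convert @hne 0 (2 * N + 5) (by omega) using 1; rw [hu]; ring
    have : shiftRatio t u (t ^ 0) = 1 := by
      rw [shiftRatio, div_eq_one_iff_eq]
      · ring
      · simp only [pow_zero, one_pow, mul_one, mul_comm u t, mul_comm u (t ^ 2)]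
        simp only [mul_comm u t] at h4
        clear hu
        simp [*]
    rw [this, mul_one]
    rfl
  | succ k ih =>
    intro hk
    rw [deformedSummand, deformedSummand, ih (by omega), mul_assoc, mul_assoc, pow_succ' t k]
    congr 1
    rw [mul_comm, ← mul_comm (shiftRatio t _ (t * t ^ k))]
    apply summandRatio_shift _ _ _ h0 (pow_ne_zero _ h0)
    · convert @hne 1 (2 * N + 3) (by omega) using 1; ring
    · convert @hne (2 * N + 6) (2 * k) (by omega) using 1; ring
    · convert @hne (2 * N + 3) 0 (by omega) using 1; ring
    · convert @hne (2 * N + 4) 0 (by omega) using 1; ring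
    · convert @hne 0 (2 * N + 4 + k) (by omega) using 1; ring
    · convert @hne 0 (2 * N + 5 + k) (by omega) using 1; ring
    · convert @hne 1 (3 * k) (by omega) using 1; ring
    · convert @hne 0 (2 * k + 2) (by omega) using 1; ring
    · convert @hne (2 * N + 3) (k + 1) (by omega) using 1; ring
    · convert @hne (2 * N + 4) (2 * k) (by omega) using 1; ring
    · convert @hne 0 (2 * N + 6 + k) (by omega) using 1; ring
    · convert @hne (2 * N + 4) k (by omega) using 1; ring

theorem sum_telescope {t : F} (h0 : t ≠ 0) (ht : ∀ k : ℕ, 0 < k → t ^ k ≠ 1) (N : ℕ) :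
    ∀ K ≤ N + 2,
      t * (1 - t ^ (2 * N + 3)) * ∑ k ∈ range K, deformedSummand t (t ^ (2 * N + 3) * t ^ 2) k -
        (1 - t ^ (2 * N + 3) * t ^ 2) * ∑ k ∈ range K, deformedSummand t (t ^ (2 * N + 3)) k =
      certificate t (t ^ (2 * N + 3)) (t ^ K) * deformedSummand t (t ^ (2 * N + 3)) K := by
  have hne : ∀ {a b : ℕ}, a ≠ b → t ^ a - t ^ b ≠ 0 := fun h => pow_sub_pow_ne_zero h0 ht h
  intro K
  induction K with
  | zero => simp [certificate]
  | succ K ih =>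
    intro hK
    have hstep : t * (1 - t ^ (2 * N + 3)) * shiftRatio t (t ^ (2 * N + 3)) (t ^ K) -
        (1 - t ^ (2 * N + 3) * t ^ 2) =
      certificate t (t ^ (2 * N + 3)) (t * t ^ K) * summandRatio t (t ^ (2 * N + 3)) (t ^ K) -
        certificate t (t ^ (2 * N + 3)) (t ^ K) := by
      apply certificate_step _ _ _ h0 (pow_ne_zero _ h0)
      · convert @hne (2 * N + 3) 1 (by omega) using 1; ring
      · convert @hne (2 * N + 6) (2 * K) (by omega) using 1; ring
      · convert @hne (2 * N + 3) 0 (by omega) using 1; ring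
      · convert @hne (2 * N + 4) 0 (by omega) using 1; ring
      · convert @hne 0 (2 * N + 4 + K) (by omega) using 1; ring
      · convert @hne 0 (2 * N + 5 + K) (by omega) using 1; ring
      · convert @hne 1 (3 * K) (by omega) using 1; ring
      · convert @hne 0 (2 * K + 2) (by omega) using 1; ring
      · convert @hne (2 * N + 3) (K + 1) (by omega) using 1; ring
      · convert @hne (2 * N + 4) (2 * K) (by omega) using 1; ring
      · convert @hne 0 (3 * K + 2) (by omega) using 1; ring
    rw [sum_range_succ, sum_range_succ, deformedSummand_shift h0 ht N K (by omega),
      deformedSummand, pow_succ' t K]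
    linear_combination ih (by omega) + deformedSummand t (t ^ (2 * N + 3)) K * hstep

theorem sum_deformedSummand_odd {t : F} (h0 : t ≠ 0) (ht : ∀ k : ℕ, 0 < k → t ^ k ≠ 1) (N : ℕ) :
    ∑ k ∈ range (N + 3), deformedSummand t (t ^ (2 * N + 3)) k =
      (1 - t ^ (2 * N + 3)) / ((1 - t) * t ^ (N + 2)) := by
  have hne : ∀ {a b : ℕ}, a ≠ b → t ^ a - t ^ b ≠ 0 := fun h => pow_sub_pow_ne_zero h0 ht h
  have h1 : 1 - t ≠ 0 := by convert @hne 0 1 (by omega) using 1; ring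
  induction N with
  | zero =>
    have h2 : 1 - t ^ 2 ≠ 0 := by convert @hne 0 2 (by omega) using 1; ring
    have h3 : 1 + t ≠ 0 := by
      intro h; apply h2; linear_combination (1 - t) * h
    have h4 : 1 - t ^ 4 ≠ 0 := by convert @hne 0 4 (by omega) using 1; ring
    have h5 : 1 - t ^ 5 ≠ 0 := by convert @hne 0 5 (by omega) using 1; ring
    have e1 : summandRatio t (t ^ 3) 1 = -1 := by
      rw [summandRatio, div_eq_iff]
      · ring
      · have e : t ^ 3 - t * 1 = - t * (1 - t ^ 2) := by ring
        have e' : 1 - t * t ^ 3 * 1 = 1 - t ^ 4 := by ring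
        have e'' : t - 1 ≠ 0 := by rw [← neg_sub]; exact neg_ne_zero.mpr h1
        rw [e, e']
        clear e e'
        simp [*]
    have e2 : summandRatio t (t ^ 3) t = (1 - t ^ 3) / (t * (1 - t)) := by
      have e : t ^ 3 - t * t = - t ^ 2 * (1 - t) := by ring
      have e' : t - t ^ 3 = t * (1 - t ^ 2) := by ring
      have e'' : 1 - t ^ 2 * t ^ 2 = 1 - t ^ 4 := by ring
      have e3 : 1 - t * t ^ 3 * t = 1 - t ^ 5 := by ring
      have e4 : t - t ^ 3 * t ^ 2 = t * (1 - t ^ 4) := by ring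
      have e5 : t ^ 3 * t - t ^ 2 = - t ^ 2 * (1 - t ^ 2) := by ring
      have e6 : 1 - t ^ 2 * t ^ 3 = 1 - t ^ 5 := by ring
      have e7 : 1 - t * t ^ 2 = 1 - t ^ 3 := by ring
      rw [summandRatio, e, e', e'', e3, e4, e5, e6, e7, div_eq_div_iff (by simp [*]) (by simp [*])]
      ring
    rw [sum_range_succ, sum_range_succ, sum_range_one]
    simp only [deformedSummand, mul_zero, zero_add, pow_zero, e1, e2, pow_one]
    field_simp
    ring
  | succ N ih =>
    have hlast : certificate t (t ^ (2 * N + 3)) (t ^ (N + 2)) +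
        t * (1 - t ^ (2 * N + 3)) * shiftRatio t (t ^ (2 * N + 3)) (t ^ (N + 2)) *
        (1 + summandRatio t (t ^ (2 * N + 3) * t ^ 2) (t ^ (N + 2))) =
        1 - t ^ (2 * N + 3) * t ^ 2 := by
      have hx : t ^ (N + 2) = t * t ^ (N + 1) := by ring
      have hu : t ^ (2 * N + 3) = t * (t ^ (N + 1)) ^ 2 := by ring
      have h12 : 1 - t ^ (2 * N + 2) ≠ 0 := by
        convert @hne 0 (2 * N + 2) (by omega) using 1; ring
      rw [hx, hu]
      apply certificate_last _ _ h0 (pow_ne_zero _ h0)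
      · convert @hne 0 2 (by omega) using 1; ring
      · convert @hne 0 (N + 1) (by omega) using 1; ring
      · intro h; apply h12; linear_combination (1 - t ^ (N + 1)) * h
      · convert @hne 0 (2 * N + 3) (by omega) using 1; ring
      · convert @hne 0 (2 * N + 4) (by omega) using 1; ring
      · convert @hne 0 (3 * N + 6) (by omega) using 1; ring
      · convert @hne 0 (3 * N + 7) (by omega) using 1; ring
      · convert @hne 0 (3 * N + 5) (by omega) using 1; ring
      · convert @hne 0 (2 * N + 6) (by omega) using 1; ring
      · convert @hne 0 (N + 2) (by omega) using 1; ring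
      · convert @hne 0 (3 * N + 8) (by omega) using 1; ring
    have hu : t ^ (2 * (N + 1) + 3) = t ^ (2 * N + 3) * t ^ 2 := by ring
    have hT := sum_telescope h0 ht N (N + 2) le_rfl
    rw [sum_range_succ] at ih
    have h3 : 1 - t ^ (2 * N + 3) ≠ 0 := by
      convert @hne 0 (2 * N + 3) (by omega) using 1; ring
    have key : t * (1 - t ^ (2 * N + 3)) * ∑ k ∈ range (N + 1 + 3),
        deformedSummand t (t ^ (2 * N + 3) * t ^ 2) k = (1 - t ^ (2 * N + 3) * t ^ 2) *
        ((1 - t ^ (2 * N + 3)) / ((1 - t) * t ^ (N + 2))) := by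
      rw [← ih, show N + 1 + 3 = N + 2 + 1 + 1 from rfl, sum_range_succ, sum_range_succ,
        deformedSummand.eq_2 t _ (N + 2), deformedSummand_shift h0 ht N (N + 2) le_rfl]
      linear_combination hT + deformedSummand t (t ^ (2 * N + 3)) (N + 2) * hlast
    have key2 : t * (1 - t ^ (2 * N + 3)) ≠ 0 := mul_ne_zero h0 h3
    apply mul_left_cancel₀ key2
    rw [hu, key, pow_succ t (N + 2)]
    have := pow_ne_zero (N + 2) h0
    field_simp

end Telescoping

section Interpolation

variable {F : Type*} [Field F]

/-- The part of the summand that does not depend on the deformation parameter. -/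
def summandCoeff (t : F) (k : ℕ) : F :=
  (1 - t ^ (3 * (k : ℤ) - 1)) / (1 - t) * (∏ i ∈ range k, (1 - t ^ (2 * i + 1)) / (1 - t ^ (2 * i + 2))) *
    t ^ ((3 * (k : ℤ) - (k : ℤ) ^ 2) / 2)

theorem deformedSummand_eq_prod {t : F} (h0 : t ≠ 0) (ht : ∀ k : ℕ, 0 < k → t ^ k ≠ 1) {u : F}
    (hu : u ≠ 0) (k : ℕ) :
    deformedSummand t u k = summandCoeff t k *
      ∏ i ∈ range k, ((1 - t ^ (2 * (i : ℤ) - 1) * u) * (1 - t ^ (2 * (i : ℤ) - 1) / u) /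
        ((1 - t ^ (i + 1) * u) * (1 - t ^ (i + 1) / u))) := by
  have hne : ∀ {a b : ℕ}, a ≠ b → t ^ a - t ^ b ≠ 0 := fun h => pow_sub_pow_ne_zero h0 ht h
  have h1 : 1 - t ≠ 0 := by convert @hne 0 1 (by omega) using 1; ring
  induction k with
  | zero =>
    simp only [deformedSummand, summandCoeff, range_zero, prod_empty, mul_one, Nat.cast_zero,
      mul_zero, zero_sub, zpow_neg_one, ne_eq, OfNat.ofNat_ne_zero, not_false_eq_true, zero_pow,
      sub_zero, Int.zero_ediv, zpow_zero]
    rw [eq_div_iff h1]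
    field_simp
    ring
  | succ k ih =>
    have he : (3 * ((k + 1 : ℕ) : ℤ) - ((k + 1 : ℕ) : ℤ) ^ 2) / 2 =
        (3 * (k : ℤ) - (k : ℤ) ^ 2) / 2 + (1 - k) := by
      have : (3 * ((k + 1 : ℕ) : ℤ) - ((k + 1 : ℕ) : ℤ) ^ 2) =
        (3 * (k : ℤ) - (k : ℤ) ^ 2) + (1 - k) * 2 := by push_cast; ring
      rw [this, Int.add_mul_ediv_right _ _ two_ne_zero]
    have hk : t ^ k ≠ 0 := pow_ne_zero k h0
    have hz1 : t ^ (3 * (k : ℤ) - 1) = (t ^ k) ^ 3 / t := by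
      rw [zpow_sub₀ h0, mul_comm, zpow_mul]; norm_cast
      rw [pow_one]
    have hz2 : t ^ (3 * ((k + 1 : ℕ) : ℤ) - 1) = t ^ 2 * (t ^ k) ^ 3 := by
      rw [show 3 * ((k + 1 : ℕ) : ℤ) - 1 = ((2 + k * 3 : ℕ) : ℤ) by push_cast; ring, zpow_natCast,
        pow_add, pow_mul]
    have hz3 : t ^ (1 - (k : ℤ)) = t / t ^ k := by
      rw [zpow_sub₀ h0, zpow_one, zpow_natCast]
    have hz4 : t ^ (2 * (k : ℤ) - 1) = (t ^ k) ^ 2 / t := by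
      rw [zpow_sub₀ h0, mul_comm, zpow_mul, zpow_one]; norm_cast
    have hb : 1 - t ^ (3 * (k : ℤ) - 1) = (t - (t ^ k) ^ 3) / t := by
      rw [hz1, sub_div, div_self h0]
    have hd : t - (t ^ k) ^ 3 ≠ 0 := by
      convert @hne 1 (3 * k) (by omega) using 1; ring
    have hd2 : 1 - t ^ 2 * (t ^ k) ^ 2 ≠ 0 := by
      convert @hne 0 (2 * k + 2) (by omega) using 1; ring
    rw [deformedSummand, ih, summandCoeff, summandCoeff, prod_range_succ, prod_range_succ, hb, hz2,
      he, zpow_add₀ h0, hz3, hz4, summandRatio, show t ^ (2 * k + 1) = t * (t ^ k) ^ 2 by ring,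
      show t ^ (2 * k + 2) = t ^ 2 * (t ^ k) ^ 2 by ring, pow_succ' t k]
    generalize ∏ i ∈ range k, (1 - t ^ (2 * i + 1)) / (1 - t ^ (2 * i + 2)) = A
    generalize ∏ i ∈ range k, ((1 - t ^ (2 * (i : ℤ) - 1) * u) * (1 - t ^ (2 * (i : ℤ) - 1) / u) /
        ((1 - t ^ (i + 1) * u) * (1 - t ^ (i + 1) / u))) = B
    generalize t ^ ((3 * (k : ℤ) - (k : ℤ) ^ 2) / 2) = C
    generalize t ^ k = x at *
    have e1 : 1 - x ^ 2 / t * u = (t - u * x ^ 2) / t := by field_simp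
    have e2 : 1 - x ^ 2 / t / u = (u * t - x ^ 2) / (u * t) := by field_simp
    have e3 : 1 - t * x / u = (u - t * x) / u := by field_simp
    have e4 : 1 - t * x * u = 1 - t * u * x := by ring
    rw [e1, e2, e3, e4]
    generalize u - t * x = a1
    generalize 1 - t * u * x = a2
    generalize t - x ^ 3 = a3 at *
    generalize 1 - t ^ 2 * x ^ 2 = a4 at *
    field_simp

/-- The factor `(1 - t ^ j * u) * (1 - t ^ j / u)` as a polynomial in `u + u⁻¹`. -/
noncomputable def pairFactor (t : F) (j : ℤ) : F[X] := C (1 + (t ^ j) ^ 2) - C (t ^ j) * X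

theorem eval_pairFactor (t : F) (j : ℤ) {u : F} (hu : u ≠ 0) :
    (pairFactor t j).eval (u + u⁻¹) = (1 - t ^ j * u) * (1 - t ^ j / u) := by
  simp only [pairFactor, eval_sub, eval_mul, eval_C, eval_X]
  field_simp
  ring

theorem natDegree_pairFactor_le (t : F) (j : ℤ) : (pairFactor t j).natDegree ≤ 1 := by
  unfold pairFactor
  compute_degree

/-- The sum of the first `n` deformed summands, after clearing denominators. -/
noncomputable def sumNumerator (t : F) (n : ℕ) : F[X] :=
  ∑ k ∈ range n, C (summandCoeff t k) *
    ((∏ i ∈ range k, pairFactor t (2 * (i : ℤ) - 1)) * ∏ i ∈ Ico k (n - 1), pairFactor t ((i : ℤ) + 1))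

theorem natDegree_sumNumerator_le (t : F) (n : ℕ) : (sumNumerator t n).natDegree ≤ n - 1 := by
  refine natDegree_sum_le_of_forall_le _ _ fun k hk => ?_
  have hk := mem_range.mp hk
  refine (natDegree_C_mul_le _ _).trans (natDegree_mul_le.trans ?_)
  have h1 : (∏ i ∈ range k, pairFactor t (2 * (i : ℤ) - 1)).natDegree ≤ k := by
    refine (natDegree_prod_le _ _).trans ((sum_le_sum fun i _ => natDegree_pairFactor_le _ _).trans ?_)
    simp
  have h2 : (∏ i ∈ Ico k (n - 1), pairFactor t ((i : ℤ) + 1)).natDegree ≤ n - 1 - k := by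
    refine (natDegree_prod_le _ _).trans ((sum_le_sum fun i _ => natDegree_pairFactor_le _ _).trans ?_)
    simp
  omega

theorem eval_sumNumerator {t : F} (h0 : t ≠ 0) (ht : ∀ k : ℕ, 0 < k → t ^ k ≠ 1) (n : ℕ) {u : F}
    (hu : u ≠ 0) (hD : ∀ i < n - 1, (pairFactor t ((i : ℤ) + 1)).eval (u + u⁻¹) ≠ 0) :
    (sumNumerator t n).eval (u + u⁻¹) =
      (∏ i ∈ range (n - 1), (pairFactor t ((i : ℤ) + 1)).eval (u + u⁻¹)) *
        ∑ k ∈ range n, deformedSummand t u k := by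
  rw [sumNumerator, eval_finsetSum, mul_sum]
  refine sum_congr rfl fun k hk => ?_
  have hk := mem_range.mp hk
  rw [deformedSummand_eq_prod h0 ht hu, eval_mul, eval_C, eval_mul, eval_prod, eval_prod,
    ← prod_range_mul_prod_Ico _ (show k ≤ n - 1 by omega), prod_div_distrib]
  have e1 : ∏ i ∈ range k, (1 - t ^ (2 * (i : ℤ) - 1) * u) * (1 - t ^ (2 * (i : ℤ) - 1) / u) =
      ∏ i ∈ range k, (pairFactor t (2 * (i : ℤ) - 1)).eval (u + u⁻¹) :=
    prod_congr rfl fun i _ => (eval_pairFactor t _ hu).symm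
  have e2 : ∏ i ∈ range k, (1 - t ^ (i + 1) * u) * (1 - t ^ (i + 1) / u) =
      ∏ i ∈ range k, (pairFactor t ((i : ℤ) + 1)).eval (u + u⁻¹) := by
    refine prod_congr rfl fun i _ => ?_
    rw [eval_pairFactor t _ hu]
    norm_cast
  rw [e1, e2]
  have h3 : ∏ i ∈ range k, (pairFactor t ((i : ℤ) + 1)).eval (u + u⁻¹) ≠ 0 :=
    prod_ne_zero_iff.mpr fun i hi => hD i (by have := mem_range.mp hi; omega)
  generalize u + u⁻¹ = w at *
  field_simp

/-- The symmetric sum `t ^ m + t ^ (-m)`. -/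
def symSum (t : F) (m : ℕ) : F := t ^ m + (t ^ m)⁻¹

theorem symSum_sub_symSum {t : F} (h0 : t ≠ 0) (a b : ℕ) :
    symSum t a - symSum t b = (1 - t ^ a / t ^ b) * (1 - t ^ (a + b)) / t ^ a := by
  rw [symSum, symSum, pow_add]
  field_simp
  ring

theorem symSum_ne {t : F} (h0 : t ≠ 0) (ht : ∀ k : ℕ, 0 < k → t ^ k ≠ 1) {a b : ℕ} (h : a ≠ b) :
    symSum t a - symSum t b ≠ 0 := by
  have h1 := pow_sub_pow_ne_zero h0 ht h
  have h2 := pow_sub_pow_ne_zero h0 ht (show 0 ≠ a + b by omega)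
  rw [pow_zero] at h2
  rw [symSum_sub_symSum h0]
  have h3 : 1 - t ^ a / t ^ b ≠ 0 := by
    rw [one_sub_div (pow_ne_zero _ h0)]
    exact div_ne_zero (by rw [← neg_sub]; exact neg_ne_zero.mpr h1) (pow_ne_zero _ h0)
  exact div_ne_zero (mul_ne_zero h3 h2) (pow_ne_zero _ h0)

theorem eval_pairFactor_natCast {t : F} (h0 : t ≠ 0) (i : ℕ) (w : F) :
    (pairFactor t ((i : ℤ) + 1)).eval w = t ^ (i + 1) * (symSum t (i + 1) - w) := by
  rw [show (i : ℤ) + 1 = ((i + 1 : ℕ) : ℤ) by push_cast; ring, pairFactor, zpow_natCast, symSum]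
  have := pow_ne_zero (i + 1) h0
  simp only [eval_sub, eval_mul, eval_C, eval_X]
  field_simp
  ring

theorem eval_sumNumerator_symSum_of_lt {t : F} (h0 : t ≠ 0) {n l : ℕ} (hl : 2 * l + 1 < n) :
    (sumNumerator t n).eval (symSum t (2 * l + 1)) = 0 := by
  rw [sumNumerator, eval_finsetSum]
  refine sum_eq_zero fun k hk => ?_
  have hk := mem_range.mp hk
  have hu : t ^ (2 * l + 1) ≠ 0 := pow_ne_zero _ h0
  rw [eval_mul, eval_mul, eval_prod, eval_prod]
  by_cases hkm : k ≤ 2 * l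
  · have : ∏ i ∈ Ico k (n - 1), (pairFactor t ((i : ℤ) + 1)).eval (symSum t (2 * l + 1)) = 0 := by
      refine prod_eq_zero (i := 2 * l) (mem_Ico.mpr ⟨hkm, by omega⟩) ?_
      rw [symSum, eval_pairFactor t _ hu, show ((2 * l : ℕ) : ℤ) + 1 = ((2 * l + 1 : ℕ) : ℤ) by
        push_cast; ring, zpow_natCast, div_self hu, sub_self, mul_zero]
    rw [this, mul_zero, mul_zero]
  · have : ∏ i ∈ range k, (pairFactor t (2 * (i : ℤ) - 1)).eval (symSum t (2 * l + 1)) = 0 := by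
      rcases Nat.eq_zero_or_pos l with rfl | hl0
      · refine prod_eq_zero (i := 0) (mem_range.mpr (by omega)) ?_
        rw [symSum, eval_pairFactor t _ hu]
        simp [h0]
      · refine prod_eq_zero (i := l + 1) (mem_range.mpr (by omega)) ?_
        rw [symSum, eval_pairFactor t _ hu, show 2 * ((l + 1 : ℕ) : ℤ) - 1 = ((2 * l + 1 : ℕ) : ℤ) by
          push_cast; ring, zpow_natCast, div_self hu, sub_self, mul_zero]
    rw [this, zero_mul, mul_zero]

theorem deformedSummand_eq_zero (t : F) (N : ℕ) {k : ℕ} (hk : N + 3 ≤ k) :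
    deformedSummand t (t ^ (2 * N + 3)) k = 0 := by
  induction k, hk using Nat.le_induction with
  | base =>
    rw [deformedSummand, summandRatio]
    have : t ^ (2 * N + 3) * t - (t ^ (N + 2)) ^ 2 = 0 := by ring
    rw [this]
    simp
  | succ k _ ih => rw [deformedSummand, ih, zero_mul]

theorem sum_range_deformedSummand {t : F} (h0 : t ≠ 0) (ht : ∀ k : ℕ, 0 < k → t ^ k ≠ 1)
    {n N : ℕ} (h : N + 2 ≤ n) :
    ∑ k ∈ range n, deformedSummand t (t ^ (2 * N + 3)) k =
      (1 - t ^ (2 * N + 3)) / ((1 - t) * t ^ (N + 2)) -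
        if N + 2 = n then deformedSummand t (t ^ (2 * N + 3)) n else 0 := by
  rw [← sum_deformedSummand_odd h0 ht]
  split_ifs with hn
  · subst hn
    rw [sum_range_succ _ (N + 2), add_sub_cancel_right]
  · rw [sub_zero]
    refine (sum_subset (range_subset_range.mpr (by omega)) fun k _ hk => ?_).symm
    exact deformedSummand_eq_zero t N (by simpa using hk)

theorem prod_range_two_mul {M : Type*} [CommMonoid M] (f : ℕ → M) (h : ℕ) :
    ∏ i ∈ range (2 * h), f i = ∏ a ∈ range h, (f (2 * a) * f (2 * a + 1)) := by
  induction h with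
  | zero => rfl
  | succ h ih => rw [mul_add, mul_one, prod_range_succ, prod_range_succ, ih, prod_range_succ, mul_assoc]

theorem prod_erase_range_add {M : Type*} [CommMonoid M] (f : ℕ → M) (h m j : ℕ) :
    ∏ i ∈ (range (h + m)).erase (h + j), f i =
      (∏ a ∈ range h, f a) * ∏ b ∈ (range m).erase j, f (h + b) := by
  have key : ∀ (s : Finset ℕ) (g : ℕ → M) (a : ℕ),
      ∏ x ∈ s.erase a, g x = ∏ x ∈ s, if x = a then 1 else g x := by
    intro s g a
    rw [← prod_erase s (a := a) (f := fun x => if x = a then 1 else g x) (if_pos rfl)]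
    exact prod_congr rfl fun x hx => (if_neg (ne_of_mem_erase hx)).symm
  rw [key, key, prod_range_add]
  congr 1
  · exact prod_congr rfl fun x hx => if_neg (by have := mem_range.mp hx; omega)
  · exact prod_congr rfl fun x _ => by simp

/-- The weight of the value at `t ^ (2 * h + 1 + 2 * j)` in the interpolation formula. -/
def weight (t : F) (h j : ℕ) : F :=
  (∏ a ∈ range h, (symSum t (2 * a + 2) - symSum t (2 * h + 1 + 2 * j)) /
      (symSum t (2 * a + 2) - symSum t 0)) *
    ∏ b ∈ (range (h + 1)).erase j, (symSum t 0 - symSum t (2 * h + 1 + 2 * b)) /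
      (symSum t (2 * h + 1 + 2 * j) - symSum t (2 * h + 1 + 2 * b))

theorem sum_deformedSummand_one {t : F} (h0 : t ≠ 0) (ht : ∀ k : ℕ, 0 < k → t ^ k ≠ 1) {h : ℕ}
    (hh : 1 ≤ h) :
    ∑ k ∈ range (2 * h + 1), deformedSummand t 1 k =
      ∑ j ∈ range (h + 1), weight t h j *
        ((1 - t ^ (2 * h + 1 + 2 * j)) / ((1 - t) * t ^ (h + 1 + j)) -
          if j = h then deformedSummand t (t ^ (2 * h + 1 + 2 * j)) (2 * h + 1) else 0) := by
  have hD : ∀ m : ℕ, (m = 0 ∨ 2 * h < m) → ∀ i < 2 * h + 1 - 1,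
      (pairFactor t ((i : ℤ) + 1)).eval (symSum t m) ≠ 0 := by
    intro m hm i hi
    rw [eval_pairFactor_natCast h0]
    exact mul_ne_zero (pow_ne_zero _ h0) (symSum_ne h0 ht (by omega))
  have hN := eval_sumNumerator h0 ht (2 * h + 1) one_ne_zero (by simpa [symSum] using hD 0 (by simp))
  have hinj : Set.InjOn (fun l => symSum t (2 * l + 1)) (range (h + (h + 1)) : Set ℕ) := by
    intro a _ b _ hab
    by_contra hne
    exact symSum_ne h0 ht (show 2 * a + 1 ≠ 2 * b + 1 by omega) (sub_eq_zero.mpr hab)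
  have hdeg : (sumNumerator t (2 * h + 1)).degree < #(range (h + (h + 1))) := by
    rw [card_range]
    refine lt_of_le_of_lt (degree_le_of_natDegree_le (natDegree_sumNumerator_le t _)) ?_
    exact_mod_cast (by omega : 2 * h + 1 - 1 < h + (h + 1))
  have hI := congrArg (eval (symSum t 0)) (Lagrange.eq_interpolate hinj hdeg)
  rw [Lagrange.interpolate_apply, eval_finsetSum, sum_range_add] at hI
  rw [sum_eq_zero (s := range h) (fun l hl => by
    rw [eval_mul, eval_C, eval_sumNumerator_symSum_of_lt h0 (by have := mem_range.mp hl; omega),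
      zero_mul]), zero_add] at hI
  have hD2 : ∏ i ∈ range (2 * h + 1 - 1), (pairFactor t ((i : ℤ) + 1)).eval (symSum t 0) ≠ 0 :=
    prod_ne_zero_iff.mpr fun i hi => hD 0 (Or.inl rfl) i (mem_range.mp hi)
  rw [show (1 : F) + 1⁻¹ = symSum t 0 by simp [symSum]] at hN
  refine mul_left_cancel₀ hD2 ?_
  rw [← hN, hI, mul_sum]
  refine sum_congr rfl fun j hj => ?_
  have hj := mem_range.mp hj
  have hval : ∑ k ∈ range (2 * h + 1), deformedSummand t (t ^ (2 * h + 1 + 2 * j)) k =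
      (1 - t ^ (2 * h + 1 + 2 * j)) / ((1 - t) * t ^ (h + 1 + j)) -
        if j = h then deformedSummand t (t ^ (2 * h + 1 + 2 * j)) (2 * h + 1) else 0 := by
    have := sum_range_deformedSummand h0 ht (n := 2 * h + 1) (N := h + j - 1) (by omega)
    rw [show 2 * (h + j - 1) + 3 = 2 * h + 1 + 2 * j by omega,
      show h + j - 1 + 2 = h + 1 + j by omega] at this
    rw [this]
    simp only [show h + 1 + j = 2 * h + 1 ↔ j = h by omega]
  rw [← hval, eval_mul, eval_C, show 2 * (h + j) + 1 = 2 * h + 1 + 2 * j by ring, symSum.eq_1 t (_ + _),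
    eval_sumNumerator h0 ht _ (pow_ne_zero _ h0) (hD (2 * h + 1 + 2 * j) (by omega)), Lagrange.basis,
    eval_prod, prod_erase_range_add]
  rw [mul_right_comm, ← mul_assoc (∏ _ ∈ _, eval (symSum t 0) _)]
  congr 1
  rw [weight, ← mul_assoc, ← mul_assoc]
  congr 1
  · rw [Nat.add_sub_cancel, prod_range_two_mul, prod_range_two_mul, ← prod_mul_distrib,
      ← prod_mul_distrib]
    refine prod_congr rfl fun a ha => ?_
    have ha := mem_range.mp ha
    rw [← symSum]
    simp only [eval_pairFactor_natCast h0, Lagrange.basisDivisor, eval_mul, eval_C, eval_sub, eval_X]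
    have h1 := symSum_ne h0 ht (show 2 * h + 1 + 2 * j ≠ 2 * a + 1 by omega)
    have h2 := symSum_ne h0 ht (show 2 * a + 2 ≠ 0 by omega)
    rw [show 2 * (h + j) + 1 = 2 * h + 1 + 2 * j by ring, show 2 * a + 1 + 1 = 2 * a + 2 by ring]
    field_simp
    ring
  · refine prod_congr rfl fun b _ => ?_
    simp only [Lagrange.basisDivisor, eval_mul, eval_C, eval_sub, eval_X]
    rw [show 2 * (h + j) + 1 = 2 * h + 1 + 2 * j by ring,
      show 2 * (h + b) + 1 = 2 * h + 1 + 2 * b by ring, inv_mul_eq_div]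

end Interpolation

section Values

/-- The rational function `f` is regular at `ζ`, with value `z`. -/
def HasVal (ζ : ℂ) (f : RatFunc ℚ) (z : ℂ) : Prop :=
  ∃ a b : ℚ[X], aeval ζ b ≠ 0 ∧ f * algebraMap ℚ[X] (RatFunc ℚ) b = algebraMap ℚ[X] (RatFunc ℚ) a ∧
    z * aeval ζ b = aeval ζ a

namespace HasVal

variable {ζ : ℂ} {f g : RatFunc ℚ} {z w : ℂ}

theorem of_polynomial (ζ : ℂ) (a : ℚ[X]) : HasVal ζ (algebraMap ℚ[X] (RatFunc ℚ) a) (aeval ζ a) :=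
  ⟨a, 1, by simp, by simp, by simp⟩

theorem var (ζ : ℂ) : HasVal ζ q ζ := by
  simpa [q] using of_polynomial ζ X

theorem ratCast (ζ : ℂ) (c : ℚ) : HasVal ζ (c : RatFunc ℚ) (c : ℂ) := by
  simpa using of_polynomial ζ (C c)

theorem natCast (ζ : ℂ) (c : ℕ) : HasVal ζ (c : RatFunc ℚ) (c : ℂ) := by
  simpa using ratCast ζ c

theorem intCast (ζ : ℂ) (c : ℤ) : HasVal ζ (c : RatFunc ℚ) (c : ℂ) := by
  simpa using ratCast ζ c

theorem one (ζ : ℂ) : HasVal ζ 1 1 := by simpa using natCast ζ 1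

theorem zero (ζ : ℂ) : HasVal ζ 0 0 := by simpa using natCast ζ 0

theorem add (hf : HasVal ζ f z) (hg : HasVal ζ g w) : HasVal ζ (f + g) (z + w) := by
  obtain ⟨a, b, h1, h2, h3⟩ := hf
  obtain ⟨c, d, h4, h5, h6⟩ := hg
  refine ⟨a * d + c * b, b * d, by simp [h1, h4], ?_, ?_⟩
  · simp only [map_mul, map_add, ← h2, ← h5]; ring
  · simp only [map_mul, map_add, ← h3, ← h6]; ring

theorem mul (hf : HasVal ζ f z) (hg : HasVal ζ g w) : HasVal ζ (f * g) (z * w) := by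
  obtain ⟨a, b, h1, h2, h3⟩ := hf
  obtain ⟨c, d, h4, h5, h6⟩ := hg
  refine ⟨a * c, b * d, by simp [h1, h4], ?_, ?_⟩
  · simp only [map_mul, ← h2, ← h5]; ring
  · simp only [map_mul, ← h3, ← h6]; ring

theorem neg (hf : HasVal ζ f z) : HasVal ζ (-f) (-z) := by
  simpa using (intCast ζ (-1)).mul hf

theorem sub (hf : HasVal ζ f z) (hg : HasVal ζ g w) : HasVal ζ (f - g) (z - w) := by
  simpa [sub_eq_add_neg] using hf.add hg.neg

theorem inv (hf : HasVal ζ f z) (hz : z ≠ 0) : HasVal ζ f⁻¹ z⁻¹ := by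
  obtain ⟨a, b, h1, h2, h3⟩ := hf
  have h4 : aeval ζ a ≠ 0 := by rw [← h3]; exact mul_ne_zero hz h1
  have hf0 : f ≠ 0 := by
    rintro rfl
    have : a = 0 := by simpa using h2.symm
    simp [this] at h4
  refine ⟨b, a, h4, ?_, ?_⟩
  · rw [← h2, inv_mul_cancel_left₀ hf0]
  · rw [← h3, inv_mul_cancel_left₀ hz]

theorem div (hf : HasVal ζ f z) (hg : HasVal ζ g w) (hw : w ≠ 0) : HasVal ζ (f / g) (z / w) := by
  simpa [div_eq_mul_inv] using hf.mul (hg.inv hw)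

theorem prod {ι : Type*} {s : Finset ι} {f : ι → RatFunc ℚ} {z : ι → ℂ}
    (h : ∀ i ∈ s, HasVal ζ (f i) (z i)) : HasVal ζ (∏ i ∈ s, f i) (∏ i ∈ s, z i) := by
  classical
  induction s using Finset.induction_on with
  | empty => simpa using one ζ
  | insert a s ha ih =>
    rw [prod_insert ha, prod_insert ha]
    exact (h a (mem_insert_self a s)).mul (ih fun i hi => h i (mem_insert_of_mem hi))

theorem sum {ι : Type*} {s : Finset ι} {f : ι → RatFunc ℚ} {z : ι → ℂ}
    (h : ∀ i ∈ s, HasVal ζ (f i) (z i)) : HasVal ζ (∑ i ∈ s, f i) (∑ i ∈ s, z i) := by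
  classical
  induction s using Finset.induction_on with
  | empty => simpa using zero ζ
  | insert a s ha ih =>
    rw [sum_insert ha, sum_insert ha]
    exact (h a (mem_insert_self a s)).add (ih fun i hi => h i (mem_insert_of_mem hi))

theorem pow (hf : HasVal ζ f z) (k : ℕ) : HasVal ζ (f ^ k) (z ^ k) := by
  simpa using prod (s := range k) fun _ _ => hf

theorem zpow (hf : HasVal ζ f z) (hz : z ≠ 0) (k : ℤ) : HasVal ζ (f ^ k) (z ^ k) := by
  cases k with
  | ofNat k => simpa using hf.pow k
  | negSucc k => simpa only [zpow_negSucc] using (hf.pow _).inv (pow_ne_zero _ hz)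

theorem unique (h1 : HasVal ζ f z) (h2 : HasVal ζ f w) : z = w := by
  obtain ⟨a, b, hb, hab, hz⟩ := h1
  obtain ⟨c, d, hd, hcd, hw⟩ := h2
  have : a * d = c * b := by
    apply RatFunc.algebraMap_injective ℚ
    rw [map_mul, map_mul, ← hab, ← hcd]; ring
  have := congrArg (aeval ζ) this
  rw [map_mul, map_mul, ← hz, ← hw] at this
  apply mul_right_cancel₀ (mul_ne_zero hb hd)
  linear_combination this

end HasVal

theorem q_ne_zero : q ≠ 0 := RatFunc.X_ne_zero

theorem q_pow_ne_one (k : ℕ) (hk : 0 < k) : q ^ k ≠ 1 := by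
  intro h
  have h1 : (X ^ k : ℚ[X]) = 1 := by
    apply RatFunc.algebraMap_injective ℚ
    simpa [q] using h
  have := congrArg natDegree h1
  simp at this
  omega

theorem HasVal.q_zpow {ζ : ℂ} (h : ζ ≠ 0) (k : ℤ) : HasVal ζ (q ^ k) (ζ ^ k) :=
  (HasVal.var ζ).zpow h k

theorem HasVal.one_sub_q_zpow {ζ : ℂ} (h : ζ ≠ 0) (k : ℤ) : HasVal ζ (1 - q ^ k) (1 - ζ ^ k) :=
  (HasVal.one ζ).sub (HasVal.q_zpow h k)

theorem HasVal.exists_eq_mul {d : ℕ} (hd : 0 < d) {ζ : ℂ} (hζ : IsPrimitiveRoot ζ d)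
    {f : RatFunc ℚ} (hf : HasVal ζ f 0) : ∃ g z, HasVal ζ g z ∧ f = (1 - q ^ d) * g := by
  obtain ⟨a, b, h1, h2, h3⟩ := hf
  rw [zero_mul, eq_comm] at h3
  have hmin : cyclotomic d ℚ ∣ a := by
    rw [cyclotomic_eq_minpoly_rat hζ hd]
    exact minpoly.dvd _ _ h3
  obtain ⟨c, rfl⟩ := hmin
  have hcd : cyclotomic d ℚ ∣ X ^ d - 1 := cyclotomic.dvd_X_pow_sub_one d ℚ
  obtain ⟨e, he⟩ := hcd
  have hcyc : aeval ζ (cyclotomic d ℚ) = 0 := by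
    rw [cyclotomic_eq_minpoly_rat hζ hd]
    exact minpoly.aeval _ _
  have he0 : aeval ζ e ≠ 0 := by
    intro h
    have := congrArg (fun p => aeval ζ (derivative p)) he
    simp [derivative_mul, derivative_X_pow, hcyc, h, hd.ne', hζ.ne_zero hd.ne'] at this
  have hb0 : algebraMap ℚ[X] (RatFunc ℚ) b ≠ 0 := by
    simpa using show b ≠ 0 by rintro rfl; simp at h1
  have he1 : algebraMap ℚ[X] (RatFunc ℚ) e ≠ 0 := by
    simpa using show e ≠ 0 by rintro rfl; simp at he0
  refine ⟨-(algebraMap _ _ c) / (algebraMap _ _ b * algebraMap _ _ e), _,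
    (HasVal.of_polynomial ζ c).neg.div ((HasVal.of_polynomial ζ b).mul (HasVal.of_polynomial ζ e))
      (mul_ne_zero h1 he0), ?_⟩
  have h4 : (1 - q ^ d) = -(algebraMap ℚ[X] (RatFunc ℚ) (cyclotomic d ℚ * e)) := by
    rw [← he]; simp [q]
  rw [h4, eq_comm, mul_div_assoc', div_eq_iff (mul_ne_zero hb0 he1), ← mul_assoc, h2, map_mul, map_mul]
  ring

theorem HasVal.cyclotomic_pow_dvd_num {d : ℕ} (hd : 0 < d) {ζ : ℂ} (hζ : IsPrimitiveRoot ζ d)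
    {f g : RatFunc ℚ} {z : ℂ} (hg : HasVal ζ g z) {k : ℕ} (hf : f = (1 - q ^ d) ^ k * g) :
    cyclotomic d ℚ ^ k ∣ f.num := by
  obtain ⟨a, b, h1, h2, -⟩ := hg
  have hbf : f * algebraMap _ _ b = algebraMap ℚ[X] _ ((1 - X ^ d) ^ k * a) := by
    rw [hf, mul_assoc, h2]; simp [q]
  have hpoly : f.num * b = f.denom * ((1 - X ^ d) ^ k * a) := by
    apply RatFunc.algebraMap_injective ℚ
    rw [map_mul, map_mul, ← hbf]
    have hdn : algebraMap ℚ[X] (RatFunc ℚ) f.denom ≠ 0 := by simpa using f.denom_ne_zero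
    have hn : algebraMap ℚ[X] (RatFunc ℚ) f.num = algebraMap _ _ f.denom * f :=
      (div_eq_iff hdn).mp (RatFunc.num_div_denom f) |>.trans (mul_comm _ _)
    rw [hn, mul_assoc]
  have hirr := cyclotomic.irreducible_rat hd
  have hcop : IsCoprime (cyclotomic d ℚ ^ k) b := by
    refine IsCoprime.pow_left ((hirr.coprime_iff_not_dvd).mpr fun h => h1 ?_)
    obtain ⟨c, rfl⟩ := h
    rw [map_mul, cyclotomic_eq_minpoly_rat hζ hd, minpoly.aeval, zero_mul]
  refine hcop.dvd_of_dvd_mul_right ?_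
  rw [hpoly]
  refine Dvd.dvd.mul_left (Dvd.dvd.mul_right (pow_dvd_pow_of_dvd ?_ k) _) _
  rw [← neg_sub, dvd_neg]
  exact cyclotomic.dvd_X_pow_sub_one d ℚ

end Values

section Blocks

theorem prod_erase_one_sub_pow_mul {n : ℕ} {ξ α : ℂ} (hn : 0 < n) (hξ : IsPrimitiveRoot ξ n) (hα : α ^ n = 1)
    {i₀ : ℕ} (hi₀ : i₀ < n) (h : ξ ^ i₀ * α = 1) :
    ∏ i ∈ (range n).erase i₀, (1 - ξ ^ i * α) = n := by
  have h1 := X_pow_sub_C_eq_prod hξ hn hα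
  rw [← mul_prod_erase _ _ (mem_range.mpr hi₀), h, map_one, ← mul_geom_sum] at h1
  have h2 := congrArg (eval 1) (mul_left_cancel₀ (X_sub_C_ne_zero (1 : ℂ)) (by simpa using h1))
  simpa [eval_prod, eval_finsetSum] using h2.symm

theorem HasVal.one_sub_q_zpow_mul {n : ℕ} (hn : 0 < n) {ζ : ℂ} (hζ : IsPrimitiveRoot ζ n) (c : ℤ) :
    ∃ Y, HasVal ζ Y c ∧ 1 - q ^ ((n : ℤ) * c) = (1 - q ^ n) * Y := by
  have hz : ζ ≠ 0 := hζ.ne_zero hn.ne'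
  have key : ∀ m : ℕ, ∃ Y, HasVal ζ Y m ∧ 1 - q ^ (n * m) = (1 - q ^ n) * Y := by
    intro m
    refine ⟨∑ i ∈ range m, (q ^ n) ^ i, ?_, ?_⟩
    · convert HasVal.sum (s := range m) fun i _ => ((HasVal.var ζ).pow n).pow i using 1
      simp [hζ.pow_eq_one]
    · rw [mul_neg_geom_sum, pow_mul]
  obtain ⟨m, rfl | rfl⟩ := c.eq_nat_or_neg
  · obtain ⟨Y, h1, h2⟩ := key m
    exact ⟨Y, by simpa using h1, by rw [← h2]; norm_cast⟩
  · obtain ⟨Y, h1, h2⟩ := key m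
    refine ⟨-(q ^ (-((n : ℤ) * m)) * Y), ?_, ?_⟩
    · convert ((HasVal.q_zpow hz (-((n : ℤ) * m))).mul h1).neg using 1
      rw [zpow_neg, zpow_mul, zpow_natCast ζ n, hζ.pow_eq_one]
      simp
    · have hq : q ^ (n * m) ≠ 0 := pow_ne_zero _ q_ne_zero
      have : q ^ ((n : ℤ) * m) = q ^ (n * m) := by norm_cast
      rw [mul_neg, mul_neg, mul_left_comm, ← h2, zpow_neg, this, mul_sub, inv_mul_cancel₀ hq]
      ring

/-- A product of `n` consecutive factors `1 - q ^ (a + r * i)` vanishes to first order at a primitive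
`n`-th root of unity. -/
theorem HasVal.prod_block {n r : ℕ} (hn : 0 < n) (hr : r.Coprime n) {ζ : ℂ}
    (hζ : IsPrimitiveRoot ζ n) {a c : ℤ} {i₀ : ℕ} (hi₀ : i₀ < n) (h : a + r * i₀ = n * c) :
    ∃ Y, HasVal ζ Y (c * n) ∧ ∏ i ∈ range n, (1 - q ^ (a + r * i)) = (1 - q ^ n) * Y := by
  have hz : ζ ≠ 0 := hζ.ne_zero hn.ne'
  have hpow : ∀ i : ℕ, ζ ^ (a + r * i) = (ζ ^ r) ^ i * ζ ^ a := fun i => by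
    rw [zpow_add₀ hz, mul_comm, zpow_mul]; norm_cast
  obtain ⟨Y, h1, h2⟩ := HasVal.one_sub_q_zpow_mul hn hζ c
  refine ⟨Y * ∏ i ∈ (range n).erase i₀, (1 - q ^ (a + r * i)), h1.mul ?_, ?_⟩
  · convert HasVal.prod (s := (range n).erase i₀) fun i _ => HasVal.one_sub_q_zpow hz (a + r * i) using 1
    simp only [hpow]
    refine (prod_erase_one_sub_pow_mul hn (hζ.pow_of_coprime r hr) ?_ hi₀ ?_).symm
    · rw [← zpow_natCast, ← zpow_mul, mul_comm, zpow_mul, zpow_natCast, hζ.pow_eq_one, one_zpow]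
    · rw [← hpow, h, zpow_mul, zpow_natCast, hζ.pow_eq_one, one_zpow]
  · rw [← mul_assoc, ← h2, ← h]
    exact (mul_prod_erase _ (fun i : ℕ => 1 - q ^ (a + r * i)) (mem_range.mpr hi₀)).symm

theorem exists_block_index {n r : ℕ} (hn : 0 < n) (hr : r.Coprime n) (a : ℤ) :
    ∃ i₀ < n, ∃ c : ℤ, a + r * i₀ = n * c := by
  have hn0 : NeZero n := ⟨hn.ne'⟩
  let u := ZMod.unitOfCoprime r hr
  refine ⟨(-(a : ZMod n) * (u⁻¹ : (ZMod n)ˣ)).val, ZMod.val_lt _, ?_⟩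
  change (n : ℤ) ∣ _
  rw [← ZMod.intCast_zmod_eq_zero_iff_dvd]
  have hu : (r : ZMod n) = u := (ZMod.coe_unitOfCoprime r hr).symm
  push_cast
  rw [ZMod.natCast_zmod_val, hu, mul_left_comm, Units.mul_inv]
  ring

/-- A product of `j * d` consecutive factors vanishes to order `j`. -/
theorem HasVal.prod_blocks {d r : ℕ} (hd : 0 < d) (hr : r.Coprime d) {ζ : ℂ}
    (hζ : IsPrimitiveRoot ζ d) (a : ℤ) (j : ℕ) :
    ∃ Y y, HasVal ζ Y y ∧ (0 < a → y ≠ 0) ∧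
      ∏ i ∈ range (d * j), (1 - q ^ (a + r * i)) = (1 - q ^ d) ^ j * Y := by
  induction j with
  | zero => exact ⟨1, 1, HasVal.one ζ, fun _ => one_ne_zero, by simp⟩
  | succ j ih =>
    obtain ⟨Y, y, h1, h2, h3⟩ := ih
    obtain ⟨i₀, hi₀, c, hc⟩ := exists_block_index hd hr (a + r * ((d * j : ℕ) : ℤ))
    obtain ⟨Z, h4, h5⟩ := HasVal.prod_block hd hr hζ hi₀ hc
    refine ⟨Y * Z, _, h1.mul h4, fun ha => mul_ne_zero (h2 ha) ?_, ?_⟩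
    · have hc0 : c ≠ 0 := by
        rintro rfl
        have : 0 ≤ (r : ℤ) * ((d * j : ℕ) : ℤ) := by positivity
        have : 0 ≤ (r : ℤ) * i₀ := by positivity
        rw [mul_zero] at hc
        omega
      exact mul_ne_zero (by exact_mod_cast hc0) (by exact_mod_cast hd.ne')
    · rw [mul_add, mul_one, prod_range_add, h3, pow_succ]
      have : ∏ i ∈ range d, (1 - q ^ (a + r * ((d * j + i : ℕ) : ℤ))) = (1 - q ^ d) * Z := by
        rw [← h5]
        refine prod_congr rfl fun i _ => ?_
        congr 2
        push_cast
        ring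
      rw [this]
      ring

end Blocks

section Lower

/-- The summand of the congruence. -/
noncomputable def summand (k : ℕ) : RatFunc ℚ :=
  qint (3 * (k : ℤ) - 1) *
    (qpoch q (q ^ 2) k * (qpoch (q ^ (-1 : ℤ)) (q ^ 2) k) ^ 2 /
      ((qpoch q q k) ^ 2 * qpoch (q ^ 2) (q ^ 2) k)) *
    q ^ ((3 * (k : ℤ) - (k : ℤ) ^ 2) / 2)

theorem qpoch_zpow (a : ℤ) (r k : ℕ) :
    qpoch (q ^ a) (q ^ r) k = ∏ i ∈ range k, (1 - q ^ (a + r * i)) := by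
  refine prod_congr rfl fun i _ => ?_
  rw [zpow_add₀ q_ne_zero, zpow_mul]
  norm_cast

theorem summand_eq_zpow (k : ℕ) : summand k = qint (3 * (k : ℤ) - 1) *
    (qpoch (q ^ (1 : ℤ)) (q ^ 2) k * (qpoch (q ^ (-1 : ℤ)) (q ^ 2) k) ^ 2 /
      ((qpoch (q ^ (1 : ℤ)) (q ^ 1) k) ^ 2 * qpoch (q ^ (2 : ℤ)) (q ^ 2) k)) *
    q ^ ((3 * (k : ℤ) - (k : ℤ) ^ 2) / 2) := by
  rw [summand, zpow_one, pow_one]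
  norm_cast

theorem HasVal.qpoch_zpow {ζ : ℂ} (hz : ζ ≠ 0) (a : ℤ) (r k : ℕ) :
    HasVal ζ (qpoch (q ^ a) (q ^ r) k) (∏ i ∈ range k, (1 - ζ ^ (a + r * i))) := by
  rw [_root_.qpoch_zpow]
  exact HasVal.prod fun i _ => HasVal.one_sub_q_zpow hz _

theorem HasVal.qpoch_zpow_add {d r : ℕ} (hd : 0 < d) (hr : r.Coprime d) {ζ : ℂ}
    (hζ : IsPrimitiveRoot ζ d) (a : ℤ) (j : ℕ) :
    ∃ Y y, HasVal ζ Y y ∧ (0 < a → y ≠ 0) ∧ ∀ s, ∃ Z,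
      HasVal ζ Z (∏ i ∈ range s, (1 - ζ ^ (a + r * i))) ∧
      qpoch (q ^ a) (q ^ r) (d * j + s) = (1 - q ^ d) ^ j * Y * Z := by
  obtain ⟨Y, y, h1, h2, h3⟩ := HasVal.prod_blocks hd hr hζ a j
  have hz : ζ ≠ 0 := hζ.ne_zero hd.ne'
  refine ⟨Y, y, h1, h2, fun s => ⟨∏ i ∈ range s, (1 - q ^ (a + r * ((d * j + i : ℕ) : ℤ))), ?_, ?_⟩⟩
  · convert HasVal.prod (s := range s)
      fun i _ => HasVal.one_sub_q_zpow hz (a + r * ((d * j + i : ℕ) : ℤ)) using 1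
    refine prod_congr rfl fun i _ => ?_
    have : a + r * ((d * j + i : ℕ) : ℤ) = a + r * i + d * (r * j) := by push_cast; ring
    rw [this, zpow_add₀ hz (a + r * i), zpow_mul ζ d, zpow_natCast ζ d, hζ.pow_eq_one, one_zpow, mul_one]
  · rw [_root_.qpoch_zpow, prod_range_add, h3]

theorem prod_one_sub_zpow_ne_zero {d r s : ℕ} (hr : r.Coprime d) {ζ : ℂ}
    (hζ : IsPrimitiveRoot ζ d) (hs : s < d) : ∏ i ∈ range s, (1 - ζ ^ ((r : ℤ) + r * i)) ≠ 0 := by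
  refine prod_ne_zero_iff.mpr fun i hi => ?_
  have hi := mem_range.mp hi
  rw [sub_ne_zero, ne_comm, ne_eq, hζ.zpow_eq_one_iff_dvd]
  intro h
  have h1 : d ∣ r * (i + 1) := by
    have : ((r * (i + 1) : ℕ) : ℤ) = (r : ℤ) + r * i := by push_cast; ring
    exact_mod_cast this ▸ h
  have := Nat.le_of_dvd (Nat.succ_pos i) (hr.symm.dvd_of_dvd_mul_left h1)
  omega

/-- The value of the summand at a primitive `d`-th root of unity. -/
noncomputable def summandVal (ζ : ℂ) (s : ℕ) : ℂ :=
  (1 - ζ ^ (3 * (s : ℤ) - 1)) / (1 - ζ) *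
    ((∏ i ∈ range s, (1 - ζ ^ ((1 : ℤ) + (2 : ℕ) * i))) *
        (∏ i ∈ range s, (1 - ζ ^ ((-1 : ℤ) + (2 : ℕ) * i))) ^ 2 /
      ((∏ i ∈ range s, (1 - ζ ^ ((1 : ℤ) + (1 : ℕ) * i))) ^ 2 *
        ∏ i ∈ range s, (1 - ζ ^ ((2 : ℤ) + (2 : ℕ) * i)))) *
    ζ ^ ((3 * (s : ℤ) - (s : ℤ) ^ 2) / 2)

theorem exponent_emod {d : ℕ} (hodd : Odd d) (j s : ℕ) : (d : ℤ) ∣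
    (3 * ((d * j + s : ℕ) : ℤ) - ((d * j + s : ℕ) : ℤ) ^ 2) / 2 - (3 * (s : ℤ) - (s : ℤ) ^ 2) / 2 := by
  have heven : ∀ x : ℤ, 2 * ((3 * x - x ^ 2) / 2) = 3 * x - x ^ 2 := by
    intro x
    refine Int.mul_ediv_cancel' (even_iff_two_dvd.mp ?_)
    rw [show 3 * x - x ^ 2 = 2 * x - x * (x - 1) by ring]
    exact (even_two_mul x).sub (Int.even_mul_pred_self x)
  have hcop : IsCoprime (d : ℤ) 2 := by
    rw [Int.isCoprime_iff_gcd_eq_one]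
    exact_mod_cast (Nat.coprime_two_right.mpr hodd)
  refine hcop.dvd_of_dvd_mul_left ?_
  rw [mul_sub, heven, heven]
  exact ⟨j * (3 - 2 * s - d * j), by push_cast; ring⟩

theorem HasVal.summand_add {d : ℕ} (hd : 1 < d) (hodd : Odd d) {ζ : ℂ}
    (hζ : IsPrimitiveRoot ζ d) (j : ℕ) :
    ∃ Y y, HasVal ζ Y y ∧ ∀ s < d, ∃ Z, HasVal ζ Z (summandVal ζ s) ∧ summand (d * j + s) = Y * Z := by
  have hd0 : 0 < d := by omega
  have hz : ζ ≠ 0 := hζ.ne_zero hd0.ne'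
  have h2 : Nat.Coprime 2 d := Nat.coprime_two_left.mpr hodd
  obtain ⟨A, a, hA, -, hA'⟩ := HasVal.qpoch_zpow_add hd0 h2 hζ 1 j
  obtain ⟨B, b, hB, -, hB'⟩ := HasVal.qpoch_zpow_add hd0 h2 hζ (-1) j
  obtain ⟨C, c, hC, hc, hC'⟩ := HasVal.qpoch_zpow_add hd0 (Nat.coprime_one_left d) hζ 1 j
  obtain ⟨D, e, hD, he, hD'⟩ := HasVal.qpoch_zpow_add hd0 h2 hζ 2 j
  refine ⟨A * B ^ 2 / (C ^ 2 * D), _, (hA.mul (hB.pow 2)).div ((hC.pow 2).mul hD)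
    (mul_ne_zero (pow_ne_zero _ (hc one_pos)) (he two_pos)), fun s hs => ?_⟩
  obtain ⟨A', hA1, hA2⟩ := hA' s
  obtain ⟨B', hB1, hB2⟩ := hB' s
  obtain ⟨C', hC1, hC2⟩ := hC' s
  obtain ⟨D', hD1, hD2⟩ := hD' s
  refine ⟨qint (3 * ((d * j + s : ℕ) : ℤ) - 1) * (A' * B' ^ 2 / (C' ^ 2 * D')) *
    q ^ ((3 * ((d * j + s : ℕ) : ℤ) - ((d * j + s : ℕ) : ℤ) ^ 2) / 2), ?_, ?_⟩
  · refine HasVal.mul (HasVal.mul ?_ ?_) ?_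
    · have := (HasVal.one_sub_q_zpow hz (3 * ((d * j + s : ℕ) : ℤ) - 1)).div
        ((HasVal.one ζ).sub (HasVal.var ζ)) (sub_ne_zero.mpr (hζ.ne_one hd).symm)
      rwa [show (ζ ^ (3 * ((d * j + s : ℕ) : ℤ) - 1)) = ζ ^ (3 * (s : ℤ) - 1) by
        rw [show 3 * ((d * j + s : ℕ) : ℤ) - 1 = 3 * (s : ℤ) - 1 + d * (3 * j) by push_cast; ring,
          zpow_add₀ hz, zpow_mul ζ d, zpow_natCast ζ d, hζ.pow_eq_one, one_zpow, mul_one]] at this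
    · refine (hA1.mul (hB1.pow 2)).div ((hC1.pow 2).mul hD1) (mul_ne_zero (pow_ne_zero _ ?_) ?_)
      · exact_mod_cast prod_one_sub_zpow_ne_zero (Nat.coprime_one_left d) hζ hs
      · exact_mod_cast prod_one_sub_zpow_ne_zero h2 hζ hs
    · convert HasVal.q_zpow hz _ using 1
      obtain ⟨c, hc⟩ := exponent_emod hodd j s
      rw [sub_eq_iff_eq_add.mp hc, zpow_add₀ hz, zpow_mul ζ d, zpow_natCast ζ d, hζ.pow_eq_one,
        one_zpow, one_mul]
  · have hpi : (1 - q ^ d) ^ j ≠ 0 := pow_ne_zero _ (sub_ne_zero.mpr (q_pow_ne_one d hd0).symm)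
    rw [summand_eq_zpow, hA2, hB2, hC2, hD2]
    generalize (1 - q ^ d) ^ j = p at *
    rw [show p * A * A' * (p * B * B') ^ 2 = p ^ 3 * (A * B ^ 2 * (A' * B' ^ 2)) by ring,
      show (p * C * C') ^ 2 * (p * D * D') = p ^ 3 * (C ^ 2 * D * (C' ^ 2 * D')) by ring,
      mul_div_mul_left _ _ (pow_ne_zero 3 hpi), ← div_mul_div_comm]
    ring

theorem HasVal.summand {d : ℕ} (hd : 1 < d) (hodd : Odd d) {ζ : ℂ}
    (hζ : IsPrimitiveRoot ζ d) {s : ℕ} (hs : s < d) : HasVal ζ (summand s) (summandVal ζ s) := by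
  have hz : ζ ≠ 0 := hζ.ne_zero (by omega)
  rw [summand_eq_zpow]
  refine (((HasVal.one_sub_q_zpow hz _).div ((HasVal.one ζ).sub (HasVal.var ζ))
    (sub_ne_zero.mpr (hζ.ne_one hd).symm)).mul (((HasVal.qpoch_zpow hz _ _ _).mul
    ((HasVal.qpoch_zpow hz _ _ _).pow 2)).div (((HasVal.qpoch_zpow hz _ _ _).pow 2).mul
    (HasVal.qpoch_zpow hz _ _ _)) (mul_ne_zero (pow_ne_zero _ ?_) ?_))).mul (HasVal.q_zpow hz _)
  · exact_mod_cast prod_one_sub_zpow_ne_zero (Nat.coprime_one_left d) hζ hs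
  · exact_mod_cast prod_one_sub_zpow_ne_zero (Nat.coprime_two_left.mpr hodd) hζ hs

/-- The sum over a multiple of `d` terms vanishes at a primitive `d`-th root of unity as soon as the
sum over `d` terms does. -/
theorem HasVal.sum_summand_mul {d : ℕ} (hd : 1 < d) (hodd : Odd d) {ζ : ℂ}
    (hζ : IsPrimitiveRoot ζ d) (h : HasVal ζ (∑ k ∈ range d, _root_.summand k) 0) (m : ℕ) :
    HasVal ζ (∑ k ∈ range (d * m), _root_.summand k) 0 := by
  have hval : ∑ s ∈ range d, summandVal ζ s = 0 :=
    (HasVal.sum fun s hs => HasVal.summand hd hodd hζ (mem_range.mp hs)).unique h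
  induction m with
  | zero => simpa using HasVal.zero ζ
  | succ m ih =>
    rw [mul_add, mul_one, sum_range_add]
    obtain ⟨Y, y, hY, hZ⟩ := HasVal.summand_add hd hodd hζ m
    choose Z hZ1 hZ2 using hZ
    have : ∑ s ∈ range d, _root_.summand (d * m + s) =
        Y * ∑ s ∈ (range d).attach, Z s (mem_range.mp s.2) := by
      rw [mul_sum, ← sum_attach]
      exact sum_congr rfl fun s _ => hZ2 _ _
    rw [this]
    convert ih.add (hY.mul (HasVal.sum (s := (range d).attach)
      fun s _ => hZ1 s (mem_range.mp s.2))) using 1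
    rw [sum_attach (range d) (summandVal ζ), hval]
    simp

end Lower

section Boundary

theorem summand_eq_deformedSummand (k : ℕ) : summand k = deformedSummand q 1 k := by
  rw [deformedSummand_eq_prod q_ne_zero q_pow_ne_one one_ne_zero, summandCoeff, summand, qint, qpoch,
    qpoch, qpoch, qpoch]
  have h1 : ∀ i : ℕ, q * (q ^ 2) ^ i = q ^ (2 * i + 1) := fun i => by ring
  have h2 : ∀ i : ℕ, q ^ 2 * (q ^ 2) ^ i = q ^ (2 * i + 2) := fun i => by ring
  have h3 : ∀ i : ℕ, q ^ (-1 : ℤ) * (q ^ 2) ^ i = q ^ (2 * (i : ℤ) - 1) := fun i => by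
    rw [sub_eq_add_neg, zpow_add₀ q_ne_zero, mul_comm, ← pow_mul]; norm_cast
  have h4 : ∀ i : ℕ, q * q ^ i = q ^ (i + 1) := fun i => by ring
  simp only [h1, h2, h3, h4, mul_one, div_one, prod_div_distrib, prod_mul_distrib]
  ring

theorem HasVal.deformedSummand_boundary {h : ℕ} (hh : 1 ≤ h) {ζ : ℂ}
    (hζ : IsPrimitiveRoot ζ (2 * h + 1)) :
    HasVal ζ (deformedSummand q (q ^ (2 * h + 1 + 2 * h)) (2 * h + 1)) (-ζ⁻¹) := by
  have hz : ζ ≠ 0 := hζ.ne_zero (by omega)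
  have hn : 0 < 2 * h + 1 := by omega
  have h2 : Nat.Coprime 2 (2 * h + 1) := by simp
  have h1 := Nat.coprime_one_left (2 * h + 1)
  obtain ⟨A, hA, hA'⟩ := HasVal.prod_block hn h2 hζ (a := 1) (c := 1) (i₀ := h) (by omega)
    (by push_cast; ring)
  obtain ⟨B, hB, hB'⟩ := HasVal.prod_block hn h2 hζ (a := 2) (c := 2) (i₀ := 2 * h) (by omega)
    (by push_cast; ring)
  obtain ⟨C, hC, hC'⟩ := HasVal.prod_block hn h2 hζ (a := 4 * h) (c := 2) (i₀ := 1) (by omega)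
    (by push_cast; ring)
  obtain ⟨D, hD, hD'⟩ := HasVal.prod_block hn h2 hζ (a := -(4 * h + 2)) (c := -2) (i₀ := 0) (by omega)
    (by push_cast; ring)
  obtain ⟨E, hE, hE'⟩ := HasVal.prod_block hn h1 hζ (a := 4 * h + 2) (c := 2) (i₀ := 0) (by omega)
    (by push_cast; ring)
  obtain ⟨F, hF, hF'⟩ := HasVal.prod_block hn h1 hζ (a := -(4 * h)) (c := -1) (i₀ := 2 * h - 1) (by omega)
    (by push_cast [Nat.cast_sub (show 1 ≤ 2 * h by omega)]; ring)
  have hA2 : ∏ i ∈ range (2 * h + 1), (1 - q ^ (2 * i + 1)) = (1 - q ^ (2 * h + 1)) * A := by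
    rw [← hA']; refine prod_congr rfl fun i _ => ?_
    rw [← zpow_natCast]; congr 2; push_cast; ring
  have hB2 : ∏ i ∈ range (2 * h + 1), (1 - q ^ (2 * i + 2)) = (1 - q ^ (2 * h + 1)) * B := by
    rw [← hB']; refine prod_congr rfl fun i _ => ?_
    rw [← zpow_natCast]; congr 2; push_cast; ring
  have hC2 : ∏ i ∈ range (2 * h + 1), (1 - q ^ (2 * (i : ℤ) - 1) * q ^ (2 * h + 1 + 2 * h)) =
      (1 - q ^ (2 * h + 1)) * C := by
    rw [← hC']; refine prod_congr rfl fun i _ => ?_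
    rw [← zpow_natCast, ← zpow_add₀ q_ne_zero]; congr 2; push_cast; ring
  have hD2 : ∏ i ∈ range (2 * h + 1), (1 - q ^ (2 * (i : ℤ) - 1) / q ^ (2 * h + 1 + 2 * h)) =
      (1 - q ^ (2 * h + 1)) * D := by
    rw [← hD']; refine prod_congr rfl fun i _ => ?_
    rw [← zpow_natCast, ← zpow_sub₀ q_ne_zero]; congr 2; push_cast; ring
  have hE2 : ∏ i ∈ range (2 * h + 1), (1 - q ^ (i + 1) * q ^ (2 * h + 1 + 2 * h)) =
      (1 - q ^ (2 * h + 1)) * E := by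
    rw [← hE']; refine prod_congr rfl fun i _ => ?_
    rw [← zpow_natCast, ← zpow_natCast, ← zpow_add₀ q_ne_zero]; congr 2; push_cast; ring
  have hF2 : ∏ i ∈ range (2 * h + 1), (1 - q ^ (i + 1) / q ^ (2 * h + 1 + 2 * h)) =
      (1 - q ^ (2 * h + 1)) * F := by
    rw [← hF']; refine prod_congr rfl fun i _ => ?_
    rw [← zpow_natCast, ← zpow_natCast, ← zpow_sub₀ q_ne_zero]; congr 2; push_cast; ring
  have hpi : 1 - q ^ (2 * h + 1) ≠ 0 := sub_ne_zero.mpr (q_pow_ne_one _ hn).symm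
  rw [deformedSummand_eq_prod q_ne_zero q_pow_ne_one (pow_ne_zero _ q_ne_zero), summandCoeff]
  simp only [prod_div_distrib, prod_mul_distrib]
  rw [hA2, hB2, hC2, hD2, hE2, hF2]
  have hN : ((2 * h + 1 : ℕ) : ℂ) ≠ 0 := by exact_mod_cast hn.ne'
  have key : ∀ e : ℤ, ((2 * h + 1 : ℕ) : ℤ) ∣ e → ζ ^ e = 1 := fun e => (hζ.zpow_eq_one_iff_dvd e).mpr
  have h5 := (((HasVal.one_sub_q_zpow hz (3 * ((2 * h + 1 : ℕ) : ℤ) - 1)).div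
    ((HasVal.one ζ).sub (HasVal.var ζ)) (sub_ne_zero.mpr (hζ.ne_one (by omega)).symm)).mul
    (hA.div hB (by simpa using hN))).mul
    (HasVal.q_zpow hz ((3 * ((2 * h + 1 : ℕ) : ℤ) - ((2 * h + 1 : ℕ) : ℤ) ^ 2) / 2)) |>.mul
    ((hC.mul hD).div (hE.mul hF) (mul_ne_zero (mul_ne_zero (by norm_num) hN) (mul_ne_zero (by norm_num) hN)))
  convert h5 using 1
  · field_simp
  · have e1 : ζ ^ (3 * ((2 * h + 1 : ℕ) : ℤ) - 1) = ζ⁻¹ := by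
      rw [sub_eq_add_neg, zpow_add₀ hz, key _ (dvd_mul_left _ _), one_mul, zpow_neg_one]
    have e2 : ζ ^ ((3 * ((2 * h + 1 : ℕ) : ℤ) - ((2 * h + 1 : ℕ) : ℤ) ^ 2) / 2) = 1 := by
      refine key _ ⟨1 - h, Int.ediv_eq_of_eq_mul_right two_ne_zero ?_⟩
      push_cast; ring
    have h6 : 1 - ζ ≠ 0 := sub_ne_zero.mpr (hζ.ne_one (by omega)).symm
    rw [e1, e2]
    push_cast at hN ⊢
    field_simp
    ring

end Boundary

section Weights

section

variable {F : Type*} [Field F] {t : F}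

theorem symSum_ratio_left (h0 : t ≠ 0) (i m : ℕ) :
    (symSum t i - symSum t m) / (symSum t i - symSum t 0) =
      (1 - t ^ i / t ^ m) * (1 - t ^ i * t ^ m) / (1 - t ^ i) ^ 2 := by
  rw [symSum_sub_symSum h0, symSum_sub_symSum h0, pow_add, div_div_div_cancel_right₀ (pow_ne_zero _ h0),
    add_zero, pow_zero, div_one, ← pow_two]

theorem symSum_ratio_right (h0 : t ≠ 0) (m l : ℕ) :
    (symSum t 0 - symSum t l) / (symSum t m - symSum t l) =
      (1 - 1 / t ^ l) * (1 - t ^ l) * t ^ m / ((1 - t ^ m / t ^ l) * (1 - t ^ m * t ^ l)) := by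
  rw [symSum_sub_symSum h0, symSum_sub_symSum h0, pow_zero, zero_add, div_one, pow_add, div_div_eq_mul_div]

theorem weight_zero (h0 : t ≠ 0) (ht : ∀ k : ℕ, 0 < k → t ^ k ≠ 1) (h : ℕ) :
    weight t h 0 = ∏ a ∈ range h, (1 + (1 - t ^ (2 * h + 1)) ^ 3 *
      (t ^ (2 * a + 2) * (t ^ (2 * h + 1) * (t ^ (2 * a + 2)) ^ 2 - 1) / (t ^ (2 * h + 1) *
        (1 - t ^ (2 * a + 2)) ^ 3 * (1 - (t ^ (2 * h + 1)) ^ 2 * t ^ (2 * a + 2))))) := by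
  have herase : ∀ f : ℕ → F, ∏ b ∈ (range (h + 1)).erase 0, f b = ∏ a ∈ range h, f (a + 1) := by
    intro f
    have : (range (h + 1)).erase 0 = (range h).image (· + 1) := by
      ext x
      cases x <;> simp
    rw [this, prod_image (by simp)]
  rw [weight, herase, ← prod_mul_distrib]
  refine prod_congr rfl fun a _ => ?_
  rw [symSum_ratio_left h0, symSum_ratio_right h0]
  have h1 : 1 - t ^ (2 * a + 2) ≠ 0 := sub_ne_zero.mpr (ht _ (by omega)).symm
  have h2 : 1 - (t ^ (2 * h + 1)) ^ 2 * t ^ (2 * a + 2) ≠ 0 := by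
    rw [← pow_mul, ← pow_add]; exact sub_ne_zero.mpr (ht _ (by omega)).symm
  have h3 : t ^ (2 * h + 1 + 2 * 0) = t ^ (2 * h + 1) := rfl
  have h4 : t ^ (2 * h + 1 + 2 * (a + 1)) = t ^ (2 * h + 1) * t ^ (2 * a + 2) := by ring
  have hx : t ^ (2 * h + 1) ≠ 0 := pow_ne_zero _ h0
  have hy : t ^ (2 * a + 2) ≠ 0 := pow_ne_zero _ h0
  rw [h3, h4]
  generalize t ^ (2 * h + 1) = x at *
  generalize t ^ (2 * a + 2) = y at *
  have h5 : 1 - x / (x * y) = (y - 1) / y := by field_simp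
  have h7 : y - 1 = -(1 - y) := by ring
  rw [h5, h7, show 1 - x * (x * y) = 1 - x ^ 2 * y by ring]
  generalize hd : 1 - x ^ 2 * y = d at *
  field_simp
  rw [← hd]
  ring

theorem weight_succ (h0 : t ≠ 0) (ht : ∀ k : ℕ, 0 < k → t ^ k ≠ 1) {h l : ℕ} (hl : l < h) :
    weight t h (l + 1) = (1 - t ^ (2 * h + 1)) ^ 3 *
      (t ^ (2 * l + 2) * (1 - t ^ (2 * h + 1) * (t ^ (2 * l + 2)) ^ 2) / (t ^ (2 * h + 1) *
        (1 - t ^ (2 * l + 2)) ^ 3 * (1 - (t ^ (2 * h + 1)) ^ 2 * t ^ (2 * l + 2))) *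
      ∏ a ∈ (range h).erase l, (
        ((1 - t ^ (2 * a + 2) / t ^ (2 * h + 1 + 2 * (l + 1))) *
          (1 - t ^ (2 * a + 2) * t ^ (2 * h + 1 + 2 * (l + 1))) / (1 - t ^ (2 * a + 2)) ^ 2) *
        ((1 - 1 / t ^ (2 * h + 1 + 2 * (a + 1))) * (1 - t ^ (2 * h + 1 + 2 * (a + 1))) *
          t ^ (2 * h + 1 + 2 * (l + 1)) /
          ((1 - t ^ (2 * h + 1 + 2 * (l + 1)) / t ^ (2 * h + 1 + 2 * (a + 1))) *
          (1 - t ^ (2 * h + 1 + 2 * (l + 1)) * t ^ (2 * h + 1 + 2 * (a + 1))))))) := by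
  have herase : ∀ f : ℕ → F, ∏ b ∈ (range (h + 1)).erase (l + 1), f b =
      f 0 * ∏ a ∈ (range h).erase l, f (a + 1) := by
    intro f
    have := prod_erase_range_add f 1 h l
    simpa [add_comm] using this
  rw [weight, herase, ← mul_prod_erase (range h) _ (mem_range.mpr hl), prod_mul_distrib]
  simp only [symSum_ratio_left h0, symSum_ratio_right h0]
  rw [mul_mul_mul_comm, ← mul_assoc (_ ^ 3)]
  congr 1
  have h1 : 1 - t ^ (2 * l + 2) ≠ 0 := sub_ne_zero.mpr (ht _ (by omega)).symm
  have h2 : 1 - (t ^ (2 * h + 1)) ^ 2 * t ^ (2 * l + 2) ≠ 0 := by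
    rw [← pow_mul, ← pow_add]; exact sub_ne_zero.mpr (ht _ (by omega)).symm
  have h3 : t ^ (2 * h + 1 + 2 * 0) = t ^ (2 * h + 1) := rfl
  have h4 : t ^ (2 * h + 1 + 2 * (l + 1)) = t ^ (2 * h + 1) * t ^ (2 * l + 2) := by ring
  have hx : t ^ (2 * h + 1) ≠ 0 := pow_ne_zero _ h0
  have hy : t ^ (2 * l + 2) ≠ 0 := pow_ne_zero _ h0
  rw [h3, h4]
  generalize t ^ (2 * h + 1) = x at *
  generalize t ^ (2 * l + 2) = y at *
  have h5 : 1 - y / (x * y) = (x - 1) / x := by field_simp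
  have h6 : 1 - x * y / x = 1 - y := by field_simp
  rw [h5, h6, show 1 - x * y * x = 1 - x ^ 2 * y by ring]
  generalize hd : 1 - x ^ 2 * y = d at *
  field_simp
  ring

end

theorem HasVal.exists_prod_one_add {ι : Type*} {ζ : ℂ} {p : RatFunc ℚ} {v : ℂ} (hp : HasVal ζ p v)
    {s : Finset ι} {f : ι → RatFunc ℚ} (hf : ∀ i ∈ s, ∃ z, HasVal ζ (f i) z) :
    ∃ g w, HasVal ζ g w ∧ ∏ i ∈ s, (1 + p * f i) = 1 + p * g := by
  classical
  induction s using Finset.induction_on with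
  | empty => exact ⟨0, 0, HasVal.zero ζ, by simp⟩
  | insert a s ha ih =>
    obtain ⟨g, w, hg, hg'⟩ := ih fun i hi => hf i (mem_insert_of_mem hi)
    obtain ⟨z, h⟩ := hf a (mem_insert_self a s)
    refine ⟨f a + g + p * (f a * g), _, (h.add hg).add (hp.mul (h.mul hg)), ?_⟩
    rw [prod_insert ha, hg']
    ring

theorem HasVal.weight_zero {h : ℕ} {ζ : ℂ} (hζ : IsPrimitiveRoot ζ (2 * h + 1)) :
    ∃ g z, HasVal ζ g z ∧ weight q h 0 = 1 + (1 - q ^ (2 * h + 1)) ^ 3 * g := by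
  rw [_root_.weight_zero q_ne_zero q_pow_ne_one]
  have hx := (HasVal.var ζ).pow (2 * h + 1)
  have h1 := HasVal.one ζ
  refine HasVal.exists_prod_one_add ((h1.sub hx).pow 3) fun a ha => ?_
  have ha := mem_range.mp ha
  have hy := (HasVal.var ζ).pow (2 * a + 2)
  refine ⟨_, (hy.mul ((hx.mul (hy.pow 2)).sub h1)).div
    ((hx.mul ((h1.sub hy).pow 3)).mul (h1.sub ((hx.pow 2).mul hy))) ?_⟩
  have : 1 - ζ ^ (2 * a + 2) ≠ 0 :=
    sub_ne_zero.mpr (hζ.pow_ne_one_of_pos_of_lt (by omega) (by omega)).symm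
  simp only [hζ.pow_eq_one, one_pow, one_mul]
  exact mul_ne_zero (pow_ne_zero _ this) this

theorem HasVal.weight_succ {h l : ℕ} (hl : l < h) {ζ : ℂ} (hζ : IsPrimitiveRoot ζ (2 * h + 1)) :
    ∃ g, HasVal ζ g ((ζ ^ (l + 1)) ^ 2 * (1 + (ζ ^ (l + 1)) ^ 2) / (1 - (ζ ^ (l + 1)) ^ 2) ^ 3) ∧
      weight q h (l + 1) = (1 - q ^ (2 * h + 1)) ^ 3 * g := by
  have hz : ζ ≠ 0 := hζ.ne_zero (by omega)
  have h1 := HasVal.one ζ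
  have hx := (HasVal.var ζ).pow (2 * h + 1)
  have hne : ∀ a < h, 1 - ζ ^ (2 * a + 2) ≠ 0 := fun a ha =>
    sub_ne_zero.mpr (hζ.pow_ne_one_of_pos_of_lt (by omega) (by omega)).symm
  have hM : ∀ b, ζ ^ (2 * h + 1 + 2 * (b + 1)) = ζ ^ (2 * b + 2) := fun b => by
    rw [pow_add, hζ.pow_eq_one, one_mul, mul_add]
  rw [_root_.weight_succ q_ne_zero q_pow_ne_one hl]
  refine ⟨_, ?_, rfl⟩
  have hy := (HasVal.var ζ).pow (2 * l + 2)
  have hw := (HasVal.var ζ).pow (2 * h + 1 + 2 * (l + 1))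
  have hA := (hy.mul (h1.sub (hx.mul (hy.pow 2)))).div
    ((hx.mul ((h1.sub hy).pow 3)).mul (h1.sub ((hx.pow 2).mul hy))) (by
      simp only [hζ.pow_eq_one, one_pow, one_mul]
      exact mul_ne_zero (pow_ne_zero _ (hne l hl)) (hne l hl))
  have hB := HasVal.prod (ζ := ζ) (s := (range h).erase l) (z := fun _ => 1) (f := fun a =>
        ((1 - q ^ (2 * a + 2) / q ^ (2 * h + 1 + 2 * (l + 1))) *
          (1 - q ^ (2 * a + 2) * q ^ (2 * h + 1 + 2 * (l + 1))) / (1 - q ^ (2 * a + 2)) ^ 2) *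
        ((1 - 1 / q ^ (2 * h + 1 + 2 * (a + 1))) * (1 - q ^ (2 * h + 1 + 2 * (a + 1))) *
          q ^ (2 * h + 1 + 2 * (l + 1)) /
          ((1 - q ^ (2 * h + 1 + 2 * (l + 1)) / q ^ (2 * h + 1 + 2 * (a + 1))) *
          (1 - q ^ (2 * h + 1 + 2 * (l + 1)) * q ^ (2 * h + 1 + 2 * (a + 1)))))) ?_
  · convert hA.mul hB using 1
    have := hne l hl
    rw [prod_const_one, mul_one, hζ.pow_eq_one, ← pow_mul, show (l + 1) * 2 = 2 * l + 2 by ring]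
    generalize ζ ^ (2 * l + 2) = y at *
    field_simp
    ring
  · intro a ha
    obtain ⟨hal, ha⟩ := mem_erase.mp ha
    have ha := mem_range.mp ha
    have hv := (HasVal.var ζ).pow (2 * a + 2)
    have hu := (HasVal.var ζ).pow (2 * h + 1 + 2 * (a + 1))
    have hy0 : ζ ^ (2 * l + 2) ≠ 0 := pow_ne_zero _ hz
    have hv0 : ζ ^ (2 * a + 2) ≠ 0 := pow_ne_zero _ hz
    have e1 : 1 - ζ ^ (2 * l + 2) / ζ ^ (2 * a + 2) ≠ 0 := by
      rw [sub_ne_zero, ne_comm, ne_eq, div_eq_one_iff_eq hv0]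
      intro h
      have := hζ.pow_inj (by omega) (by omega) h
      omega
    have e2 : 1 - ζ ^ (2 * l + 2) * ζ ^ (2 * a + 2) ≠ 0 := by
      rw [sub_ne_zero, ne_comm, ne_eq, ← pow_add, hζ.pow_eq_one_iff_dvd]
      intro h
      rw [show 2 * l + 2 + (2 * a + 2) = 2 * (l + a + 2) by ring] at h
      have := (Nat.Coprime.dvd_of_dvd_mul_left (by simp) h)
      have := Nat.le_of_dvd (by omega) this
      omega
    have := ((((h1.sub (hv.div hw (pow_ne_zero _ hz))).mul (h1.sub (hv.mul hw))).div ((h1.sub hv).pow 2)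
      (pow_ne_zero _ (hne a ha))).mul ((((h1.sub (h1.div hu (pow_ne_zero _ hz))).mul (h1.sub hu)).mul
      hw).div ((h1.sub (hw.div hu (pow_ne_zero _ hz))).mul (h1.sub (hw.mul hu)))
      (by rw [hM, hM]; exact mul_ne_zero e1 e2)))
    convert this using 1
    rw [hM, hM]
    have e3 := hne a ha
    rw [one_sub_div hv0] at e1
    generalize ζ ^ (2 * l + 2) = y at *
    generalize ζ ^ (2 * a + 2) = v at *
    have e4 : v - y ≠ 0 := fun h => e1 (by rw [h, zero_div])
    rw [one_sub_div hy0, one_sub_div hv0, one_sub_div hv0, eq_comm, show y - v = -(v - y) by ring,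
      show v - 1 = -(1 - v) by ring, mul_comm y v]
    rw [mul_comm] at e2
    field_simp

end Weights

section RootSums

theorem one_sub_pow_three_mul_sum (N : ℂ) (w : ℂ) (m : ℕ) :
    (1 - w) ^ 3 * ∑ k ∈ range m, k * (N - k) * w ^ k =
      (1 - w) * w * (N - 1) - 2 * w ^ 2 -
        ((1 - w) ^ 2 * (m * (N - m)) + (1 - w) * w * (N - 2 * m - 1) - 2 * w ^ 2) * w ^ m := by
  induction m with
  | zero => simp
  | succ m ih =>
    rw [sum_range_succ, mul_add, ih]
    push_cast
    ring

theorem div_one_sub_sq_eq_sum {n : ℕ} (hn : 0 < n) {w : ℂ} (hw : w ^ n = 1) (h1 : w ≠ 1) :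
    w / (1 - w) ^ 2 = (∑ k ∈ range n, (k : ℂ) * (n - k) * w ^ k) / (2 * n) := by
  have h2 : 1 - w ≠ 0 := sub_ne_zero.mpr h1.symm
  have hN : (n : ℂ) ≠ 0 := by exact_mod_cast hn.ne'
  have h3 := one_sub_pow_three_mul_sum n w n
  rw [hw] at h3
  rw [div_eq_div_iff (pow_ne_zero _ h2) (mul_ne_zero two_ne_zero hN)]
  apply mul_left_cancel₀ h2
  linear_combination -h3

theorem sum_range_mul_sub (N : ℂ) (m : ℕ) :
    ∑ k ∈ range m, (k : ℂ) * (N - k) = N * (m * (m - 1)) / 2 - m * (m - 1) * (2 * m - 1) / 6 := by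
  induction m with
  | zero => simp
  | succ m ih =>
    rw [sum_range_succ, ih]
    push_cast
    ring

theorem sum_div_one_sub_sq {n : ℕ} {ξ : ℂ} (hξ : IsPrimitiveRoot ξ (n + 1)) :
    ∑ j ∈ range n, ξ ^ (j + 1) / (1 - ξ ^ (j + 1)) ^ 2 = -(((n + 1 : ℕ) : ℂ) ^ 2 - 1) / 12 := by
  have hN : ((n + 1 : ℕ) : ℂ) ≠ 0 := by exact_mod_cast n.succ_ne_zero
  have h1 : ∀ j ∈ range n, ξ ^ (j + 1) / (1 - ξ ^ (j + 1)) ^ 2 =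
      (∑ k ∈ range (n + 1), (k : ℂ) * ((n + 1 : ℕ) - k) * (ξ ^ (j + 1)) ^ k) / (2 * (n + 1 : ℕ)) := by
    intro j hj
    refine div_one_sub_sq_eq_sum n.succ_pos (by rw [← pow_mul, mul_comm, pow_mul, hξ.pow_eq_one, one_pow])
      (hξ.pow_ne_one_of_pos_of_lt j.succ_ne_zero ?_)
    have := mem_range.mp hj
    omega
  rw [sum_congr rfl h1, ← sum_div, sum_comm]
  have h2 : ∀ k ∈ range (n + 1), ∑ j ∈ range n, (k : ℂ) * ((n + 1 : ℕ) - k) * (ξ ^ (j + 1)) ^ k =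
      -((k : ℂ) * ((n + 1 : ℕ) - k)) := by
    intro k hk
    rcases Nat.eq_zero_or_pos k with rfl | hk0
    · simp
    have hne : ξ ^ k ≠ 1 := hξ.pow_ne_one_of_pos_of_lt hk0.ne' (mem_range.mp hk)
    have h3 : ∑ j ∈ range (n + 1), (ξ ^ k) ^ j = 0 := by
      rw [geom_sum_eq hne, ← pow_mul, mul_comm, pow_mul, hξ.pow_eq_one, one_pow, sub_self, zero_div]
    rw [sum_range_succ', pow_zero] at h3
    rw [← mul_sum]
    simp only [← pow_mul, mul_comm k] at h3 ⊢
    rw [eq_neg_of_add_eq_zero_left h3]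
    ring
  rw [sum_congr rfl h2, sum_neg_distrib, sum_range_mul_sub]
  field_simp
  push_cast
  ring

theorem sum_half_div_one_sub_sq {h : ℕ} {ξ : ℂ} (hξ : IsPrimitiveRoot ξ (2 * h + 1)) :
    ∑ j ∈ range h, ξ ^ (j + 1) / (1 - ξ ^ (j + 1)) ^ 2 = -(((2 * h + 1 : ℕ) : ℂ) ^ 2 - 1) / 24 := by
  have h0 : ξ ≠ 0 := hξ.ne_zero (by omega)
  have h1 := sum_div_one_sub_sq hξ
  rw [two_mul, sum_range_add, ← sum_range_reflect (fun j => ξ ^ (h + j + 1) / _)] at h1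
  have h2 : ∀ j ∈ range h, ξ ^ (h + (h - 1 - j) + 1) / (1 - ξ ^ (h + (h - 1 - j) + 1)) ^ 2 =
      ξ ^ (j + 1) / (1 - ξ ^ (j + 1)) ^ 2 := by
    intro j hj
    have hj := mem_range.mp hj
    have h3 : ξ ^ (h + (h - 1 - j) + 1) * ξ ^ (j + 1) = 1 := by
      rw [← pow_add, ← hξ.pow_eq_one]; congr 1; omega
    have h4 : 1 - ξ ^ (j + 1) ≠ 0 :=
      sub_ne_zero.mpr (hξ.pow_ne_one_of_pos_of_lt (by omega) (by omega)).symm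
    have h5 : ξ ^ (j + 1) ≠ 0 := pow_ne_zero _ h0
    rw [eq_inv_of_mul_eq_one_left h3]
    generalize ξ ^ (j + 1) = w at *
    rw [inv_eq_one_div, one_sub_div h5, show w - 1 = -(1 - w) by ring]
    field_simp
  rw [sum_congr rfl h2, ← two_mul] at h1
  rw [← two_mul] at h1
  linear_combination h1 / 2

theorem sum_weight_values {h : ℕ} {ζ : ℂ} (hζ : IsPrimitiveRoot ζ (2 * h + 1)) :
    ∑ j ∈ range h, ζ ^ (j + 1) * (1 + (ζ ^ (j + 1)) ^ 2) / (1 - (ζ ^ (j + 1)) ^ 2) ^ 2 =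
      (((2 * h + 1 : ℕ) : ℂ) ^ 2 - 1) / 24 := by
  have h1 := sum_half_div_one_sub_sq hζ
  have h2 := sum_half_div_one_sub_sq (hζ.pow_of_coprime 2 (by simp))
  have h3 : ∀ j ∈ range h, ζ ^ (j + 1) * (1 + (ζ ^ (j + 1)) ^ 2) / (1 - (ζ ^ (j + 1)) ^ 2) ^ 2 =
      ζ ^ (j + 1) / (1 - ζ ^ (j + 1)) ^ 2 -
        2 * ((ζ ^ 2) ^ (j + 1) / (1 - (ζ ^ 2) ^ (j + 1)) ^ 2) := by
    intro j hj
    have hj := mem_range.mp hj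
    have h4 : 1 - ζ ^ (j + 1) ≠ 0 :=
      sub_ne_zero.mpr (hζ.pow_ne_one_of_pos_of_lt (by omega) (by omega)).symm
    have h5 : 1 - ζ ^ (2 * (j + 1)) ≠ 0 :=
      sub_ne_zero.mpr (hζ.pow_ne_one_of_pos_of_lt (by omega) (by omega)).symm
    rw [pow_right_comm ζ 2]
    rw [mul_comm, pow_mul] at h5
    generalize ζ ^ (j + 1) = w at *
    have h6 : 1 + w ≠ 0 := fun h => h5 (by linear_combination (1 - w) * h)
    rw [show 1 - w ^ 2 = (1 - w) * (1 + w) by ring]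
    field_simp
    ring
  rw [sum_congr rfl h3, sum_sub_distrib, ← mul_sum, h1, h2]
  ring

end RootSums

section Main

/-- The right-hand side of the congruence. -/
noncomputable def closedForm (n : ℕ) : RatFunc ℚ :=
  qint n * q ^ (-(((n : ℤ) + 1) / 2)) - (1 + q) * (qint n) ^ 3 +
    ((n : RatFunc ℚ) ^ 2 - 1) * (1 - q) ^ 2 / 24 * (qint n) ^ 3 * q ^ (-(((n : ℤ) + 1) / 2))

theorem HasVal.weighted_sum {m : ℕ} {ζ : ℂ} (hζ : IsPrimitiveRoot ζ (2 * (m + 1) + 1)) :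
    ∃ g, HasVal ζ g (((((2 * (m + 1) + 1 : ℕ) : ℂ) ^ 2 - 1) / 24) / ((1 - ζ) * ζ ^ (m + 2)) -
        (1 + ζ) / (1 - ζ) ^ 3) ∧
      ∑ l ∈ range (m + 1), weight q (m + 1) (l + 1) *
        ((1 - q ^ (2 * (m + 1) + 1 + 2 * (l + 1))) / ((1 - q) * q ^ (m + 1 + 1 + (l + 1))) -
          if l + 1 = m + 1 then deformedSummand q (q ^ (2 * (m + 1) + 1 + 2 * (l + 1)))
            (2 * (m + 1) + 1) else 0) = (1 - q ^ (2 * (m + 1) + 1)) ^ 3 * g := by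
  have hz : ζ ≠ 0 := hζ.ne_zero (by omega)
  have h1 : 1 - ζ ≠ 0 := sub_ne_zero.mpr (hζ.ne_one (by omega)).symm
  choose! g hg hg' using fun (l : ℕ) (hl : l < m + 1) => HasVal.weight_succ hl hζ
  have hval : ∀ l, HasVal ζ
      ((1 - q ^ (2 * (m + 1) + 1 + 2 * (l + 1))) / ((1 - q) * q ^ (m + 1 + 1 + (l + 1))))
      ((1 - ζ ^ (2 * (m + 1) + 1 + 2 * (l + 1))) / ((1 - ζ) * ζ ^ (m + 1 + 1 + (l + 1)))) := fun l =>
    ((HasVal.one ζ).sub ((HasVal.var ζ).pow _)).div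
      (((HasVal.one ζ).sub (HasVal.var ζ)).mul ((HasVal.var ζ).pow _)) (mul_ne_zero h1 (pow_ne_zero _ hz))
  have hT : ∀ l, HasVal ζ (if l + 1 = m + 1 then
      deformedSummand q (q ^ (2 * (m + 1) + 1 + 2 * (l + 1))) (2 * (m + 1) + 1) else 0)
      (if l = m then -ζ⁻¹ else 0) := by
    intro l
    rcases eq_or_ne l m with rfl | hl
    · simpa using HasVal.deformedSummand_boundary (by omega) hζ
    · simpa [hl] using HasVal.zero ζ
  have hS := HasVal.sum (s := range (m + 1)) fun l hl =>
    (hg l (mem_range.mp hl)).mul ((hval l).sub (hT l))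
  refine ⟨_, Eq.mp (congrArg (HasVal ζ _) (Eq.symm ?_)) hS, ?_⟩
  rotate_left
  · rw [mul_sum]
    refine sum_congr rfl fun l hl => ?_
    rw [hg' l (mem_range.mp hl), mul_assoc]
  simp only [mul_sub, sum_sub_distrib, mul_ite, mul_zero, sum_ite_eq', mem_range, Nat.lt_succ_self,
    if_true]
  rw [← sum_weight_values hζ, sum_div]
  congr 1
  · refine sum_congr rfl fun l hl => ?_
    have hl := mem_range.mp hl
    have h2 : 1 - ζ ^ (2 * (l + 1)) ≠ 0 :=
      sub_ne_zero.mpr (hζ.pow_ne_one_of_pos_of_lt (by omega) (by omega)).symm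
    have h3 : ζ ^ (l + 1) ≠ 0 := pow_ne_zero _ hz
    rw [pow_add ζ _ (2 * (l + 1)), hζ.pow_eq_one, one_mul, pow_add ζ (m + 1 + 1),
      mul_comm 2 (l + 1), pow_mul]
    rw [mul_comm, pow_mul] at h2
    have h4 : ζ ^ (m + 2) ≠ 0 := pow_ne_zero _ hz
    rw [show m + 1 + 1 = m + 2 from rfl]
    generalize ζ ^ (m + 2) = u at *
    generalize ζ ^ (l + 1) = w at *
    generalize 1 - w ^ 2 = d at *
    field_simp
  · have h2 : (ζ ^ (m + 1)) ^ 2 = ζ⁻¹ := by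
      rw [← pow_mul]
      apply eq_inv_of_mul_eq_one_left
      rw [← pow_succ, ← hζ.pow_eq_one]
      congr 1
      ring
    rw [h2, inv_eq_one_div, one_sub_div hz, show ζ - 1 = -(1 - ζ) by ring]
    field_simp
    ring

/-- The congruence at a primitive `n`-th root of unity. -/
theorem HasVal.sum_summand_sub_closedForm {n : ℕ} (hn : 1 < n) (hodd : Odd n) {ζ : ℂ}
    (hζ : IsPrimitiveRoot ζ n) : ∃ g z, HasVal ζ g z ∧
      ∑ k ∈ range n, _root_.summand k - closedForm n = (1 - q ^ n) ^ 4 * g := by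
  obtain ⟨h, rfl⟩ := hodd
  obtain ⟨m, rfl⟩ : ∃ m, h = m + 1 := ⟨h - 1, by omega⟩
  have hz : ζ ≠ 0 := hζ.ne_zero (by omega)
  have h1 : 1 - ζ ≠ 0 := sub_ne_zero.mpr (hζ.ne_one (by omega)).symm
  obtain ⟨g, z, hg, hg'⟩ := HasVal.weight_zero hζ
  obtain ⟨S, hS, hS'⟩ := HasVal.weighted_sum hζ
  have hv := (HasVal.one ζ).div (((HasVal.one ζ).sub (HasVal.var ζ)).mul ((HasVal.var ζ).pow (m + 2)))
    (mul_ne_zero h1 (pow_ne_zero _ hz))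
  set v := 1 / ((1 - q) * q ^ (m + 2)) with hv_def
  have hR : HasVal ζ ((1 + q) / (1 - q) ^ 3 -
      ((((2 * (m + 1) + 1 : ℕ) : RatFunc ℚ) ^ 2 - 1) / 24) * v) ((1 + ζ) / (1 - ζ) ^ 3 -
      ((((2 * (m + 1) + 1 : ℕ) : ℂ) ^ 2 - 1) / 24) * (1 / ((1 - ζ) * ζ ^ (m + 2)))) := by
    refine ((((HasVal.one ζ).add (HasVal.var ζ)).div (((HasVal.one ζ).sub (HasVal.var ζ)).pow 3)
      (pow_ne_zero _ h1)).sub ((((((HasVal.natCast ζ _).pow 2).sub (HasVal.one ζ)).div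
      (by exact_mod_cast HasVal.natCast ζ 24) (by norm_num)).mul hv)))
  obtain ⟨E, e, hE, hE'⟩ := HasVal.exists_eq_mul (by omega) hζ (f := S + ((1 + q) / (1 - q) ^ 3 -
    ((((2 * (m + 1) + 1 : ℕ) : RatFunc ℚ) ^ 2 - 1) / 24) * v)) (by
      convert hS.add hR using 1; ring)
  refine ⟨g * v + E, _, (hg.mul hv).add hE, ?_⟩
  have hq1 : 1 - q ≠ 0 := by simpa using sub_ne_zero.mpr (q_pow_ne_one 1 one_pos).symm
  have hint : qint ((2 * (m + 1) + 1 : ℕ) : ℤ) = (1 - q ^ (2 * (m + 1) + 1)) / (1 - q) := by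
    rw [qint, zpow_natCast]
  have hexp : -((((2 * (m + 1) + 1 : ℕ) : ℤ) + 1) / 2) = -((m + 2 : ℕ) : ℤ) := by
    push_cast; omega
  simp only [summand_eq_deformedSummand]
  rw [sum_deformedSummand_one q_ne_zero q_pow_ne_one (by omega), sum_range_succ', hS', hg', closedForm,
    hint, hexp, zpow_neg, zpow_natCast, if_neg (by omega)]
  have hqm : q ^ (m + 2) ≠ 0 := pow_ne_zero _ q_ne_zero
  rw [← sub_eq_zero] at hE'
  simp only [mul_zero, add_zero, sub_zero, show m + 1 + 1 = m + 2 from rfl]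
  generalize q ^ (2 * (m + 1) + 1) = x at *
  have hSE : S = (1 - x) * E - ((1 + q) / (1 - q) ^ 3 -
    ((((2 * (m + 1) + 1 : ℕ) : RatFunc ℚ) ^ 2 - 1) / 24) * v) := by linear_combination hE'
  rw [hSE, hv_def]
  field_simp
  ring

end Main

section Global

theorem HasVal.closedForm {d n : ℕ} (hd : 1 < d) (hdn : d ∣ n) {ζ : ℂ} (hζ : IsPrimitiveRoot ζ d) :
    HasVal ζ (closedForm n) 0 := by
  have hz : ζ ≠ 0 := hζ.ne_zero (by omega)
  have h1 := HasVal.one ζ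
  have hv := HasVal.var ζ
  have hint : HasVal ζ (qint n) 0 := by
    have := (HasVal.one_sub_q_zpow hz n).div (h1.sub hv) (sub_ne_zero.mpr (hζ.ne_one hd).symm)
    rwa [zpow_natCast ζ, (hζ.pow_eq_one_iff_dvd n).mpr hdn, sub_self, zero_div] at this
  have hpow := HasVal.q_zpow hz (-(((n : ℤ) + 1) / 2))
  have h24 : HasVal ζ 24 24 := by exact_mod_cast HasVal.natCast ζ 24
  refine Eq.mp (congrArg (HasVal ζ _) ?_) (((hint.mul hpow).sub ((h1.add hv).mul (hint.pow 3))).add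
    (((((((HasVal.natCast ζ n).pow 2).sub h1).mul ((h1.sub hv).pow 2)).div h24 (by norm_num)).mul
      (hint.pow 3)).mul hpow))
  simp

theorem HasVal.sum_summand {d n : ℕ} (hd : 1 < d) (hodd : Odd d) (hdn : d ∣ n) {ζ : ℂ}
    (hζ : IsPrimitiveRoot ζ d) : HasVal ζ (∑ k ∈ range n, _root_.summand k) 0 := by
  obtain ⟨m, rfl⟩ := hdn
  refine HasVal.sum_summand_mul hd hodd hζ ?_ m
  obtain ⟨g, z, hg, h⟩ := HasVal.sum_summand_sub_closedForm hd hodd hζ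
  rw [sub_eq_iff_eq_add.mp h]
  convert ((((HasVal.one ζ).sub ((HasVal.var ζ).pow d)).pow 4).mul hg).add
    (HasVal.closedForm hd dvd_rfl hζ) using 1
  simp [hζ.pow_eq_one]

theorem qintPoly_eq_prod_cyclotomic {n : ℕ} (hn : 0 < n) :
    qintPoly n = ∏ d ∈ n.divisors.erase 1, cyclotomic d ℚ :=
  (prod_cyclotomic_eq_geom_sum hn ℚ).symm

theorem qintPoly_mul_cyclotomic_pow {n : ℕ} (hn : 1 < n) :
    qintPoly n * cyclotomic n ℚ ^ 3 =
      ∏ d ∈ n.divisors.erase 1, cyclotomic d ℚ ^ (if d = n then 4 else 1) := by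
  have hmem : n ∈ n.divisors.erase 1 := by simp; omega
  rw [qintPoly_eq_prod_cyclotomic (by omega), ← mul_prod_erase _ _ hmem, ← mul_prod_erase _ _ hmem,
    if_pos rfl, prod_congr rfl (g := fun d => cyclotomic d ℚ ^ (if d = n then 4 else 1))
      (s₂ := (n.divisors.erase 1).erase n) fun d hd => ?_]
  · ring
  · rw [if_neg (mem_erase.mp hd).1, pow_one]

end Global

theorem stmt_1 (n : ℕ) (hn : 1 < n) (hodd : Odd n) :
    ratCongr
      (∑ k ∈ Finset.range n,
        qint (3 * (k : ℤ) - 1) *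
          (qpoch q (q ^ 2) k * (qpoch (q ^ (-1 : ℤ)) (q ^ 2) k) ^ 2 /
            ((qpoch q q k) ^ 2 * qpoch (q ^ 2) (q ^ 2) k)) *
          q ^ ((3 * (k : ℤ) - (k : ℤ) ^ 2) / 2))
      (qint n * q ^ (-(((n : ℤ) + 1) / 2)) - (1 + q) * (qint n) ^ 3 +
        ((n : RatFunc ℚ) ^ 2 - 1) * (1 - q) ^ 2 / 24 * (qint n) ^ 3 * q ^ (-(((n : ℤ) + 1) / 2)))
      (qintPoly n * (Polynomial.cyclotomic n ℚ) ^ 3) := by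
  change _ ∣ (∑ k ∈ range n, summand k - closedForm n).num
  rw [qintPoly_mul_cyclotomic_pow hn]
  refine prod_dvd_of_coprime (fun a _ b _ hab => (cyclotomic.isCoprime_rat hab).pow) fun d hd => ?_
  obtain ⟨hd1, hd⟩ := mem_erase.mp hd
  have hdn := Nat.dvd_of_mem_divisors hd
  have hd0 : 0 < d := Nat.pos_of_mem_divisors hd
  have hζ := Complex.isPrimitiveRoot_exp d hd0.ne'
  split_ifs with h
  · subst h
    obtain ⟨g, z, hg, h⟩ := HasVal.sum_summand_sub_closedForm hn hodd hζ
    exact HasVal.cyclotomic_pow_dvd_num hd0 hζ hg h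
  · have hd2 : 1 < d := by omega
    have hval := (HasVal.sum_summand hd2 (hodd.of_dvd_nat hdn) hdn hζ).sub (HasVal.closedForm hd2 hdn hζ)
    rw [sub_zero] at hval
    obtain ⟨g, z, hg, h⟩ := HasVal.exists_eq_mul hd0 hζ hval
    exact HasVal.cyclotomic_pow_dvd_num hd0 hζ hg (by rw [pow_one]; exact h)
end

section
/- Let n > 3 be an odd integer. Then, modulo [n]·Φ_n(q)^3, the following q-congruence of rational functions holds: Σ_{k=0}^{n-1} [3k+5] · ((q;q^2)_k · (q^5;q^2)_k^2 / ((q;q)_k^2 · (q^2;q^2)_k)) · q^{-(k^2+9k)/2} ≡ [n]·q^{(5-n)/2} + (1+q)·q^3·[n]^3 + ((1+q^3)·q^4/(1+q+q^2)^2)·[n]^3 + ((n^2-1)(1-q)^2/24)·[n]^3·q^{(5-n)/2}. -/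
open Finset Polynomial

/-- `OrdGE p e f` says that the `p`-adic order of the rational function `f` is at least `e`. -/
def OrdGE (p : ℚ[X]) (e : ℤ) (f : RatFunc ℚ) : Prop :=
  ∃ a b : ℚ[X], ¬ p ∣ b ∧
    f * algebraMap ℚ[X] (RatFunc ℚ) b =
      algebraMap ℚ[X] (RatFunc ℚ) p ^ e * algebraMap ℚ[X] (RatFunc ℚ) a

namespace OrdGE

variable {p : ℚ[X]} {e e' : ℤ} {f g : RatFunc ℚ}

theorem algebraMap_ne_zero {a : ℚ[X]} (ha : a ≠ 0) : algebraMap ℚ[X] (RatFunc ℚ) a ≠ 0 :=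
  RatFunc.algebraMap_ne_zero ha

theorem zero (hp : Prime p) (e : ℤ) : OrdGE p e 0 :=
  ⟨0, 1, hp.not_dvd_one, by simp⟩

theorem of_polynomial (hp : Prime p) (a : ℚ[X]) : OrdGE p 0 (algebraMap ℚ[X] (RatFunc ℚ) a) :=
  ⟨a, 1, hp.not_dvd_one, by simp⟩

theorem add (hp : Prime p) (hf : OrdGE p e f) (hg : OrdGE p e g) : OrdGE p e (f + g) := by
  obtain ⟨a, b, hb, h⟩ := hf
  obtain ⟨a', b', hb', h'⟩ := hg
  refine ⟨a * b' + a' * b, b * b', fun hd => (hp.dvd_or_dvd hd).elim hb hb', ?_⟩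
  simp only [map_mul, map_add]
  linear_combination algebraMap ℚ[X] (RatFunc ℚ) b' * h + algebraMap ℚ[X] (RatFunc ℚ) b * h'

theorem mul (hp : Prime p) (hf : OrdGE p e f) (hg : OrdGE p e' g) :
    OrdGE p (e + e') (f * g) := by
  obtain ⟨a, b, hb, h⟩ := hf
  obtain ⟨a', b', hb', h'⟩ := hg
  refine ⟨a * a', b * b', fun hd => (hp.dvd_or_dvd hd).elim hb hb', ?_⟩
  rw [zpow_add₀ (algebraMap_ne_zero hp.ne_zero), map_mul, map_mul]
  calc _ = (f * algebraMap ℚ[X] (RatFunc ℚ) b) * (g * algebraMap ℚ[X] (RatFunc ℚ) b') := by ring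
    _ = _ := by rw [h, h']; ring

theorem mono (hp : Prime p) (h : e' ≤ e) (hf : OrdGE p e f) : OrdGE p e' f := by
  obtain ⟨a, b, hb, h1⟩ := hf
  obtain ⟨k, rfl⟩ := Int.le.dest h
  refine ⟨p ^ k * a, b, hb, ?_⟩
  rw [h1, zpow_add₀ (algebraMap_ne_zero hp.ne_zero), map_mul, map_pow, zpow_natCast]
  ring

theorem neg (hf : OrdGE p e f) : OrdGE p e (-f) := by
  obtain ⟨a, b, hb, h⟩ := hf
  exact ⟨-a, b, hb, by rw [map_neg, neg_mul, h]; ring⟩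

theorem sub (hp : Prime p) (hf : OrdGE p e f) (hg : OrdGE p e g) : OrdGE p e (f - g) := by
  rw [sub_eq_add_neg]
  exact hf.add hp hg.neg

theorem one (hp : Prime p) : OrdGE p 0 1 := by simpa using of_polynomial hp 1

theorem pow (hp : Prime p) (hf : OrdGE p e f) (k : ℕ) : OrdGE p (k * e) (f ^ k) := by
  induction k with
  | zero => simpa using one hp
  | succ k ih =>
    rw [pow_succ]
    convert ih.mul hp hf using 1
    push_cast; ring

theorem pow_zero (hp : Prime p) (hf : OrdGE p 0 f) (k : ℕ) : OrdGE p 0 (f ^ k) := by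
  simpa using hf.pow hp k

theorem mul_left (hp : Prime p) (hf : OrdGE p 0 f) (hg : OrdGE p e g) : OrdGE p e (f * g) := by
  simpa using hf.mul hp hg

theorem mul_right (hp : Prime p) (hf : OrdGE p e f) (hg : OrdGE p 0 g) : OrdGE p e (f * g) := by
  simpa using hf.mul hp hg

theorem sum (hp : Prime p) {ι : Type*} (s : Finset ι) (F : ι → RatFunc ℚ)
    (h : ∀ i ∈ s, OrdGE p e (F i)) : OrdGE p e (∑ i ∈ s, F i) :=
  Finset.sum_induction F (OrdGE p e) (fun _ _ ha hb => ha.add hp hb) (zero hp e) h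

theorem prod (hp : Prime p) {ι : Type*} (s : Finset ι) (F : ι → RatFunc ℚ) (E : ι → ℤ)
    (h : ∀ i ∈ s, OrdGE p (E i) (F i)) : OrdGE p (∑ i ∈ s, E i) (∏ i ∈ s, F i) := by
  classical
  induction s using Finset.induction_on with
  | empty => simpa using one hp
  | insert i s hi ih =>
    rw [Finset.sum_insert hi, Finset.prod_insert hi]
    exact (h i (mem_insert_self i s)).mul hp (ih fun j hj => h j (mem_insert_of_mem hj))

/-- A polynomial multiple `p ^ k * u` with `p ∤ u` has order exactly `k`. -/
theorem inv_polynomial {k : ℕ} {u : ℚ[X]} (hp : Prime p) (hu : ¬ p ∣ u) :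
    OrdGE p (-k) (algebraMap ℚ[X] (RatFunc ℚ) (p ^ k * u))⁻¹ := by
  refine ⟨1, u, hu, ?_⟩
  have h1 := algebraMap_ne_zero hp.ne_zero
  have h2 : algebraMap ℚ[X] (RatFunc ℚ) u ≠ 0 :=
    algebraMap_ne_zero (by rintro rfl; exact hu (dvd_zero p))
  rw [map_mul, map_pow, zpow_neg, zpow_natCast, map_one]
  field_simp

theorem pow_dvd_num (hp : Prime p) {k : ℕ} (hf : OrdGE p k f) : p ^ k ∣ f.num := by
  obtain ⟨a, b, hb, h⟩ := hf
  have h2 : f.num * b = p ^ k * (a * f.denom) := by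
    apply RatFunc.algebraMap_injective ℚ
    have hd : algebraMap ℚ[X] (RatFunc ℚ) f.denom ≠ 0 := algebraMap_ne_zero f.denom_ne_zero
    rw [zpow_natCast] at h
    rw [← RatFunc.num_div_denom f, div_mul_eq_mul_div, div_eq_iff hd] at h
    simp only [map_mul, map_pow]
    rw [h]; ring
  exact (hp.coprime_iff_not_dvd.2 hb).pow_left.dvd_of_dvd_mul_right ⟨_, h2⟩

end OrdGE

theorem one_sub_q_pow (j : ℕ) :
    1 - q ^ j = -algebraMap ℚ[X] (RatFunc ℚ) (X ^ j - 1) := by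
  simp [q, RatFunc.algebraMap_X]

theorem one_sub_q_pow_ne_zero {j : ℕ} (hj : j ≠ 0) : 1 - q ^ j ≠ 0 := by
  rw [one_sub_q_pow, neg_ne_zero]
  exact RatFunc.algebraMap_ne_zero (X_pow_sub_C_ne_zero (Nat.pos_of_ne_zero hj) 1)

section Cyclotomic

variable {d : ℕ}

theorem prime_cyclotomic (hd : 0 < d) : Prime (cyclotomic d ℚ) :=
  (cyclotomic.irreducible_rat hd).prime

theorem cyclotomic_dvd_iff (hd : 0 < d) (f : ℚ[X]) :
    cyclotomic d ℚ ∣ f ↔ aeval (Complex.exp (2 * Real.pi * Complex.I / d)) f = 0 := by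
  rw [cyclotomic_eq_minpoly_rat (Complex.isPrimitiveRoot_exp d hd.ne') hd, minpoly.dvd_iff]

theorem cyclotomic_dvd_X_pow_sub_one_iff (hd : 0 < d) (j : ℕ) :
    cyclotomic d ℚ ∣ X ^ j - 1 ↔ d ∣ j := by
  rw [cyclotomic_dvd_iff hd, ← (Complex.isPrimitiveRoot_exp d hd.ne').pow_eq_one_iff_dvd]
  simp [sub_eq_zero]

theorem ordGE_q (hd : 0 < d) : OrdGE (cyclotomic d ℚ) 0 q := by
  simpa [q, RatFunc.algebraMap_X] using OrdGE.of_polynomial (prime_cyclotomic hd) X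

theorem ordGE_q_inv (hd : 0 < d) : OrdGE (cyclotomic d ℚ) 0 q⁻¹ := by
  have h : ¬ cyclotomic d ℚ ∣ X := by
    rw [cyclotomic_dvd_iff hd]
    simp [Complex.exp_ne_zero]
  simpa [q, RatFunc.algebraMap_X] using
    OrdGE.inv_polynomial (k := 0) (prime_cyclotomic hd) h

theorem ordGE_one_sub (hd : 0 < d) (j : ℕ) :
    OrdGE (cyclotomic d ℚ) (if d ∣ j then 1 else 0) (1 - q ^ j) := by
  rw [one_sub_q_pow]
  split_ifs with h
  · obtain ⟨u, hu⟩ := (cyclotomic_dvd_X_pow_sub_one_iff hd j).2 h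
    rw [hu]
    refine OrdGE.neg ⟨u, 1, (prime_cyclotomic hd).not_dvd_one, by simp⟩
  · exact (OrdGE.of_polynomial (prime_cyclotomic hd) _).neg

theorem ordGE_one_sub_zero (hd : 0 < d) (j : ℕ) : OrdGE (cyclotomic d ℚ) 0 (1 - q ^ j) :=
  (ordGE_one_sub hd j).mono (prime_cyclotomic hd) (by split_ifs <;> simp)

theorem ordGE_one_sub_of_dvd (hd : 0 < d) {j : ℕ} (h : d ∣ j) :
    OrdGE (cyclotomic d ℚ) 1 (1 - q ^ j) := by
  simpa [h] using ordGE_one_sub hd j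

theorem ordGE_inv_one_sub (hd : 0 < d) {j : ℕ} (hj : j ≠ 0) :
    OrdGE (cyclotomic d ℚ) (-(if d ∣ j then 1 else 0)) (1 - q ^ j)⁻¹ := by
  have hp := prime_cyclotomic hd
  rw [one_sub_q_pow, inv_neg]
  split_ifs with h
  · obtain ⟨u, hu⟩ := (cyclotomic_dvd_X_pow_sub_one_iff hd j).2 h
    have hsep : (X ^ j - 1 : ℚ[X]).Separable := by
      simpa using separable_X_pow_sub_C (1 : ℚ) (by exact_mod_cast hj) one_ne_zero
    have hu' : ¬ cyclotomic d ℚ ∣ u := fun hdu =>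
      hp.not_isUnit (hsep.squarefree _ (hu ▸ mul_dvd_mul_left _ hdu))
    rw [hu]
    simpa using (OrdGE.inv_polynomial (k := 1) hp hu').neg
  · have h' := mt (cyclotomic_dvd_X_pow_sub_one_iff hd j).1 h
    simpa using (OrdGE.inv_polynomial (k := 0) hp h').neg

theorem ordGE_inv_one_sub_of_not_dvd (hd : 0 < d) {j : ℕ} (h : ¬ d ∣ j) :
    OrdGE (cyclotomic d ℚ) 0 (1 - q ^ j)⁻¹ := by
  have hj : j ≠ 0 := by rintro rfl; exact h (dvd_zero d)
  simpa [h] using ordGE_inv_one_sub hd hj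

theorem qpoch_pow_eq_prod (s t k : ℕ) :
    qpoch (q ^ s) (q ^ t) k = ∏ i ∈ range k, (1 - q ^ (s + t * i)) :=
  prod_congr rfl fun i _ => by rw [pow_add, pow_mul]

theorem qpoch_ne_zero {s : ℕ} (hs : s ≠ 0) (t k : ℕ) : qpoch (q ^ s) (q ^ t) k ≠ 0 := by
  rw [qpoch_pow_eq_prod]
  exact prod_ne_zero_iff.2 fun i _ => one_sub_q_pow_ne_zero (by omega)

theorem ordGE_qpoch (hd : 0 < d) (s t k : ℕ) :
    OrdGE (cyclotomic d ℚ) (k.count fun i => d ∣ s + t * i) (qpoch (q ^ s) (q ^ t) k) := by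
  rw [qpoch_pow_eq_prod, Nat.count_eq_card_filter_range, card_filter, Nat.cast_sum]
  refine OrdGE.prod (prime_cyclotomic hd) _ _ _ fun i _ => ?_
  simpa using ordGE_one_sub hd (s + t * i)

theorem ordGE_qpoch_inv (hd : 0 < d) {s : ℕ} (hs : s ≠ 0) (t k : ℕ) :
    OrdGE (cyclotomic d ℚ) (-(k.count fun i => d ∣ s + t * i : ℕ))
      (qpoch (q ^ s) (q ^ t) k)⁻¹ := by
  rw [qpoch_pow_eq_prod, Nat.count_eq_card_filter_range, card_filter, Nat.cast_sum,
    ← sum_neg_distrib, ← prod_inv_distrib]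
  refine OrdGE.prod (prime_cyclotomic hd) _ _ _ fun i _ => ?_
  simpa using ordGE_inv_one_sub hd (j := s + t * i) (by omega)

theorem dvd_add_two_mul_iff (hodd : Odd d) (s i : ℕ) :
    d ∣ s + 2 * i ↔ i ≡ s * (d / 2) [MOD d] := by
  obtain ⟨e, rfl⟩ := hodd
  have he : (2 * e + 1) / 2 = e := by omega
  have hc : IsCoprime ((2 * e + 1 : ℕ) : ℤ) 2 := ⟨1, -e, by push_cast; ring⟩
  have h : ((s + 2 * i : ℕ) : ℤ) = s * (2 * e + 1 : ℕ) - 2 * ((s * e : ℕ) - i) := by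
    push_cast; ring
  rw [he, Nat.modEq_iff_dvd, ← Int.natCast_dvd_natCast, h, dvd_sub_right (dvd_mul_left _ _)]
  exact ⟨hc.dvd_of_dvd_mul_left, fun h => h.mul_left 2⟩

theorem count_dvd_add_two_mul (hodd : Odd d) (s k : ℕ) :
    (k.count fun i => d ∣ s + 2 * i) =
      k / d + if s * (d / 2) % d < k % d then 1 else 0 := by
  simp only [dvd_add_two_mul_iff hodd]
  exact Nat.count_modEq_card _ hodd.pos _

theorem ordGE_qpoch_sq (hodd : Odd d) (s k : ℕ) :
    OrdGE (cyclotomic d ℚ) (k / d : ℕ) (qpoch (q ^ s) (q ^ 2) k) := by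
  refine (ordGE_qpoch hodd.pos s 2 k).mono (prime_cyclotomic hodd.pos) ?_
  rw [count_dvd_add_two_mul hodd]
  exact_mod_cast Nat.le_add_right _ _

theorem ordGE_qpoch_sq_of_dvd (hodd : Odd d) {s k : ℕ} (hs : d ∣ s) (hk : ¬ d ∣ k) :
    OrdGE (cyclotomic d ℚ) ((k / d : ℕ) + 1) (qpoch (q ^ s) (q ^ 2) k) := by
  have h : s * (d / 2) % d < k % d := by
    rw [Nat.mod_eq_zero_of_dvd (hs.mul_right _)]
    exact Nat.pos_of_ne_zero (mt Nat.dvd_of_mod_eq_zero hk)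
  simpa [count_dvd_add_two_mul hodd, h] using ordGE_qpoch hodd.pos s 2 k

theorem ordGE_qpoch_two_inv (hodd : Odd d) (k : ℕ) :
    OrdGE (cyclotomic d ℚ) (-(k / d : ℕ)) (qpoch (q ^ 2) (q ^ 2) k)⁻¹ := by
  have h : ¬ 2 * (d / 2) % d < k % d := by
    have h1 := Nat.mod_lt k hodd.pos
    obtain ⟨e, rfl⟩ := hodd
    have he : 2 * ((2 * e + 1) / 2) = 2 * e := by omega
    rw [he, Nat.mod_eq_of_lt (by omega)]
    omega
  simpa [count_dvd_add_two_mul hodd, h] using ordGE_qpoch_inv hodd.pos two_ne_zero 2 k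

theorem ordGE_qpoch_one_inv (hd : 0 < d) (k : ℕ) :
    OrdGE (cyclotomic d ℚ) (-(k / d : ℕ)) (qpoch q q k)⁻¹ := by
  have h : (k.count fun i => d ∣ 1 + 1 * i) = k / d := by
    simp only [one_mul, add_comm 1]
    rw [Nat.count_eq_card_filter_range, Nat.card_multiples]
  have h' := ordGE_qpoch_inv hd one_ne_zero 1 k
  rwa [h, pow_one] at h'

end Cyclotomic

/-- The part of the `k`-th summand that does not depend on the parameter `a`. -/
noncomputable def quadCoeff (k : ℕ) : RatFunc ℚ :=
  qpoch q (q ^ 2) k / ((qpoch q q k) ^ 2 * qpoch (q ^ 2) (q ^ 2) k) / q ^ k.choose 2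

/-- The truncated quadratic basic hypergeometric sum with parameter `a`. -/
noncomputable def quadSum (n : ℕ) (a : RatFunc ℚ) : RatFunc ℚ :=
  ∑ k ∈ range n, quadCoeff k * (1 - a * q ^ (3 * k)) * (qpoch a (q ^ 2) k) ^ 2 / a ^ k

/-- The boundary term in the recurrence of `quadSum` under `a ↦ a * q ^ 2`. -/
noncomputable def quadBoundary (k : ℕ) (a : RatFunc ℚ) : RatFunc ℚ :=
  quadCoeff k * (1 - q ^ (2 * k + 1)) * (1 + a * q ^ (k + 1)) *
    (qpoch (a * q ^ 2) (q ^ 2) k) ^ 2 / (a ^ k * q ^ (2 * k))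

theorem qpoch_zero (a b : RatFunc ℚ) : qpoch a b 0 = 1 := prod_range_zero _

theorem qpoch_succ (a b : RatFunc ℚ) (k : ℕ) :
    qpoch a b (k + 1) = qpoch a b k * (1 - a * b ^ k) := prod_range_succ _ _

theorem qpoch_succ' (a b : RatFunc ℚ) (k : ℕ) :
    qpoch a b (k + 1) = (1 - a) * qpoch (a * b) b k := by
  simp only [qpoch, prod_range_succ', pow_zero, mul_one, mul_comm (1 - a), pow_succ' b, mul_assoc]

theorem quadCoeff_zero : quadCoeff 0 = 1 := by simp [quadCoeff, qpoch_zero]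

theorem quadCoeff_succ (k : ℕ) :
    quadCoeff k * (1 - q ^ (2 * k + 1)) =
      quadCoeff (k + 1) * ((1 - q ^ (k + 1)) ^ 2 * (1 - q ^ (2 * k + 2)) * q ^ k) := by
  have h1 : qpoch q q k ≠ 0 := by simpa using qpoch_ne_zero one_ne_zero 1 k
  have h2 := qpoch_ne_zero two_ne_zero 2 k
  have h3 : 1 - q * q ^ k ≠ 0 := pow_succ' q k ▸ one_sub_q_pow_ne_zero (Nat.succ_ne_zero k)
  have h4 := one_sub_q_pow_ne_zero (j := 2 * k + 2) (by omega)
  have h5 := q_ne_zero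
  have e1 : q * (q ^ 2) ^ k = q ^ (2 * k + 1) := by ring
  have e2 : q ^ 2 * (q ^ 2) ^ k = q ^ (2 * k + 2) := by ring
  simp only [quadCoeff, qpoch_succ, Nat.choose_succ_succ' k 1, Nat.choose_one_right, pow_add q k,
    e1, e2, ← pow_succ']
  field_simp

theorem quadSum_succ (n : ℕ) (a : RatFunc ℚ) :
    quadSum (n + 1) a = quadSum n a +
      quadCoeff n * (1 - a * q ^ (3 * n)) * (qpoch a (q ^ 2) n) ^ 2 / a ^ n :=
  sum_range_succ _ _

theorem quadSum_succ_recurrence (k : ℕ) {a : RatFunc ℚ} (ha : a ≠ 0) :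
    quadSum (k + 1) (a * q ^ 2) - q * quadSum (k + 1) a = quadBoundary k a := by
  have hq := q_ne_zero
  induction k with
  | zero =>
    simp [quadSum, quadBoundary, quadCoeff_zero, qpoch_zero]
    ring
  | succ k ih =>
    rw [quadSum_succ (k + 1), quadSum_succ (k + 1)]
    have hb : quadBoundary k a = quadCoeff (k + 1) * ((1 - q ^ (k + 1)) ^ 2 *
        (1 - q ^ (2 * k + 2)) * q ^ k) * (1 + a * q ^ (k + 1)) *
          (qpoch (a * q ^ 2) (q ^ 2) k) ^ 2 / (a ^ k * q ^ (2 * k)) := by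
      rw [quadBoundary, quadCoeff_succ]
    rw [hb] at ih
    rw [mul_add q, add_sub_add_comm, ih, quadBoundary, qpoch_succ (a * q ^ 2), qpoch_succ' a]
    generalize quadCoeff (k + 1) = c
    generalize qpoch (a * q ^ 2) (q ^ 2) k = P
    simp only [mul_add, pow_add, mul_one, mul_pow, pow_mul' q _ k, pow_right_comm q 2 k]
    generalize hz : q ^ k = z
    have hz0 : z ≠ 0 := hz ▸ pow_ne_zero k hq
    generalize hw : a ^ k = w
    have hw0 : w ≠ 0 := hw ▸ pow_ne_zero k ha
    field_simp
    ring

theorem quadSum_recurrence {n : ℕ} (hn : 0 < n) {a : RatFunc ℚ} (ha : a ≠ 0) :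
    quadSum n (a * q ^ 2) = q * quadSum n a + quadBoundary (n - 1) a := by
  obtain ⟨k, rfl⟩ := Nat.exists_eq_succ_of_ne_zero hn.ne'
  rw [Nat.succ_eq_add_one, add_tsub_cancel_right, ← quadSum_succ_recurrence k ha]
  ring

section Divisibility

variable {d n : ℕ}

theorem ordGE_div_q_pow (hd : 0 < d) {e : ℤ} {f : RatFunc ℚ} (hf : OrdGE (cyclotomic d ℚ) e f)
    (j : ℕ) : OrdGE (cyclotomic d ℚ) e (f / q ^ j) := by
  have hp := prime_cyclotomic hd
  rw [div_eq_mul_inv, ← inv_pow]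
  exact hf.mul_right hp ((ordGE_q_inv hd).pow_zero hp j)

theorem ordGE_quadCoeff (hodd : Odd d) {k : ℕ} {e : ℤ}
    (h : OrdGE (cyclotomic d ℚ) e (qpoch q (q ^ 2) k)) :
    OrdGE (cyclotomic d ℚ) (e - 3 * (k / d : ℕ)) (quadCoeff k) := by
  have hp := prime_cyclotomic hodd.pos
  refine ordGE_div_q_pow hodd.pos ?_ _
  rw [div_eq_mul_inv, mul_inv, ← inv_pow]
  refine ((h.mul hp (((ordGE_qpoch_one_inv hodd.pos k).pow hp 2).mul hp
    (ordGE_qpoch_two_inv hodd k))).mono hp ?_)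
  push_cast
  linarith

theorem ordGE_quadCoeff_neg (hodd : Odd d) (k : ℕ) :
    OrdGE (cyclotomic d ℚ) (-(2 * (k / d : ℕ))) (quadCoeff k) := by
  have h := ordGE_qpoch_sq hodd 1 k
  rw [pow_one] at h
  exact (ordGE_quadCoeff hodd h).mono (prime_cyclotomic hodd.pos) (by linarith)

theorem ordGE_quadCoeff_pred_mul (hodd : Odd d) (hn : 0 < n) (hdn : d ∣ n) :
    OrdGE (cyclotomic d ℚ) (1 - 2 * ((n - 1) / d : ℕ))
      (quadCoeff (n - 1) * (1 - q ^ (2 * (n - 1) + 1))) := by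
  have hp := prime_cyclotomic hodd.pos
  have h := ordGE_qpoch_sq hodd 1 n
  have hs : qpoch q (q ^ 2) n = qpoch q (q ^ 2) (n - 1) * (1 - q ^ (2 * (n - 1) + 1)) := by
    conv_lhs => rw [← Nat.sub_add_cancel (Nat.one_le_of_lt hn), qpoch_succ]
    ring
  have hdiv : (n / d : ℕ) = (n - 1) / d + 1 := by
    obtain ⟨m, rfl⟩ := hdn
    obtain ⟨l, rfl⟩ := Nat.exists_eq_succ_of_ne_zero (pos_of_mul_pos_right hn (Nat.zero_le _)).ne'
    rw [Nat.mul_div_cancel_left _ hodd.pos, Nat.succ_eq_add_one, mul_add_one,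
      Nat.add_sub_assoc (show 1 ≤ d from hodd.pos), Nat.mul_add_div hodd.pos,
      Nat.div_eq_of_lt (Nat.sub_lt hodd.pos one_pos), add_zero]
  have e : quadCoeff (n - 1) * (1 - q ^ (2 * (n - 1) + 1)) =
      qpoch q (q ^ 2) n * ((qpoch q q (n - 1))⁻¹ ^ 2 * (qpoch (q ^ 2) (q ^ 2) (n - 1))⁻¹) /
        q ^ (n - 1).choose 2 := by
    rw [hs, quadCoeff, div_eq_mul_inv (qpoch q (q ^ 2) (n - 1)), mul_inv, inv_pow]
    ring
  rw [pow_one, hdiv] at h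
  rw [e]
  refine ordGE_div_q_pow hodd.pos ((h.mul hp (((ordGE_qpoch_one_inv hodd.pos _).pow hp 2).mul hp
    (ordGE_qpoch_two_inv hodd _))).mono hp ?_) _
  push_cast
  linarith

theorem ordGE_one_add_q_pow (hd : 0 < d) (j : ℕ) : OrdGE (cyclotomic d ℚ) 0 (1 + q ^ j) :=
  (OrdGE.one (prime_cyclotomic hd)).add (prime_cyclotomic hd)
    ((ordGE_q hd).pow_zero (prime_cyclotomic hd) j)

theorem ordGE_quadBoundary (hodd : Odd d) (hn : 0 < n) (hdn : d ∣ n) (s : ℕ) :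
    OrdGE (cyclotomic d ℚ) 1 (quadBoundary (n - 1) (q ^ s)) := by
  have hp := prime_cyclotomic hodd.pos
  have h1 := (ordGE_quadCoeff_pred_mul hodd hn hdn).mul hp
    ((ordGE_qpoch_sq hodd (s + 2) (n - 1)).pow hp 2)
  have h2 := (ordGE_one_add_q_pow hodd.pos (s + (n - 1 + 1))).mul_left hp h1
  rw [quadBoundary, ← pow_mul, ← pow_add, ← pow_add, ← pow_add]
  refine ordGE_div_q_pow hodd.pos ?_ _
  rw [mul_right_comm, mul_comm]
  exact h2.mono hp (by push_cast; linarith)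

theorem ordGE_quadSum_q_pow_self (hodd : Odd d) (hdn : d ∣ n) :
    OrdGE (cyclotomic d ℚ) 1 (quadSum n (q ^ n)) := by
  have hp := prime_cyclotomic hodd.pos
  refine OrdGE.sum hp _ _ fun k _ => ?_
  rw [← pow_mul, ← pow_add]
  refine ordGE_div_q_pow hodd.pos ?_ _
  by_cases hk : d ∣ k
  · exact (((ordGE_quadCoeff_neg hodd k).mul hp (ordGE_one_sub_of_dvd hodd.pos
      (hdn.add (hk.mul_left 3)))).mul hp ((ordGE_qpoch_sq hodd n k).pow hp 2)).mono hp
      (by push_cast; linarith)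
  · exact (((ordGE_quadCoeff_neg hodd k).mul hp (ordGE_one_sub_zero hodd.pos _)).mul hp
      ((ordGE_qpoch_sq_of_dvd hodd hdn hk).pow hp 2)).mono hp (by push_cast; linarith)

theorem ordGE_quadSum (hn : Odd n) (hdn : d ∣ n) {s : ℕ} (hs : Odd s) (hsn : s ≤ n) :
    OrdGE (cyclotomic d ℚ) 1 (quadSum n (q ^ s)) := by
  have hodd : Odd d := hn.of_dvd_nat hdn
  have hp := prime_cyclotomic hodd.pos
  obtain ⟨j, hj⟩ : ∃ j, n = s + 2 * j := by
    obtain ⟨a, rfl⟩ := hn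
    obtain ⟨b, rfl⟩ := hs
    exact ⟨a - b, by omega⟩
  induction j generalizing s with
  | zero =>
    obtain rfl : n = s := by omega
    exact ordGE_quadSum_q_pow_self hodd hdn
  | succ j ih =>
    have h1 := ih (s := s + 2) (hs.add_even even_two) (by omega) (by omega)
    have h2 : quadSum n (q ^ s) =
        q⁻¹ * (quadSum n (q ^ (s + 2)) - quadBoundary (n - 1) (q ^ s)) := by
      have hq := q_ne_zero
      rw [pow_add, quadSum_recurrence hn.pos (pow_ne_zero s hq)]
      field_simp
      ring
    rw [h2]
    exact (ordGE_q_inv hodd.pos).mul_left hp (h1.sub hp (ordGE_quadBoundary hodd hn.pos hdn s))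

end Divisibility

/-- The polynomial in the parameter `a` given by `a ^ m * quadSum (m + 1) a`. -/
noncomputable def quadPoly (m : ℕ) : (RatFunc ℚ)[X] :=
  ∑ k ∈ range (m + 1), C (quadCoeff k) * (1 - C (q ^ (3 * k)) * X) *
    (∏ i ∈ range k, (1 - C ((q ^ 2) ^ i) * X)) ^ 2 * X ^ (m - k)

/-- The polynomial in the parameter `a` given by `q ^ (2 * m) * a ^ m * quadBoundary m a`. -/
noncomputable def boundaryPoly (m : ℕ) : (RatFunc ℚ)[X] :=
  C (quadCoeff m * (1 - q ^ (2 * m + 1))) * (1 + C (q ^ (m + 1)) * X) *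
    (∏ i ∈ range m, (1 - C ((q ^ 2) ^ (i + 1)) * X)) ^ 2

theorem eval_quadPoly (m : ℕ) {a : RatFunc ℚ} (ha : a ≠ 0) :
    (quadPoly m).eval a = a ^ m * quadSum (m + 1) a := by
  rw [quadPoly, quadSum, eval_finsetSum, mul_sum]
  refine sum_congr rfl fun k hk => ?_
  have hk' : a ^ m = a ^ (m - k) * a ^ k := by
    rw [← pow_add, Nat.sub_add_cancel (Nat.lt_succ_iff.1 (mem_range.1 hk))]
  rw [hk']
  simp only [eval_mul, eval_C, eval_sub, eval_one, eval_X, eval_pow, eval_prod, qpoch,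
    mul_comm _ a]
  field_simp

theorem eval_boundaryPoly (m : ℕ) {a : RatFunc ℚ} (ha : a ≠ 0) :
    (boundaryPoly m).eval a = q ^ (2 * m) * a ^ m * quadBoundary m a := by
  have hq := q_ne_zero
  simp only [boundaryPoly, quadBoundary, eval_mul, eval_C, eval_add, eval_sub, eval_one, eval_X,
    eval_pow, eval_prod, qpoch, pow_succ' (q ^ 2), mul_comm _ a, mul_assoc a]
  field_simp

theorem natDegree_one_sub_C_mul_X_le (c : RatFunc ℚ) : (1 - C c * X).natDegree ≤ 1 := by
  compute_degree

theorem natDegree_prod_sq_le (k : ℕ) (c : ℕ → RatFunc ℚ) :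
    ((∏ i ∈ range k, (1 - C (c i) * X)) ^ 2).natDegree ≤ 2 * k := by
  refine natDegree_pow_le_of_le 2 ((natDegree_prod_le _ _).trans ?_)
  simpa using sum_le_card_nsmul (range k) _ 1 fun i _ => natDegree_one_sub_C_mul_X_le (c i)

theorem natDegree_quadPoly_le (m : ℕ) : (quadPoly m).natDegree ≤ 2 * m + 1 := by
  refine natDegree_sum_le_of_forall_le _ _ fun k hk => ?_
  have hk' := mem_range.1 hk
  refine (natDegree_mul_le_of_le (natDegree_mul_le_of_le
    ((natDegree_C_mul_le _ _).trans (natDegree_one_sub_C_mul_X_le _))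
      (natDegree_prod_sq_le k _)) (natDegree_X_pow_le _)).trans ?_
  omega

theorem natDegree_boundaryPoly_le (m : ℕ) : (boundaryPoly m).natDegree ≤ 2 * m + 1 := by
  have h : (1 + C (q ^ (m + 1)) * X : (RatFunc ℚ)[X]).natDegree ≤ 1 := by compute_degree
  exact (natDegree_mul_le_of_le ((natDegree_C_mul_le _ _).trans h)
    (natDegree_prod_sq_le m _)).trans (by omega)

theorem polynomial_ext_of_ne_zero {f g : (RatFunc ℚ)[X]} (h : ∀ a ≠ 0, f.eval a = g.eval a) :
    f = g :=
  eq_of_infinite_eval_eq f g <|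
    (Set.infinite_univ.sdiff (Set.finite_singleton 0)).mono fun a ha => h a ha.2

theorem quadPoly_comp (m : ℕ) :
    (quadPoly m).comp (C (q ^ 2) * X) - C (q ^ (2 * m + 1)) * quadPoly m = boundaryPoly m := by
  have hq := q_ne_zero
  refine polynomial_ext_of_ne_zero fun a ha => ?_
  simp only [eval_sub, eval_comp, eval_mul, eval_C, eval_X]
  rw [eval_quadPoly m (mul_ne_zero (pow_ne_zero 2 hq) ha), eval_quadPoly m ha,
    eval_boundaryPoly m ha, ← quadSum_succ_recurrence m ha, mul_comm (q ^ 2) a]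
  ring

theorem coeff_quadPoly_mul (m e : ℕ) :
    (quadPoly m).coeff e * (q ^ (2 * e) - q ^ (2 * m + 1)) = (boundaryPoly m).coeff e := by
  rw [← quadPoly_comp, coeff_sub, comp_C_mul_X_coeff, coeff_C_mul]
  ring

theorem reflect_boundaryPoly (m : ℕ) :
    (reflect (2 * m + 1) (boundaryPoly m)).comp (C (q ^ (2 * (m + 1))) * X) =
      C (q ^ ((m + 1) * (2 * m + 1))) * boundaryPoly m := by
  have hq := q_ne_zero
  refine polynomial_ext_of_ne_zero fun a ha => ?_
  set y := q ^ (2 * (m + 1)) * a with hy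
  have hy0 : y ≠ 0 := mul_ne_zero (pow_ne_zero _ hq) ha
  let _ := invertibleOfNonzero (inv_ne_zero hy0)
  have h := eval₂_reflect_mul_pow (RingHom.id _) y⁻¹ (2 * m + 1) (boundaryPoly m)
    (natDegree_boundaryPoly_le m)
  rw [invOf_eq_inv, inv_inv, inv_pow, ← div_eq_mul_inv, div_eq_iff (pow_ne_zero _ hy0)] at h
  simp only [eval_comp, eval_mul, eval_C, eval_X, ← hy]
  change eval y _ = eval y⁻¹ _ * _ at h
  rw [h]
  simp only [boundaryPoly, eval_mul, eval_C, eval_add, eval_sub, eval_one, eval_X, eval_pow,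
    eval_prod]
  have h1 : (∏ i ∈ range m, (1 - (q ^ 2) ^ (i + 1) * y⁻¹)) * y ^ m =
      (-1) ^ m * ∏ i ∈ range m, ((q ^ 2) ^ (i + 1) * (1 - (q ^ 2) ^ (m - 1 - i + 1) * a)) := by
    rw [← card_range m, ← prod_const, ← prod_const, card_range, ← prod_mul_distrib,
      ← prod_mul_distrib]
    refine prod_congr rfl fun i hi => ?_
    have hi' := mem_range.1 hi
    have h2 : y = (q ^ 2) ^ (i + 1) * (q ^ 2) ^ (m - 1 - i + 1) * a := by
      rw [hy, ← pow_add, ← pow_mul]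
      congr 2
      omega
    rw [sub_mul, mul_assoc, inv_mul_cancel₀ hy0]
    rw [h2]
    ring
  have h3 : ∏ i ∈ range m, (q ^ 2) ^ (i + 1) = q ^ (m * (m + 1)) := by
    rw [prod_pow_eq_pow_sum, ← pow_mul]
    congr 1
    have := sum_range_id_mul_two (m + 1)
    rw [sum_range_succ'] at this
    simp only [add_tsub_cancel_right, add_zero] at this
    linarith
  rw [prod_mul_distrib, h3, prod_range_reflect (fun i => 1 - (q ^ 2) ^ (i + 1) * a) m] at h1
  have h4 : (1 + q ^ (m + 1) * y⁻¹) * y = q ^ (m + 1) * (1 + q ^ (m + 1) * a) := by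
    rw [add_mul, mul_assoc, inv_mul_cancel₀ hy0, hy]
    ring
  set c := quadCoeff m * (1 - q ^ (2 * m + 1))
  set S := ∏ i ∈ range m, (1 - (q ^ 2) ^ (i + 1) * y⁻¹)
  set R := ∏ i ∈ range m, (1 - (q ^ 2) ^ (i + 1) * a)
  have h5 : ((-1 : RatFunc ℚ) ^ m) ^ 2 = 1 := by rw [← pow_mul, mul_comm, pow_mul]; simp
  calc c * (1 + q ^ (m + 1) * y⁻¹) * S ^ 2 * y ^ (2 * m + 1)
      = c * ((1 + q ^ (m + 1) * y⁻¹) * y) * (S * y ^ m) ^ 2 := by ring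
    _ = ((-1 : RatFunc ℚ) ^ m) ^ 2 * (q ^ ((m + 1) * (2 * m + 1)) *
          (c * (1 + q ^ (m + 1) * a) * R ^ 2)) := by rw [h1, h4]; ring
    _ = _ := by rw [h5, one_mul]

theorem coeff_boundaryPoly_reflect {m e : ℕ} (he : e ≤ 2 * m + 1) :
    (boundaryPoly m).coeff (2 * m + 1 - e) * q ^ (2 * (m + 1) * e) =
      q ^ ((m + 1) * (2 * m + 1)) * (boundaryPoly m).coeff e := by
  have h := congrArg (fun f => coeff f e) (reflect_boundaryPoly m)
  simpa only [comp_C_mul_X_coeff, coeff_reflect, revAt_le he, coeff_C_mul, ← pow_mul] using h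

theorem coeff_quadPoly_reflect {m e : ℕ} (he : e ≤ m) :
    (quadPoly m).coeff (2 * m + 1 - e) =
      -((quadPoly m).coeff e * q ^ (m * (2 * (m - e) + 1))) := by
  have hq := q_ne_zero
  obtain ⟨r, rfl⟩ := Nat.exists_eq_add_of_le he
  have h := coeff_boundaryPoly_reflect (m := e + r) (e := e) (by omega)
  rw [← coeff_quadPoly_mul, ← coeff_quadPoly_mul] at h
  rw [Nat.add_sub_cancel_left]
  have h1 : 2 * (e + r) + 1 - e = e + (2 * r + 1) := by omega
  rw [h1] at h ⊢
  generalize (quadPoly (e + r)).coeff (e + (2 * r + 1)) = u at *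
  generalize (quadPoly (e + r)).coeff e = v at *
  have hs := one_sub_q_pow_ne_zero (j := 2 * r + 1) (by omega)
  have h2 : q ^ (2 * (e + (2 * r + 1))) - q ^ (2 * (e + r) + 1) =
      -(q ^ (2 * e) * q ^ (2 * r + 1) * (1 - q ^ (2 * r + 1))) := by ring
  have h3 : q ^ (2 * e) - q ^ (2 * (e + r) + 1) = q ^ (2 * e) * (1 - q ^ (2 * r + 1)) := by ring
  have h4 : q ^ ((e + r + 1) * (2 * (e + r) + 1)) =
      q ^ (2 * (e + r + 1) * e) * (q ^ (2 * r + 1) * q ^ ((e + r) * (2 * r + 1))) := by ring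
  rw [h2, h3, h4] at h
  refine mul_left_cancel₀ (mul_ne_zero (mul_ne_zero (mul_ne_zero (pow_ne_zero (2 * e) hq)
    (pow_ne_zero (2 * r + 1) hq)) hs) (pow_ne_zero (2 * (e + r + 1) * e) hq)) ?_
  linear_combination -h

theorem sum_range_fold {M : Type*} [AddCommMonoid M] (f : ℕ → M) (m : ℕ) :
    ∑ e ∈ range (2 * m + 2), f e = ∑ e ∈ range (m + 1), (f e + f (2 * m + 1 - e)) := by
  rw [sum_add_distrib, show 2 * m + 2 = (m + 1) + (m + 1) by ring, sum_range_add,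
    ← sum_range_reflect (fun i => f (m + 1 + i))]
  congr 1
  refine sum_congr rfl fun i hi => congrArg f ?_
  have := mem_range.1 hi
  omega

theorem quadSum_q_eq_sum (m : ℕ) :
    q ^ m * quadSum (m + 1) q = ∑ e ∈ range (m + 1),
      (quadPoly m).coeff e * q ^ e * (1 - (q ^ (m + 1)) ^ (2 * (m - e) + 1)) := by
  rw [← eval_quadPoly m q_ne_zero, eval_eq_sum_range' (n := 2 * m + 2)
    (Nat.lt_succ_of_le (natDegree_quadPoly_le m)), sum_range_fold]
  refine sum_congr rfl fun e he => ?_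
  have he' := Nat.lt_succ_iff.1 (mem_range.1 he)
  rw [coeff_quadPoly_reflect he', show 2 * m + 1 - e = e + (2 * (m - e) + 1) by omega]
  ring

theorem mul_eval_derivative {f : (RatFunc ℚ)[X]} {N : ℕ} (hf : f.natDegree < N)
    (x : RatFunc ℚ) : x * (derivative f).eval x = ∑ e ∈ range N, f.coeff e * e * x ^ e := by
  conv_lhs => rw [f.as_sum_range_C_mul_X_pow' hf]
  rw [derivative_sum, eval_finsetSum, mul_sum]
  refine sum_congr rfl fun e _ => ?_
  rcases e with _ | e
  · simp
  · simp; ring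

theorem eval_derivative_mul_sq {f g : (RatFunc ℚ)[X]} {x : RatFunc ℚ} (h : f.eval x = 0) :
    (derivative (f ^ 2 * g)).eval x = 0 := by
  simp [derivative_mul, derivative_pow, h]

theorem eval_derivative_quadPoly_one (m : ℕ) : (derivative (quadPoly m)).eval 1 = -1 := by
  rw [quadPoly, derivative_sum, eval_finsetSum, sum_range_succ', sum_eq_zero]
  · simp [quadCoeff_zero, derivative_mul]
  · intro k _
    rw [prod_range_succ', mul_pow]
    rw [show ∀ a b c d : (RatFunc ℚ)[X], a * (b * c) * d = c * (a * b * d) by intros; ring]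
    exact eval_derivative_mul_sq (by simp)

theorem eval_derivative_quadPoly {m j : ℕ} (hj : j ≤ m) :
    q ^ ((2 * m + 1) * j) * ((q ^ 2)⁻¹ ^ j * (derivative (quadPoly m)).eval ((q ^ 2)⁻¹ ^ j)) =
      -1 := by
  have hq := q_ne_zero
  induction j with
  | zero => simp [eval_derivative_quadPoly_one]
  | succ j ih =>
    have h := congrArg (fun f => (derivative f).eval ((q ^ 2)⁻¹ ^ (j + 1))) (quadPoly_comp m)
    have h0 : (derivative (boundaryPoly m)).eval ((q ^ 2)⁻¹ ^ (j + 1)) = 0 := by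
      rw [boundaryPoly, ← mul_prod_erase _ _ (mem_range.2 hj), mul_pow, mul_left_comm]
      refine eval_derivative_mul_sq ?_
      simp [hq]
    have h1 : q ^ 2 * (q ^ 2)⁻¹ ^ (j + 1) = (q ^ 2)⁻¹ ^ j := by
      rw [pow_succ' _ j, mul_inv_cancel_left₀ (pow_ne_zero 2 hq)]
    simp only [derivative_sub, derivative_comp, derivative_C_mul, derivative_X, eval_sub, eval_mul,
      eval_comp, eval_C, eval_X, mul_one, h0, h1] at h
    rw [← ih (by omega), ← h1]
    rw [sub_eq_zero, ← h1] at h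
    rw [mul_add_one, pow_add]
    linear_combination -q ^ ((2 * m + 1) * j) * (q ^ 2)⁻¹ ^ (j + 1) * h

theorem sum_coeff_quadPoly (M : ℕ) :
    q ^ ((2 * (2 * M) + 1) * M) * ∑ e ∈ range (2 * M + 1),
      (quadPoly (2 * M)).coeff e * (q ^ (2 * M))⁻¹ ^ e * (2 * ((2 * M - e : ℕ) : RatFunc ℚ) + 1) =
        1 := by
  have hq := q_ne_zero
  have h := eval_derivative_quadPoly (m := 2 * M) (j := M) (by omega)
  rw [mul_eval_derivative (Nat.lt_succ_of_le (natDegree_quadPoly_le (2 * M))),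
    show (2 * (2 * M) + 1).succ = 2 * (2 * M) + 2 by rfl, sum_range_fold, inv_pow, ← pow_mul] at h
  rw [← neg_inj, ← h, ← mul_neg, ← sum_neg_distrib]
  congr 1
  refine sum_congr rfl fun e he => ?_
  obtain ⟨r, hr⟩ := Nat.exists_eq_add_of_le (Nat.lt_succ_iff.1 (mem_range.1 he))
  rw [coeff_quadPoly_reflect (by omega),
    show 2 * (2 * M) + 1 - e = e + (2 * (2 * M - e) + 1) by omega,
    pow_add _ e, pow_mul q (2 * M) (2 * (2 * M - e) + 1)]
  have hx : q ^ (2 * M) ≠ 0 := pow_ne_zero _ hq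
  generalize q ^ (2 * M) = x at *
  generalize 2 * M - e = t
  have hx1 : x ^ (2 * t + 1) * x⁻¹ ^ (2 * t + 1) = 1 := by
    rw [← mul_pow, mul_inv_cancel₀ hx, one_pow]
  push_cast
  linear_combination ((quadPoly (2 * M)).coeff e * x⁻¹ ^ e * (e + 2 * t + 1)) * hx1

namespace OrdGE

variable {p : ℚ[X]} {f g : RatFunc ℚ}

/-- The rational functions that are integral at `p`. -/
def subring (hp : Prime p) : Subring (RatFunc ℚ) where
  carrier := {f | OrdGE p 0 f}
  mul_mem' hf hg := mul_left hp hf hg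
  one_mem' := one hp
  add_mem' hf hg := add hp hf hg
  zero_mem' := zero hp 0
  neg_mem' hf := neg hf

theorem of_sub_one (hp : Prime p) (hf : OrdGE p 1 (f - 1)) : OrdGE p 0 f := by
  simpa using (hf.mono hp zero_le_one).add hp (one hp)

theorem mul_sub_one (hp : Prime p) (hf : OrdGE p 1 (f - 1)) (hg : OrdGE p 1 (g - 1)) :
    OrdGE p 1 (f * g - 1) := by
  rw [show f * g - 1 = f * (g - 1) + (f - 1) by ring]
  exact ((of_sub_one hp hf).mul_left hp hg).add hp hf

theorem pow_sub_one (hp : Prime p) (hf : OrdGE p 1 (f - 1)) (k : ℕ) :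
    OrdGE p 1 (f ^ k - 1) := by
  induction k with
  | zero => simpa using zero hp 1
  | succ k ih => exact pow_succ f k ▸ mul_sub_one hp ih hf

theorem prod_sub_one (hp : Prime p) {ι : Type*} (s : Finset ι) (F : ι → RatFunc ℚ)
    (h : ∀ i ∈ s, OrdGE p 1 (F i - 1)) : OrdGE p 1 (∏ i ∈ s, F i - 1) :=
  Finset.prod_induction F (fun f => OrdGE p 1 (f - 1)) (fun _ _ => mul_sub_one hp)
    (by simpa using zero hp 1) h

theorem inv_sub_one (hf : OrdGE p 1 (f - 1)) : OrdGE p 1 (f⁻¹ - 1) := by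
  obtain ⟨a, b, hb, h⟩ := hf
  rw [zpow_one] at h
  have hc : ¬ p ∣ p * a + b := by rwa [dvd_add_right (dvd_mul_right p a)]
  have h1 : f * algebraMap ℚ[X] (RatFunc ℚ) b = algebraMap ℚ[X] (RatFunc ℚ) (p * a + b) := by
    rw [map_add, map_mul]
    linear_combination h
  have hf0 : f ≠ 0 := by
    rintro rfl
    rw [zero_mul] at h1
    exact algebraMap_ne_zero (by rintro h0; exact hc (h0 ▸ dvd_zero p)) h1.symm
  refine ⟨-a, p * a + b, hc, ?_⟩
  rw [zpow_one, sub_mul, ← h1, inv_mul_cancel_left₀ hf0, h1, map_add, map_mul, map_neg]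
  ring

/-- Expansion of `N ^ (-r) * (1 - N ^ (2 * r + 1))` to fourth order in `1 - N`. -/
theorem one_sub_pow_sub (hp : Prime p) {N : RatFunc ℚ} (hN0 : N ≠ 0) (hN : OrdGE p 1 (1 - N))
    (r : ℕ) :
    OrdGE p 4 (N⁻¹ ^ r * (1 - N ^ (2 * r + 1)) -
      (2 * r + 1) * ((1 - N) + (1 - N) ^ 3 * (r * (r + 1) / 6))) := by
  have hN1 : OrdGE p 1 (N - 1) := by simpa using hN.neg
  induction r with
  | zero => simpa using zero hp 4
  | succ r ih =>
    set S := ∑ i ∈ range (r + 1), N ^ i with hSdef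
    have hS : 1 - N ^ (r + 1) = (1 - N) * S := (mul_neg_geom_sum N (r + 1)).symm
    have hS1 : OrdGE p 1 (S - ((r + 1 : ℕ) : RatFunc ℚ)) := by
      rw [show S - ((r + 1 : ℕ) : RatFunc ℚ) = ∑ i ∈ range (r + 1), (N ^ i - 1) by
        simp [sum_sub_distrib, hSdef]]
      exact sum hp _ _ fun i _ => pow_sub_one hp hN1 i
    have hr : OrdGE p 0 ((r + 1 : ℕ) : RatFunc ℚ) := by
      simpa using of_polynomial hp ((r + 1 : ℕ) : ℚ[X])
    have hS0 : OrdGE p 0 S := by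
      simpa using (hS1.mono hp zero_le_one).add hp hr
    have hI := pow_sub_one hp (inv_sub_one hN1) (r + 1)
    have h1 : OrdGE p 1 (N⁻¹ ^ (r + 1) * S ^ 2 - ((r + 1 : ℕ) : RatFunc ℚ) ^ 2) := by
      rw [show N⁻¹ ^ (r + 1) * S ^ 2 - ((r + 1 : ℕ) : RatFunc ℚ) ^ 2 =
        S ^ 2 * (N⁻¹ ^ (r + 1) - 1) + (S + (r + 1 : ℕ)) * (S - (r + 1 : ℕ)) by ring]
      exact ((hS0.pow_zero hp 2).mul_left hp hI).add hp ((hS0.add hp hr).mul_left hp hS1)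
    have h2 : OrdGE p 4 ((1 - N) ^ 3 *
        (N⁻¹ ^ (r + 1) * S ^ 2 - ((r + 1 : ℕ) : RatFunc ℚ) ^ 2)) := by
      simpa using (hN.pow hp 3).mul hp h1
    convert ih.add hp h2 using 1
    have h3 : N⁻¹ ^ r = N⁻¹ ^ (r + 1) * N := by
      rw [pow_succ, mul_assoc, inv_mul_cancel₀ hN0, mul_one]
    have h4 : N⁻¹ ^ (r + 1) * N ^ (r + 1) = 1 := by rw [← mul_pow, inv_mul_cancel₀ hN0, one_pow]
    rw [h3, show ∀ u : RatFunc ℚ, (1 - N) ^ 3 * (u * S ^ 2 - ((r + 1 : ℕ) : RatFunc ℚ) ^ 2) =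
      u * (1 - N) * ((1 - N) * S) ^ 2 - (1 - N) ^ 3 * ((r + 1 : ℕ) : RatFunc ℚ) ^ 2 by
        intros; ring, ← hS]
    push_cast
    linear_combination (2 * (1 - N)) * h4

end OrdGE

section Middle

variable {M : ℕ}

theorem ordGE_coeff_boundaryPoly (M e : ℕ) :
    OrdGE (cyclotomic (2 * M + 1) ℚ) 1 ((boundaryPoly (2 * M)).coeff e) := by
  have hn : 0 < 2 * M + 1 := by omega
  have hp := prime_cyclotomic hn
  set R := OrdGE.subring hp
  have hC (j : ℕ) : C (q ^ j) * X ∈ Polynomial.lifts R.subtype :=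
    mul_mem (C'_mem_lifts ⟨⟨q ^ j, (ordGE_q hn).pow_zero hp j⟩, rfl⟩) (X_mem_lifts _)
  have hl : (1 + C (q ^ (2 * M + 1)) * X) * (∏ i ∈ range (2 * M),
      (1 - C ((q ^ 2) ^ (i + 1)) * X)) ^ 2 ∈ Polynomial.lifts R.subtype := by
    refine mul_mem (add_mem (one_mem _) (hC _)) (pow_mem (prod_mem fun i _ => ?_) 2)
    rw [sub_eq_add_neg, ← neg_one_mul, ← pow_mul]
    refine add_mem (one_mem _) (mul_mem ?_ (hC _))
    simpa using C_mem_lifts R.subtype (-1)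
  obtain ⟨⟨c, hc⟩, hce⟩ := (lifts_iff_coeff_lifts _).1 hl e
  rw [boundaryPoly, mul_assoc, coeff_C_mul, ← hce]
  have h := ordGE_quadCoeff_pred_mul (odd_two_mul_add_one M) hn dvd_rfl
  rw [Nat.add_sub_cancel, Nat.div_eq_of_lt (by omega)] at h
  exact OrdGE.mul_right hp (by simpa using h) hc

theorem dvd_two_mul_sub_add_one_iff {e : ℕ} (he : e ≤ 2 * M) :
    2 * M + 1 ∣ 2 * (2 * M - e) + 1 ↔ e = M := by
  refine ⟨fun ⟨c, hc⟩ => ?_, fun h => ⟨1, by omega⟩⟩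
  have h1 : c < 2 := by
    by_contra! h
    nlinarith [Nat.mul_le_mul_left (2 * M + 1) h, Nat.sub_le (2 * M) e]
  interval_cases c <;> omega

theorem ordGE_coeff_quadPoly {e : ℕ} (he : e ≤ 2 * M) :
    OrdGE (cyclotomic (2 * M + 1) ℚ) (if e = M then 0 else 1) ((quadPoly (2 * M)).coeff e) := by
  have hn : 0 < 2 * M + 1 := by omega
  have hp := prime_cyclotomic hn
  have hs : 2 * (2 * M - e) + 1 ≠ 0 := by omega
  have h1 : (quadPoly (2 * M)).coeff e = (boundaryPoly (2 * M)).coeff e / q ^ (2 * e) *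
      (1 - q ^ (2 * (2 * M - e) + 1))⁻¹ := by
    have h2 : q ^ (2 * (2 * M) + 1) = q ^ (2 * e) * q ^ (2 * (2 * M - e) + 1) := by
      rw [← pow_add]
      congr 1
      omega
    rw [eq_mul_inv_iff_mul_eq₀ (one_sub_q_pow_ne_zero hs),
      eq_div_iff (pow_ne_zero _ q_ne_zero), ← coeff_quadPoly_mul, h2]
    ring
  rw [h1]
  refine ((ordGE_div_q_pow hn (ordGE_coeff_boundaryPoly M e) _).mul hp
    (ordGE_inv_one_sub hn hs)).mono hp ?_
  simp only [dvd_two_mul_sub_add_one_iff he]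
  split_ifs <;> simp

/-- The sum at `a = q` modulo the fourth power of the cyclotomic polynomial. -/
theorem ordGE_quadSum_q_sub (M : ℕ) :
    OrdGE (cyclotomic (2 * M + 1) ℚ) 4 (quadSum (2 * M + 1) q -
      q⁻¹ ^ M * ((1 - q ^ (2 * M + 1)) + (1 - q ^ (2 * M + 1)) ^ 3 * (M * (M + 1) / 6))) := by
  have hn : 0 < 2 * M + 1 := by omega
  have hp := prime_cyclotomic hn
  have hq := q_ne_zero
  set N := q ^ (2 * M + 1) with hNdef
  have hN0 : N ≠ 0 := pow_ne_zero _ hq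
  have hN : OrdGE (cyclotomic (2 * M + 1) ℚ) 1 (1 - N) := ordGE_one_sub_of_dvd hn dvd_rfl
  set η : ℕ → RatFunc ℚ := fun e => (quadPoly (2 * M)).coeff e * (q ^ (2 * M))⁻¹ ^ e with hη
  have hηo {e : ℕ} (he : e ≤ 2 * M) :
      OrdGE (cyclotomic (2 * M + 1) ℚ) (if e = M then 0 else 1) (η e) := by
    refine (ordGE_coeff_quadPoly he).mul_right hp ?_
    rw [← inv_pow]
    exact ((ordGE_q_inv hn).pow_zero hp _).pow_zero hp _
  have hA : quadSum (2 * M + 1) q = q⁻¹ ^ (2 * M) * N ^ (2 * M) * ∑ e ∈ range (2 * M + 1),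
      η e * (N⁻¹ ^ (2 * M - e) * (1 - N ^ (2 * (2 * M - e) + 1))) := by
    rw [← mul_right_inj' (pow_ne_zero (2 * M) hq), quadSum_q_eq_sum, ← mul_assoc, ← mul_assoc,
      ← mul_pow, mul_inv_cancel₀ hq, one_pow, one_mul, mul_sum]
    refine sum_congr rfl fun e he => ?_
    obtain ⟨r, hr⟩ := Nat.exists_eq_add_of_le (Nat.lt_succ_iff.1 (mem_range.1 he))
    have h1 : N ^ (2 * M) * N⁻¹ ^ (2 * M - e) = (q ^ (2 * M)) ^ e * q ^ e := by
      rw [show 2 * M - e = r by omega]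
      conv_lhs => rw [hr, pow_add, mul_assoc, ← mul_pow, mul_inv_cancel₀ hN0, one_pow, mul_one]
      rw [hNdef, pow_succ, mul_pow]
    have h2 : (q ^ (2 * M))⁻¹ ^ e * (q ^ (2 * M)) ^ e = 1 := by
      rw [← mul_pow, inv_mul_cancel₀ (pow_ne_zero _ hq), one_pow]
    rw [hη, ← hNdef]
    linear_combination (-(quadPoly (2 * M)).coeff e * (q ^ (2 * M))⁻¹ ^ e *
      (1 - N ^ (2 * (2 * M - e) + 1))) * h1 - (quadPoly (2 * M)).coeff e * q ^ e *
      (1 - N ^ (2 * (2 * M - e) + 1)) * h2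
  have hB : q⁻¹ ^ (2 * M) * N ^ (2 * M) * ∑ e ∈ range (2 * M + 1),
      η e * (2 * ((2 * M - e : ℕ) : RatFunc ℚ) + 1) = q⁻¹ ^ M := by
    have h1 : N ^ (2 * M) = q ^ ((2 * (2 * M) + 1) * M) * q ^ M := by
      rw [← pow_mul, ← pow_add]
      congr 1
      ring
    rw [h1, mul_comm (q ^ _) (q ^ M), mul_assoc, mul_assoc, sum_coeff_quadPoly, mul_one, two_mul M,
      pow_add, mul_assoc, ← mul_pow, inv_mul_cancel₀ hq, one_pow, mul_one]
  have hr (r : ℕ) : OrdGE (cyclotomic (2 * M + 1) ℚ) 0 (((2 * r + 1) *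
      (r * (r + 1) - M * (M + 1)) / 6 : ℚ) : RatFunc ℚ) := by
    simpa using OrdGE.of_polynomial hp (C ((2 * r + 1) * (r * (r + 1) - M * (M + 1)) / 6 : ℚ))
  have h1 : OrdGE (cyclotomic (2 * M + 1) ℚ) 4 (∑ e ∈ range (2 * M + 1), (η e *
      (N⁻¹ ^ (2 * M - e) * (1 - N ^ (2 * (2 * M - e) + 1)) - (2 * ((2 * M - e : ℕ) : RatFunc ℚ) + 1)
        * ((1 - N) + (1 - N) ^ 3 * ((2 * M - e : ℕ) * ((2 * M - e : ℕ) + 1) / 6))))) := by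
    refine OrdGE.sum hp _ _ fun e he => ?_
    refine ((hηo (Nat.lt_succ_iff.1 (mem_range.1 he))).mono hp ?_).mul_left hp
      (OrdGE.one_sub_pow_sub hp hN0 hN _)
    split_ifs <;> simp
  have h2 : OrdGE (cyclotomic (2 * M + 1) ℚ) 1 (∑ e ∈ range (2 * M + 1), (η e *
      (((2 * (2 * M - e : ℕ) + 1) * ((2 * M - e : ℕ) * ((2 * M - e : ℕ) + 1) - M * (M + 1)) / 6 :
        ℚ) : RatFunc ℚ))) := by
    refine OrdGE.sum hp _ _ fun e he => ?_
    by_cases heM : e = M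
    · rw [show 2 * M - e = M by omega]
      simpa using OrdGE.zero hp 1
    · simpa [heM] using (hηo (Nat.lt_succ_iff.1 (mem_range.1 he))).mul hp (hr (2 * M - e))
  have h3 := ((hN.pow hp 3).mul hp h2).mono hp (e' := 4) (by norm_num)
  have hK : OrdGE (cyclotomic (2 * M + 1) ℚ) 0 (q⁻¹ ^ (2 * M) * N ^ (2 * M)) :=
    ((ordGE_q_inv hn).pow_zero hp _).mul_left hp (((ordGE_q hn).pow_zero hp _).pow_zero hp _)
  convert hK.mul_left hp (h1.add hp h3) using 1
  rw [hA, ← hB, mul_assoc _ (∑ e ∈ _, _), ← mul_sub, sum_mul, mul_sum _ _ ((1 - N) ^ 3),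
    ← sum_sub_distrib, ← sum_add_distrib]
  congr 1
  refine sum_congr rfl fun e _ => ?_
  push_cast
  ring

end Middle

theorem qpoch_add (a b : RatFunc ℚ) (j k : ℕ) :
    qpoch a b (j + k) = qpoch a b j * qpoch (a * b ^ j) b k := by
  simp only [qpoch, prod_range_add, pow_add, mul_assoc]

theorem qpoch_q_two_mul (M : ℕ) :
    qpoch q q (2 * M) = qpoch q (q ^ 2) M * qpoch (q ^ 2) (q ^ 2) M := by
  induction M with
  | zero => simp [qpoch_zero]
  | succ M ih =>
    rw [show 2 * (M + 1) = 2 * M + 1 + 1 by ring, qpoch_succ, qpoch_succ, ih, qpoch_succ,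
      qpoch_succ]
    ring

section Boundary

variable {M : ℕ}

theorem ordGE_mul_q_pow_sub_one (M : ℕ) {j : ℕ} (hj : ¬ 2 * M + 1 ∣ j) :
    OrdGE (cyclotomic (2 * M + 1) ℚ) 1
      ((1 - q ^ (2 * M + 1) * q ^ j) / (1 - q ^ j) - 1) := by
  have hn : 0 < 2 * M + 1 := by omega
  have hp := prime_cyclotomic hn
  have hj0 : 1 - q ^ j ≠ 0 := one_sub_q_pow_ne_zero (by rintro rfl; exact hj (dvd_zero _))
  rw [show (1 - q ^ (2 * M + 1) * q ^ j) / (1 - q ^ j) - 1 =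
      (1 - q ^ (2 * M + 1)) * (q ^ j * (1 - q ^ j)⁻¹) by field_simp; ring]
  exact (ordGE_one_sub_of_dvd hn dvd_rfl).mul_right hp
    (((ordGE_q hn).pow_zero hp j).mul_left hp (ordGE_inv_one_sub_of_not_dvd hn hj))

theorem exists_qpoch_mul_eq (M : ℕ) {s : ℕ} (hs : s ≠ 0) (hs2 : s ≤ 2) :
    ∃ u, OrdGE (cyclotomic (2 * M + 1) ℚ) 1 (u - 1) ∧
      qpoch (q ^ (2 * M + 1) * q ^ s) (q ^ 2) M = qpoch (q ^ s) (q ^ 2) M * u := by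
  have hp := prime_cyclotomic (show 0 < 2 * M + 1 by omega)
  refine ⟨∏ i ∈ range M, (1 - q ^ (2 * M + 1) * q ^ (s + 2 * i)) / (1 - q ^ (s + 2 * i)),
    OrdGE.prod_sub_one hp _ _ fun i hi => ordGE_mul_q_pow_sub_one M fun h => ?_, ?_⟩
  · have := Nat.le_of_dvd (by omega) h
    have := mem_range.1 hi
    omega
  · rw [← pow_add, qpoch_pow_eq_prod, qpoch_pow_eq_prod, ← prod_mul_distrib]
    refine prod_congr rfl fun i _ => ?_
    rw [mul_div_cancel₀ _ (one_sub_q_pow_ne_zero (by omega)), ← pow_add, add_assoc]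

/-- The `q`-shifted factorials in the boundary term agree modulo the cyclotomic polynomial. -/
theorem exists_qpoch_eq (M : ℕ) : ∃ u v,
    OrdGE (cyclotomic (2 * M + 1) ℚ) 1 (u - 1) ∧ OrdGE (cyclotomic (2 * M + 1) ℚ) 1 (v - 1) ∧
      qpoch (q ^ 2) (q ^ 2) (2 * M) = qpoch q q (2 * M) * u ∧
      qpoch q (q ^ 2) (2 * M + 1) = qpoch q q (2 * M) * v * (1 - q ^ (2 * M + 1)) := by
  obtain ⟨u, hu, hu'⟩ := exists_qpoch_mul_eq M one_ne_zero one_le_two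
  obtain ⟨v, hv, hv'⟩ := exists_qpoch_mul_eq M two_ne_zero le_rfl
  refine ⟨u, v, hu, hv, ?_, ?_⟩
  · rw [pow_one] at hu'
    rw [two_mul, qpoch_add, ← two_mul, qpoch_q_two_mul, ← pow_mul,
      show q ^ 2 * q ^ (2 * M) = q ^ (2 * M + 1) * q by ring, hu']
    ring
  · rw [show 2 * M + 1 = M + (M + 1) by ring, qpoch_add, ← pow_mul, ← pow_succ', qpoch_succ',
      hv', qpoch_q_two_mul, show M + (M + 1) = 2 * M + 1 by ring]
    ring

theorem ordGE_quadBoundary_sub {s : ℕ} {w : RatFunc ℚ} (hs : ¬ 2 * M + 1 ∣ s)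
    (hw : OrdGE (cyclotomic (2 * M + 1) ℚ) 1 (w - 1))
    (h : qpoch (q ^ s * q ^ 2) (q ^ 2) (2 * M) * (1 - q ^ s) = qpoch q (q ^ 2) (2 * M + 1) * w) :
    OrdGE (cyclotomic (2 * M + 1) ℚ) 4 (quadBoundary (2 * M) (q ^ s) -
      q ^ (s + 1) * (1 + q ^ s) * (1 - q ^ (2 * M + 1)) ^ 3 / (1 - q ^ s) ^ 2) := by
  have hn : 0 < 2 * M + 1 := by omega
  have hp := prime_cyclotomic hn
  have hq := q_ne_zero
  obtain ⟨u, v, hu, hv, hC, hA⟩ := exists_qpoch_eq M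
  have hB0 : qpoch q q (2 * M) ≠ 0 := by simpa using qpoch_ne_zero one_ne_zero 1 (2 * M)
  have hC0 := qpoch_ne_zero two_ne_zero 2 (2 * M)
  have hu0 : u ≠ 0 := by
    rintro rfl
    exact hC0 (by rw [hC, mul_zero])
  have hs0 : 1 - q ^ s ≠ 0 := one_sub_q_pow_ne_zero (by rintro rfl; exact hs (dvd_zero _))
  have hN : OrdGE (cyclotomic (2 * M + 1) ℚ) 1 (1 - q ^ (2 * M + 1)) :=
    ordGE_one_sub_of_dvd hn dvd_rfl
  have hN1 : OrdGE (cyclotomic (2 * M + 1) ℚ) 1 (q ^ (2 * M + 1) - 1) := by simpa using hN.neg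
  have hU : OrdGE (cyclotomic (2 * M + 1) ℚ) 1
      (v ^ 3 * w ^ 2 * u⁻¹ * (q ^ (2 * M + 1))⁻¹ ^ (M + s + 1) - 1) :=
    OrdGE.mul_sub_one hp (OrdGE.mul_sub_one hp (OrdGE.mul_sub_one hp
      (OrdGE.pow_sub_one hp hv 3) (OrdGE.pow_sub_one hp hw 2)) (OrdGE.inv_sub_one hu))
      (OrdGE.pow_sub_one hp (OrdGE.inv_sub_one hN1) _)
  set U := v ^ 3 * w ^ 2 * u⁻¹ * (q ^ (2 * M + 1))⁻¹ ^ (M + s + 1) with hUdef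
  have hA' : qpoch q (q ^ 2) (2 * M) * (1 - q ^ (2 * (2 * M) + 1)) =
      qpoch q q (2 * M) * v * (1 - q ^ (2 * M + 1)) := by
    rw [← hA, qpoch_succ]
    ring
  have hD : qpoch (q ^ s * q ^ 2) (q ^ 2) (2 * M) =
      qpoch q q (2 * M) * v * (1 - q ^ (2 * M + 1)) * w / (1 - q ^ s) := by
    rw [eq_div_iff hs0, h, hA]
  have hch : (2 * M).choose 2 = M * (2 * M - 1) := by
    rw [Nat.choose_two_right, mul_assoc, Nat.mul_div_cancel_left _ two_pos]
  have hpow : q ^ (2 * M).choose 2 * ((q ^ s) ^ (2 * M) * q ^ (2 * (2 * M))) * q ^ (s + 1) =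
      (q ^ (2 * M + 1)) ^ (M + s + 1) := by
    rw [hch]
    simp only [← pow_mul, ← pow_add]
    congr 1
    rcases M with _ | M
    · ring
    · rw [show 2 * (M + 1) - 1 = 2 * M + 1 by omega]
      ring
  have key : quadBoundary (2 * M) (q ^ s) = q ^ (s + 1) * (1 - q ^ (2 * M + 1)) ^ 3 /
      (1 - q ^ s) ^ 2 * ((1 + q ^ s * q ^ (2 * M + 1)) * U) := by
    have e1 : quadCoeff (2 * M) * (1 - q ^ (2 * (2 * M) + 1)) =
        qpoch q q (2 * M) * v * (1 - q ^ (2 * M + 1)) /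
          (qpoch q q (2 * M) ^ 2 * (qpoch q q (2 * M) * u)) / q ^ (2 * M).choose 2 := by
      rw [← hA', quadCoeff, hC]
      ring
    rw [quadBoundary, e1, hD, hUdef, inv_pow, ← hpow]
    generalize qpoch q q (2 * M) = B at *
    generalize 1 - q ^ s = t at *
    generalize 1 - q ^ (2 * M + 1) = N at *
    field_simp
  rw [key, show ∀ c : RatFunc ℚ, q ^ (s + 1) * (1 - q ^ (2 * M + 1)) ^ 3 / (1 - q ^ s) ^ 2 * c -
      q ^ (s + 1) * (1 + q ^ s) * (1 - q ^ (2 * M + 1)) ^ 3 / (1 - q ^ s) ^ 2 =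
      (1 - q ^ (2 * M + 1)) ^ 3 * ((q ^ (s + 1) * (1 - q ^ s)⁻¹ ^ 2) * (c - (1 + q ^ s))) by
    intro c; field_simp]
  have h1 : OrdGE (cyclotomic (2 * M + 1) ℚ) 1
      ((1 + q ^ s * q ^ (2 * M + 1)) * U - (1 + q ^ s)) := by
    rw [show (1 + q ^ s * q ^ (2 * M + 1)) * U - (1 + q ^ s) =
      (1 + q ^ s * q ^ (2 * M + 1)) * (U - 1) - q ^ s * (1 - q ^ (2 * M + 1)) by ring]
    refine OrdGE.sub hp (OrdGE.mul_left hp ?_ hU) (((ordGE_q hn).pow_zero hp s).mul_left hp hN)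
    rw [← pow_add]
    exact ordGE_one_add_q_pow hn _
  exact ((hN.pow hp 3).mul hp ((((ordGE_q hn).pow_zero hp _).mul_left hp
    ((ordGE_inv_one_sub_of_not_dvd hn hs).pow_zero hp 2)).mul_left hp h1)).mono hp (by norm_num)

end Boundary

/-- The value of `quadSum (2 * M + 1) (q ^ 5)` modulo the fourth power of the cyclotomic
polynomial. -/
noncomputable def quadExpansion (M : ℕ) : RatFunc ℚ :=
  q ^ 2 * (q⁻¹ ^ M *
      ((1 - q ^ (2 * M + 1)) + (1 - q ^ (2 * M + 1)) ^ 3 * (M * (M + 1) / 6))) +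
    q ^ 3 * (1 + q) * (1 - q ^ (2 * M + 1)) ^ 3 / (1 - q) ^ 2 +
    q ^ 4 * (1 + q ^ 3) * (1 - q ^ (2 * M + 1)) ^ 3 / (1 - q ^ 3) ^ 2

/-- The sum at `a = q ^ 5` modulo the fourth power of the cyclotomic polynomial. -/
theorem ordGE_quadSum_q_pow_five_sub {M : ℕ} (hM : 2 ≤ M) :
    OrdGE (cyclotomic (2 * M + 1) ℚ) 4 (quadSum (2 * M + 1) (q ^ 5) - quadExpansion M) := by
  have hn : 0 < 2 * M + 1 := by omega
  have hp := prime_cyclotomic hn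
  have hq := q_ne_zero
  have h1 : ¬ 2 * M + 1 ∣ 1 := fun h => by have := Nat.le_of_dvd one_pos h; omega
  have h3 : ¬ 2 * M + 1 ∣ 3 := fun h => by have := Nat.le_of_dvd three_pos h; omega
  have h2 : ¬ 2 * M + 1 ∣ 2 * M + 2 := (Nat.dvd_add_right dvd_rfl).not.2 h1
  have hq1 : 1 - q ≠ 0 := by simpa using one_sub_q_pow_ne_zero one_ne_zero
  have e1 : qpoch (q ^ 1 * q ^ 2) (q ^ 2) (2 * M) * (1 - q ^ 1) =
      qpoch q (q ^ 2) (2 * M + 1) * 1 := by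
    rw [qpoch_succ', pow_one]
    ring
  have e3 : qpoch (q ^ 3 * q ^ 2) (q ^ 2) (2 * M) * (1 - q ^ 3) = qpoch q (q ^ 2) (2 * M + 1) *
      ((1 - q ^ (2 * M + 1) * q ^ 1) / (1 - q ^ 1) *
        ((1 - q ^ (2 * M + 1) * q ^ (2 * M + 2)) / (1 - q ^ (2 * M + 2)))) := by
    have h4 : 1 - q ^ (2 * M + 2) ≠ 0 := one_sub_q_pow_ne_zero (by omega)
    have h5 : qpoch (q ^ 3 * q ^ 2) (q ^ 2) (2 * M) * (1 - q ^ 3) =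
        qpoch (q ^ 3) (q ^ 2) (2 * M) * (1 - q ^ 3 * (q ^ 2) ^ (2 * M)) := by
      rw [← qpoch_succ, qpoch_succ', mul_comm]
    rw [h5, qpoch_succ', show q * q ^ 2 = q ^ 3 by ring, pow_one, ← pow_succ]
    field_simp
    ring
  have b1 := ordGE_quadBoundary_sub h1 (by simpa using OrdGE.zero hp 1) e1
  have b3 := ordGE_quadBoundary_sub h3 (OrdGE.mul_sub_one hp (ordGE_mul_q_pow_sub_one M h1)
    (ordGE_mul_q_pow_sub_one M h2)) e3
  rw [pow_one] at b1
  have hrec : quadSum (2 * M + 1) (q ^ 5) = q ^ 2 * quadSum (2 * M + 1) q +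
      q * quadBoundary (2 * M) q + quadBoundary (2 * M) (q ^ 3) := by
    rw [show q ^ 5 = q * q ^ 2 * q ^ 2 by ring,
      quadSum_recurrence hn (mul_ne_zero hq (pow_ne_zero 2 hq)),
      quadSum_recurrence hn hq, Nat.add_sub_cancel, show q * q ^ 2 = q ^ 3 by ring]
    ring
  rw [hrec, quadExpansion]
  convert ((((ordGE_q hn).pow_zero hp 2).mul_left hp (ordGE_quadSum_q_sub M)).add hp
    ((ordGE_q hn).mul_left hp b1)).add hp b3 using 1
  ring

theorem sum_qint_eq_quadSum (n : ℕ) :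
    ∑ k ∈ Finset.range n,
        qint (3 * k + 5) *
          (qpoch q (q ^ 2) k * (qpoch (q ^ 5) (q ^ 2) k) ^ 2 /
            ((qpoch q q k) ^ 2 * qpoch (q ^ 2) (q ^ 2) k)) *
          q ^ (-(((k : ℤ) ^ 2 + 9 * k) / 2)) = quadSum n (q ^ 5) / (1 - q) := by
  have h1 (k : ℕ) : (k : ℤ) ^ 2 = 2 * k.choose 2 + k := by
    induction k with
    | zero => simp
    | succ k ih =>
      rw [Nat.choose_succ_succ' k 1, Nat.choose_one_right]
      push_cast
      linarith
  rw [quadSum, sum_div]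
  refine sum_congr rfl fun k _ => ?_
  have h2 : ((k : ℤ) ^ 2 + 9 * k) / 2 = (k.choose 2 + 5 * k : ℕ) := by
    have := h1 k
    push_cast
    omega
  have h3 : (3 * k + 5 : ℤ) = (5 + 3 * k : ℕ) := by
    push_cast
    ring
  rw [h2, zpow_neg, zpow_natCast, qint, h3, zpow_natCast, quadCoeff, pow_add q 5, pow_add,
    pow_mul q 5 k]
  ring

theorem qint_expression_eq_quadExpansion (M : ℕ) :
    qint (2 * M + 1 : ℕ) * q ^ ((5 - ((2 * M + 1 : ℕ) : ℤ)) / 2) +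
        (1 + q) * q ^ 3 * (qint (2 * M + 1 : ℕ)) ^ 3 +
        (1 + q ^ 3) * q ^ 4 / (1 + q + q ^ 2) ^ 2 * (qint (2 * M + 1 : ℕ)) ^ 3 +
        (((2 * M + 1 : ℕ) : RatFunc ℚ) ^ 2 - 1) * (1 - q) ^ 2 / 24 * (qint (2 * M + 1 : ℕ)) ^ 3 *
          q ^ ((5 - ((2 * M + 1 : ℕ) : ℤ)) / 2) =
      quadExpansion M / (1 - q) := by
  have hq1 : 1 - q ≠ 0 := by simpa using one_sub_q_pow_ne_zero one_ne_zero
  have hq3 : 1 - q ^ 3 = (1 - q) * (1 + q + q ^ 2) := by ring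
  have hq2 : 1 + q + q ^ 2 ≠ 0 :=
    right_ne_zero_of_mul (hq3 ▸ one_sub_q_pow_ne_zero three_ne_zero)
  have hz : (5 - ((2 * M + 1 : ℕ) : ℤ)) / 2 = (2 : ℕ) - (M : ℕ) := by
    push_cast
    omega
  rw [hz, zpow_sub₀ q_ne_zero, zpow_natCast, zpow_natCast, qint, zpow_natCast,
    quadExpansion, hq3, inv_pow]
  have hM : q ^ M ≠ 0 := pow_ne_zero M q_ne_zero
  generalize 1 - q ^ (2 * M + 1) = N
  generalize q ^ M = x at *
  push_cast
  field_simp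
  ring

section Divisors

variable {M d : ℕ}

theorem ordGE_quadExpansion (hd : d ∣ 2 * M + 1) :
    OrdGE (cyclotomic d ℚ) 1 (quadExpansion M) := by
  have hd0 : 0 < d := Nat.pos_of_dvd_of_pos hd (by omega)
  have hp := prime_cyclotomic hd0
  have hN : OrdGE (cyclotomic d ℚ) 1 (1 - q ^ (2 * M + 1)) := ordGE_one_sub_of_dvd hd0 hd
  have hq := ordGE_q hd0
  have hi {j : ℕ} (hj : j ≠ 0) : OrdGE (cyclotomic d ℚ) (-1) (1 - q ^ j)⁻¹ :=
    (ordGE_inv_one_sub hd0 hj).mono hp (by split_ifs <;> simp)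
  have hc : OrdGE (cyclotomic d ℚ) 0 (M * (M + 1) / 6 : RatFunc ℚ) := by
    simpa using OrdGE.of_polynomial hp (C (M * (M + 1) / 6 : ℚ))
  have hb {j s t : ℕ} (hj : j ≠ 0) : OrdGE (cyclotomic d ℚ) 1
      (q ^ s * (1 + q ^ t) * (1 - q ^ (2 * M + 1)) ^ 3 / (1 - q ^ j) ^ 2) := by
    rw [div_eq_mul_inv, ← inv_pow]
    exact ((((hq.pow_zero hp s).mul_left hp (ordGE_one_add_q_pow hd0 t)).mul hp
      (hN.pow hp 3)).mul hp ((hi hj).pow hp 2)).mono hp (by norm_num)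
  refine ((OrdGE.mul_left hp (hq.pow_zero hp 2) (OrdGE.mul_left hp
    ((ordGE_q_inv hd0).pow_zero hp M) (hN.add hp ?_))).add hp ?_).add hp (hb three_ne_zero)
  · exact ((hN.pow hp 3).mul_right hp hc).mono hp (by norm_num)
  · simpa using hb (s := 3) (t := 1) one_ne_zero

theorem ordGE_div_one_sub_q (hd0 : 0 < d) (hd1 : d ≠ 1) {e : ℤ} {f : RatFunc ℚ}
    (hf : OrdGE (cyclotomic d ℚ) e f) : OrdGE (cyclotomic d ℚ) e (f / (1 - q)) := by
  have h := ordGE_inv_one_sub_of_not_dvd hd0 (Nat.dvd_one.not.2 hd1)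
  rw [pow_one] at h
  exact div_eq_mul_inv f _ ▸ hf.mul_right (prime_cyclotomic hd0) h

end Divisors

theorem qintPoly_mul_cyclotomic_dvd {n : ℕ} (hn : 1 < n) {g : ℚ[X]}
    (h4 : cyclotomic n ℚ ^ 4 ∣ g) (h1 : ∀ d, d ∣ n → d ≠ 1 → cyclotomic d ℚ ∣ g) :
    qintPoly n * cyclotomic n ℚ ^ 3 ∣ g := by
  have h : qintPoly n * cyclotomic n ℚ ^ 3 =
      ∏ d ∈ n.divisors.erase 1, cyclotomic d ℚ ^ (1 + if d = n then 3 else 0) := by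
    have hn' : n ∈ n.divisors.erase 1 :=
      mem_erase.2 ⟨by omega, Nat.mem_divisors_self n (by omega)⟩
    simp only [pow_add, pow_one, pow_ite, pow_zero, prod_mul_distrib, prod_ite_eq', if_pos hn',
      prod_cyclotomic_eq_geom_sum (show 0 < n by omega), qintPoly]
  rw [h]
  refine Finset.prod_dvd_of_coprime (fun d _ d' _ hdd => (cyclotomic.isCoprime_rat hdd).pow)
    fun d hd => ?_
  rw [mem_erase, Nat.mem_divisors] at hd
  split_ifs with hdn
  · rwa [hdn]
  · rw [add_zero, pow_one]
    exact h1 d hd.2.1 hd.1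

theorem stmt_2 (n : ℕ) (hn : 3 < n) (hodd : Odd n) :
    ratCongr
      (∑ k ∈ Finset.range n,
        qint (3 * k + 5) *
          (qpoch q (q ^ 2) k * (qpoch (q ^ 5) (q ^ 2) k) ^ 2 /
            ((qpoch q q k) ^ 2 * qpoch (q ^ 2) (q ^ 2) k)) *
          q ^ (-(((k : ℤ) ^ 2 + 9 * k) / 2)))
      (qint n * q ^ ((5 - (n : ℤ)) / 2) + (1 + q) * q ^ 3 * (qint n) ^ 3 +
        (1 + q ^ 3) * q ^ 4 / (1 + q + q ^ 2) ^ 2 * (qint n) ^ 3 +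
        ((n : RatFunc ℚ) ^ 2 - 1) * (1 - q) ^ 2 / 24 * (qint n) ^ 3 * q ^ ((5 - (n : ℤ)) / 2))
      (qintPoly n * (Polynomial.cyclotomic n ℚ) ^ 3) := by
  obtain ⟨M, rfl⟩ := hodd
  rw [ratCongr, sum_qint_eq_quadSum, qint_expression_eq_quadExpansion, ← sub_div]
  refine qintPoly_mul_cyclotomic_dvd (by omega) ?_ fun d hd hd1 => ?_
  · have hd0 : 0 < 2 * M + 1 := by omega
    exact OrdGE.pow_dvd_num (prime_cyclotomic hd0) (k := 4)
      (ordGE_div_one_sub_q hd0 (by omega) (ordGE_quadSum_q_pow_five_sub (by omega)))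
  · have hd0 : 0 < d := Nat.pos_of_dvd_of_pos hd (by omega)
    have hp := prime_cyclotomic hd0
    have h5 : Odd 5 := by decide
    simpa using OrdGE.pow_dvd_num hp (k := 1) (ordGE_div_one_sub_q hd0 hd1
      ((ordGE_quadSum (odd_two_mul_add_one M) hd h5 (by omega)).sub hp (ordGE_quadExpansion hd)))
end
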